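/- arXiv:2308.11118 — 6 statements merged into one kernel-verified Lean document; each statement's English description precedes it below -/
import Mathlib

section
/- Let m ≥ 1 and h ≥ 2 be integers, and let s ≥ 1 and rational polynomials p_0, ..., p_{s-1} represent the quasipolynomial b_{m,h}, i.e. b_{m,h}(t) = p_{t mod s}(t) for all positive integers t. Then (−1)^{m−1} · p_0(0) equals the number of combinatorial types of B_h-sets with m+1 markings, that is, the number of equivalence classes of real B_h-rulers of length 1 with m+1 markings under combinatorial equivalence. -/
/-- A ruler of length `t` with `m+1` markings: `0 = x 0 < x 1 < ⋯ < x m = t`. -/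
def IsRuler (m : ℕ) (t : ℤ) (x : Fin (m + 1) → ℤ) : Prop :=
  StrictMono x ∧ x 0 = 0 ∧ x (Fin.last m) = t

/-- A ruler is a `B_h`-set if any two distinct multisets of `h` markings have distinct sums. -/
def IsBhSet (m h : ℕ) (x : Fin (m + 1) → ℤ) : Prop :=
  ∀ r s : Multiset (Fin (m + 1)), Multiset.card r = h → Multiset.card s = h → r ≠ s →
    (r.map x).sum ≠ (s.map x).sum

/-- `b_{m,h}(t)`: the number of `B_h`-sets of length `t` with `m+1` markings. -/
noncomputable def bmh (m h : ℕ) (t : ℤ) : ℕ :=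
  Nat.card {x : Fin (m + 1) → ℤ // IsRuler m t x ∧ IsBhSet m h x}

/-- A real ruler of length `t` with `m+1` markings. -/
def IsRealRuler (m : ℕ) (t : ℝ) (y : Fin (m + 1) → ℝ) : Prop :=
  StrictMono y ∧ y 0 = 0 ∧ y (Fin.last m) = t

/-- A real `B_h`-ruler: any two distinct multisets of `h` markings have distinct sums. -/
def IsRealBhRuler (m h : ℕ) (y : Fin (m + 1) → ℝ) : Prop :=
  ∀ r s : Multiset (Fin (m + 1)), Multiset.card r = h → Multiset.card s = h → r ≠ s →
    (r.map y).sum ≠ (s.map y).sum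

/-- Combinatorial equivalence of real rulers as `B_h`-rulers: all strict inequalities
between sums of `h` markings agree. -/
def CombEquivBh (m h : ℕ) (y y' : Fin (m + 1) → ℝ) : Prop :=
  ∀ r s : Multiset (Fin (m + 1)), Multiset.card r = h → Multiset.card s = h →
    ((r.map y).sum < (s.map y).sum ↔ (r.map y').sum < (s.map y').sum)

/-- The setoid of combinatorial equivalence on a set of real rulers. -/
def bhSetoid (m h : ℕ) (P : (Fin (m + 1) → ℝ) → Prop) : Setoid {y : Fin (m + 1) → ℝ // P y} where
  r a b := CombEquivBh m h a.1 b.1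
  iseqv :=
    ⟨fun _ _ _ _ _ => Iff.rfl,
     fun hab r s hr hs => (hab r s hr hs).symm,
     fun hab hbc r s hr hs => (hab r s hr hs).trans (hbc r s hr hs)⟩

namespace BhRuler

open SignType Finset

lemma ncard_mul_mem_Ioo {P lo hi : ℤ} (hP : 0 < P) (h : lo < hi) :
    (({k : ℤ | lo < P * k ∧ P * k < hi}.ncard : ℕ) : ℤ) = -((-hi) / P) - lo / P - 1 := by
  have hset : {k : ℤ | lo < P * k ∧ P * k < hi} = ↑(Finset.Ioo (lo / P) (-((-hi) / P))) := by
    ext k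
    have h1 : lo / P < k ↔ lo < P * k := by
      rw [Int.ediv_lt_iff_lt_mul hP, mul_comm]
    have h2 : (-hi) / P < -k ↔ P * k < hi := by
      rw [Int.ediv_lt_iff_lt_mul hP]
      constructor <;> intro h <;> nlinarith
    simp only [Set.mem_ofPred_eq, Finset.coe_Ioo, Set.mem_Ioo, ← h1, ← h2]
    constructor <;> rintro ⟨h, h'⟩ <;> constructor <;> omega
  rw [hset, Set.ncard_coe_finset, Int.card_Ioo, Int.toNat_of_nonneg]
  have h1 : P * (lo / P) ≤ lo := Int.mul_ediv_self_le hP.ne'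
  have h2 : P * ((-hi) / P) ≤ -hi := Int.mul_ediv_self_le hP.ne'
  by_contra hcon
  have : 0 ≤ lo / P + (-hi) / P := by omega
  nlinarith

/-- A cell on which no breakpoint lies is an interval between two extremal breakpoints. -/
lemma cell_eq_Ioo {ι : Type*} {P : ℤ} {β : ι → ℤ} {σ : ι → SignType}
    (hσ : ∀ i, σ i ≠ 0) {i j : ι} (hi : σ i = 1) (hj : σ j = -1)
    (himax : ∀ i', σ i' = 1 → β i' ≤ β i) (hjmin : ∀ j', σ j' = -1 → β j ≤ β j') :
    {k : ℤ | ∀ i, sign (P * k - β i) = σ i} = {k : ℤ | β i < P * k ∧ P * k < β j} := by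
  ext k
  simp only [Set.mem_ofPred_eq]
  constructor
  · intro h
    have h1 := h i
    have h2 := h j
    rw [hi, sign_eq_one_iff] at h1
    rw [hj, sign_eq_neg_one_iff] at h2
    constructor <;> linarith
  · rintro ⟨h1, h2⟩ i'
    rcases h : σ i' with _ | _ | _
    · exact absurd h (hσ i')
    · have := hjmin i' h
      exact sign_eq_neg_one_iff.2 (by linarith)
    · have := himax i' h
      exact sign_eq_one_iff.2 (by linarith)

lemma ncard_cell_congr {ι : Type*} [Finite ι] {P : ℤ} {q : ℕ} (hP : 0 < P) {β β' : ι → ℤ}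
    (hcong : ∀ i, P * q ∣ β' i - β i)
    (hord : ∀ i j, sign (β i - β j) = sign (β' i - β' j)) {σ : ι → SignType}
    (hlo : ∃ i, σ i = 1) (hhi : ∃ i, σ i = -1) :
    ({k : ℤ | ∀ i, sign (P * k - β i) = σ i}.ncard : ZMod q) =
      ({k : ℤ | ∀ i, sign (P * k - β' i) = σ i}.ncard : ZMod q) := by
  by_cases h0 : ∃ i, σ i = 0
  · obtain ⟨i, hi⟩ := h0
    obtain ⟨u, hu⟩ := hcong i
    have himg : {k : ℤ | ∀ i, sign (P * k - β' i) = σ i} =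
        (fun k => k + q * u) '' {k : ℤ | ∀ i, sign (P * k - β i) = σ i} := by
      ext k
      simp only [Set.mem_ofPred_eq, Set.mem_image]
      constructor
      · intro h
        refine ⟨k - q * u, fun j => ?_, by ring⟩
        have hk := h i
        rw [hi, sign_eq_zero_iff] at hk
        rw [← h j, show P * k - β' j = β' i - β' j by linarith, ← hord]
        congr 1
        linear_combination hk + hu
      · rintro ⟨k, h, rfl⟩ j
        have hk := h i
        rw [hi, sign_eq_zero_iff] at hk
        rw [← h j, show P * k - β j = β i - β j by linarith, hord]
        congr 1
        linear_combination hk - hu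
    rw [himg, Set.ncard_image_of_injective _ (add_left_injective _)]
  · push Not at h0
    obtain ⟨i, hi, himax⟩ := Set.exists_max_image {i | σ i = 1} β (Set.toFinite _) hlo
    obtain ⟨j, hj, hjmin⟩ := Set.exists_min_image {i | σ i = -1} β (Set.toFinite _) hhi
    have hle : ∀ k l, β k ≤ β l → β' k ≤ β' l := by
      intro k l h
      by_contra hcon
      have h1 : sign (β' k - β' l) = 1 := sign_eq_one_iff.2 (by linarith)
      rw [← hord, sign_eq_one_iff] at h1
      linarith
    rw [cell_eq_Ioo h0 hi hj himax hjmin, cell_eq_Ioo h0 hi hj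
      (fun k hk => hle _ _ (himax k hk)) (fun k hk => hle _ _ (hjmin k hk))]
    by_cases hij : β i < β j
    · have hij' : β' i < β' j := by
        have h1 : sign (β i - β j) = -1 := sign_eq_neg_one_iff.2 (by linarith)
        rw [hord, sign_eq_neg_one_iff] at h1
        linarith
      have e1 := ncard_mul_mem_Ioo hP hij
      have e2 := ncard_mul_mem_Ioo hP hij'
      obtain ⟨u, hu⟩ := hcong i
      obtain ⟨v, hv⟩ := hcong j
      rw [show β' i = β i + P * (q * u) by linarith,
        show -β' j = -β j + P * (-(q * v)) by linarith,
        Int.add_mul_ediv_left _ _ hP.ne', Int.add_mul_ediv_left _ _ hP.ne'] at e2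
      rw [show β' i = β i + P * (q * u) by linarith]
      rw [← Int.cast_natCast, ← Int.cast_natCast (R := ZMod q) (Set.ncard _), e1, e2]
      push_cast
      simp
    · have hij' : ¬ β' i < β' j := not_lt.2 (hle _ _ (not_lt.1 hij))
      have hempty : ∀ {x y : ℤ}, ¬ x < y → {k : ℤ | x < P * k ∧ P * k < y} = ∅ := fun h =>
        Set.eq_empty_of_forall_notMem fun _ hk => h (hk.1.trans hk.2)
      rw [hempty hij, hempty hij']

/-- The lattice points of a cell in a fixed residue class, parametrised by the quotient. -/
lemma card_filter_residue {ι : Type*} {N t : ℤ} {M : ℕ} [NeZero M] (hN : 0 < N) {β : ι → ℤ}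
    {i₀ i₁ : ι} (h₀ : β i₀ = 0) (h₁ : β i₁ = N * t) {σ : ι → SignType} (hσ₀ : σ i₀ = 1)
    (hσ₁ : σ i₁ = -1) (r : ZMod M)
    [DecidablePred fun y : ℤ => (fun i => sign (N * y - β i), (y : ZMod M)) = (σ, r)] :
    #{y ∈ Finset.Ioo 0 t | (fun i => sign (N * y - β i), (y : ZMod M)) = (σ, r)} =
      {k : ℤ | ∀ i, sign (N * M * k - (β i - N * r.val)) = σ i}.ncard := by
  rw [← Set.ncard_coe_finset]
  have hinj : Function.Injective fun k : ℤ => (r.val : ℤ) + M * k := fun k l h => by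
    simpa [NeZero.ne M] using h
  rw [← Set.ncard_image_of_injective {k : ℤ | ∀ i, sign (N * M * k - (β i - N * r.val)) = σ i} hinj]
  congr 1
  ext y
  simp only [Finset.coe_filter, Finset.mem_Ioo, Prod.mk.injEq, Set.mem_ofPred_eq, Set.mem_image,
    funext_iff]
  constructor
  · rintro ⟨-, hs, hr⟩
    have hd : (M : ℤ) ∣ y - r.val := by
      rw [← ZMod.intCast_zmod_eq_zero_iff_dvd]
      simp [hr]
    obtain ⟨k, hk⟩ := hd
    refine ⟨k, fun i => ?_, by linarith⟩
    rw [← hs i]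
    congr 1
    linear_combination -N * hk
  · rintro ⟨k, hk, rfl⟩
    have hs : ∀ i, sign (N * (r.val + M * k) - β i) = σ i := fun i => by
      rw [← hk i]
      congr 1
      ring
    refine ⟨⟨?_, ?_⟩, hs, by simp⟩
    · have := hs i₀
      rw [hσ₀, h₀, sub_zero, sign_eq_one_iff] at this
      exact pos_of_mul_pos_right this hN.le
    · have := hs i₁
      rw [hσ₁, h₁, sign_eq_neg_one_iff] at this
      nlinarith

/-- A function on the lattice which only depends on the residues modulo `M` of the coordinates and
on the signs of finitely many linear functionals. -/
def IsTame {ι R : Type*} {n : ℕ} (a : ι → Fin n → ℤ) (M : ℕ) (f : (Fin n → ℤ) → R) : Prop :=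
  ∀ z z' : Fin n → ℤ, (∀ j, (M : ℤ) ∣ z' j - z j) →
    (∀ i, sign (a i ⬝ᵥ z) = sign (a i ⬝ᵥ z')) → f z = f z'

/-- For each functional `a i`, the functional on the remaining coordinates whose value is `N`
times the zero of `a i` as a function of the first coordinate; also `0` and `N` times the last
coordinate. -/
def breakpoint {ι : Type*} {n : ℕ} (N : ℤ) (a : ι → Fin (n + 2) → ℤ) :
    ι ⊕ Bool → Fin (n + 1) → ℤ
  | .inl i => -(N / a i 0) • Fin.tail (a i)
  | .inr false => 0
  | .inr true => Pi.single (Fin.last n) N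

/-- The functionals controlling sums over the first coordinate. -/
def projFamily {ι : Type*} {n : ℕ} (N : ℤ) (a : ι → Fin (n + 2) → ℤ) :
    ι ⊕ (ι ⊕ Bool) × (ι ⊕ Bool) → Fin (n + 1) → ℤ
  | .inl i => Fin.tail (a i)
  | .inr (u, v) => breakpoint N a u - breakpoint N a v

lemma dotProduct_cons {n : ℕ} (a : Fin (n + 1) → ℤ) (y : ℤ) (x : Fin n → ℤ) :
    a ⬝ᵥ (Fin.cons y x : Fin (n + 1) → ℤ) = a 0 * y + Fin.tail a ⬝ᵥ x := by
  simp [dotProduct, Fin.sum_univ_succ, Fin.tail]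

lemma sign_dotProduct_cons_congr {ι : Type*} {n : ℕ} {N : ℤ} {a : ι → Fin (n + 2) → ℤ} (hN : 0 < N)
    {i : ι} (hdvd : a i 0 ≠ 0 → a i 0 ∣ N) {x x' : Fin (n + 1) → ℤ} {y y' : ℤ}
    (htail : sign (Fin.tail (a i) ⬝ᵥ x) = sign (Fin.tail (a i) ⬝ᵥ x'))
    (hbr : sign (N * y - breakpoint N a (.inl i) ⬝ᵥ x) =
      sign (N * y' - breakpoint N a (.inl i) ⬝ᵥ x')) :
    sign (a i ⬝ᵥ (Fin.cons y x : Fin (n + 2) → ℤ)) =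
      sign (a i ⬝ᵥ (Fin.cons y' x' : Fin (n + 2) → ℤ)) := by
  simp only [dotProduct_cons]
  by_cases h0 : a i 0 = 0
  · simpa [h0] using htail
  · obtain ⟨d, hd⟩ := hdvd h0
    have hdiv : N / a i 0 = d := by rw [hd, Int.mul_ediv_cancel_left _ h0]
    have hd0 : d ≠ 0 := by
      rintro rfl
      simp at hd
      exact hN.ne' hd
    have key : ∀ (y : ℤ) (x : Fin (n + 1) → ℤ), N * y - breakpoint N a (.inl i) ⬝ᵥ x =
        d * (a i 0 * y + Fin.tail (a i) ⬝ᵥ x) := by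
      intro y x
      simp only [breakpoint, hdiv, neg_smul, neg_dotProduct, smul_dotProduct, smul_eq_mul]
      rw [hd]
      ring
    rw [key, key, sign_mul, sign_mul] at hbr
    exact mul_left_cancel₀ (by simpa [sign_eq_zero_iff] using hd0) hbr

lemma isTame_sum {ι : Type*} [Finite ι] {n : ℕ} {N : ℤ} {M q : ℕ} {a : ι → Fin (n + 2) → ℤ}
    (hN : 0 < N) (hM : 0 < M) (hdvd : ∀ i, a i 0 ≠ 0 → a i 0 ∣ N)
    {f : (Fin (n + 2) → ℤ) → ZMod q} (hf : IsTame a M f) :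
    IsTame (projFamily N a) (N.toNat * M * q)
      (fun x => ∑ y ∈ Finset.Ioo 0 (x (Fin.last n)), f (Fin.cons y x)) := by
  classical
  have := Fintype.ofFinite ι
  have : NeZero M := ⟨hM.ne'⟩
  intro x x' hmod hsign
  have hNn : ((N.toNat : ℕ) : ℤ) = N := Int.toNat_of_nonneg hN.le
  push_cast [hNn] at hmod
  set β : (Fin (n + 1) → ℤ) → ι ⊕ Bool → ℤ := fun x u => breakpoint N a u ⬝ᵥ x with hβ
  set key : (Fin (n + 1) → ℤ) → ℤ → (ι ⊕ Bool → SignType) × ZMod M :=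
    fun x y => (fun u => sign (N * y - β x u), (y : ZMod M)) with hkey
  have h₀ : ∀ x, β x (.inr false) = 0 := fun x => by simp [hβ, breakpoint]
  have h₁ : ∀ x, β x (.inr true) = N * x (Fin.last n) := fun x => by simp [hβ, breakpoint]
  have hfeq : ∀ z z' : Fin (n + 1) → ℤ, (∀ j, (M : ℤ) ∣ z' j - z j) →
      (∀ i, sign (Fin.tail (a i) ⬝ᵥ z) = sign (Fin.tail (a i) ⬝ᵥ z')) → ∀ y y', key z y = key z' y' →
      f (Fin.cons y z) = f (Fin.cons y' z') := by
    intro z z' hz hs y y' hyy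
    simp only [hkey, Prod.mk.injEq, funext_iff] at hyy
    refine hf _ _ (fun j => ?_) fun i => ?_
    · induction j using Fin.cases with
      | zero =>
        simp only [Fin.cons_zero]
        rw [← ZMod.intCast_zmod_eq_zero_iff_dvd]
        simp [hyy.2]
      | succ j => simpa using hz j
    · exact sign_dotProduct_cons_congr hN (hdvd i) (hs i) (hyy.1 _)
  have hmodM : ∀ j, (M : ℤ) ∣ x' j - x j := fun j =>
    (Dvd.intro_left _ (by ring : N * q * M = N * M * q)).trans (hmod j)
  have htail : ∀ i, sign (Fin.tail (a i) ⬝ᵥ x) = sign (Fin.tail (a i) ⬝ᵥ x') :=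
    fun i => hsign (.inl i)
  simp only
  rw [← Finset.sum_fiberwise _ (key x), ← Finset.sum_fiberwise _ (key x')]
  refine Finset.sum_congr rfl ?_
  rintro ⟨σ, r⟩ -
  obtain ⟨v, hv, hv'⟩ : ∃ v, (∀ y, key x y = (σ, r) → f (Fin.cons y x) = v) ∧
      (∀ y, key x' y = (σ, r) → f (Fin.cons y x') = v) := by
    by_cases h : ∃ y, key x y = (σ, r)
    · obtain ⟨y₀, hy₀⟩ := h
      exact ⟨f (Fin.cons y₀ x), fun y hy => hfeq _ _ (by simp) (fun _ => rfl) _ _ (hy.trans hy₀.symm),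
        fun y hy => (hfeq _ _ hmodM htail _ _ (hy₀.trans hy.symm)).symm⟩
    · by_cases h' : ∃ y, key x' y = (σ, r)
      · obtain ⟨y₀, hy₀⟩ := h'
        exact ⟨f (Fin.cons y₀ x'), fun y hy => (h ⟨y, hy⟩).elim,
          fun y hy => hfeq _ _ (by simp) (fun _ => rfl) _ _ (hy.trans hy₀.symm)⟩
      · exact ⟨0, fun y hy => (h ⟨y, hy⟩).elim, fun y hy => (h' ⟨y, hy⟩).elim⟩
  rw [Finset.sum_congr rfl fun y hy => hv y (Finset.mem_filter.1 hy).2,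
    Finset.sum_congr rfl fun y hy => hv' y (Finset.mem_filter.1 hy).2, Finset.sum_const,
    Finset.sum_const, nsmul_eq_mul, nsmul_eq_mul]
  congr 1
  by_cases hσ : σ (.inr false) = 1 ∧ σ (.inr true) = -1
  · rw [card_filter_residue hN (h₀ x) (h₁ x) hσ.1 hσ.2 r,
      card_filter_residue hN (h₀ x') (h₁ x') hσ.1 hσ.2 r]
    refine ncard_cell_congr (by positivity) (fun u => ?_) (fun u v => ?_) ⟨_, hσ.1⟩ ⟨_, hσ.2⟩
    · have : β x' u - N * r.val - (β x u - N * r.val) = breakpoint N a u ⬝ᵥ (x' - x) := by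
        simp only [hβ, dotProduct_sub]
        ring
      rw [this]
      exact Finset.dvd_sum fun j _ => (hmod j).mul_left _
    · have := hsign (.inr (u, v))
      simp only [projFamily, sub_dotProduct] at this
      rw [sub_sub_sub_cancel_right, sub_sub_sub_cancel_right]
      exact this
  · have hempty : ∀ z, Finset.filter (fun y => key z y = (σ, r))
        (Finset.Ioo 0 (z (Fin.last n))) = ∅ := by
      intro z
      refine Finset.filter_eq_empty_iff.2 fun y hy h => hσ ?_
      rw [Finset.mem_Ioo] at hy
      simp only [hkey, Prod.mk.injEq, funext_iff] at h
      rw [← h.1, ← h.1, h₀, h₁]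
      exact ⟨sign_eq_one_iff.2 (by nlinarith), sign_eq_neg_one_iff.2 (by nlinarith)⟩
    rw [hempty, hempty]

/-- Rational open convex cones, as sets of lattice points. -/
structure IsOpenCone {n : ℕ} (C : Set (Fin n → ℤ)) : Prop where
  add_mem : ∀ z ∈ C, ∀ z' ∈ C, z + z' ∈ C
  smul_mem : ∀ k : ℤ, 0 < k → ∀ z ∈ C, k • z ∈ C
  of_smul_mem : ∀ k : ℤ, 0 < k → ∀ z, k • z ∈ C → z ∈ C
  exists_smul_add_mem : ∀ z ∈ C, ∀ v, ∃ k : ℤ, 0 < k ∧ k • z + v ∈ C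

/-- The rational projection of a cone along the first coordinate. -/
def coneProj {n : ℕ} (C : Set (Fin (n + 1) → ℤ)) : Set (Fin n → ℤ) :=
  {x | ∃ k : ℤ, 0 < k ∧ ∃ y : ℤ, (Fin.cons y (k • x) : Fin (n + 1) → ℤ) ∈ C}

lemma cons_add_cons {n : ℕ} (y y' : ℤ) (x x' : Fin n → ℤ) :
    (Fin.cons y x + Fin.cons y' x' : Fin (n + 1) → ℤ) = Fin.cons (y + y') (x + x') := by
  ext j
  induction j using Fin.cases <;> simp

lemma smul_cons {n : ℕ} (k y : ℤ) (x : Fin n → ℤ) :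
    (k • Fin.cons y x : Fin (n + 1) → ℤ) = Fin.cons (k * y) (k • x) := by
  ext j
  induction j using Fin.cases <;> simp

lemma IsOpenCone.coneProj {n : ℕ} {C : Set (Fin (n + 1) → ℤ)} (hC : IsOpenCone C) :
    IsOpenCone (coneProj C) where
  add_mem := by
    rintro x ⟨k, hk, y, hy⟩ x' ⟨k', hk', y', hy'⟩
    refine ⟨k * k', by positivity, k' * y + k * y', ?_⟩
    have := hC.add_mem _ (hC.smul_mem k' hk' _ hy) _ (hC.smul_mem k hk _ hy')
    rwa [smul_cons, smul_cons, cons_add_cons, smul_smul, smul_smul, mul_comm k' k,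
      ← smul_add] at this
  smul_mem := by
    rintro l hl x ⟨k, hk, y, hy⟩
    refine ⟨k, hk, l * y, ?_⟩
    have := hC.smul_mem l hl _ hy
    rwa [smul_cons, smul_comm] at this
  of_smul_mem := by
    rintro l hl x ⟨k, hk, y, hy⟩
    exact ⟨k * l, by positivity, y, by rwa [mul_smul]⟩
  exists_smul_add_mem := by
    rintro x ⟨k, hk, y, hy⟩ v
    obtain ⟨l, hl, h⟩ := hC.exists_smul_add_mem _ hy (Fin.cons 0 v)
    rw [smul_cons, cons_add_cons, smul_smul] at h
    exact ⟨l * k, by positivity, 1, one_pos, _, by rwa [one_smul]⟩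

lemma sum_range_mul' {R : Type*} [AddCommMonoid R] (g : ℕ → R) (M q : ℕ) :
    ∑ j ∈ range (M * q), g j = ∑ l ∈ range q, ∑ r ∈ range M, g (M * l + r) := by
  induction q with
  | zero => simp
  | succ q ih => rw [mul_add_one, Finset.sum_range_add, ih, Finset.sum_range_succ]

/-- Away from its first point, a periodic block contributes as little as possible. -/
lemma sum_block {M q : ℕ} (hM : 0 < M) (hq : 2 ≤ q) (g : ℕ → ZMod q)
    (hper : ∀ r l, 0 < r + l → r < M → l < q → g (M * l + r) = g (M * (if r = 0 then 1 else 0) + r)) :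
    ∑ j ∈ range (M * q), g j = g 0 - g M := by
  rw [sum_range_mul', Finset.sum_comm]
  obtain ⟨M, rfl⟩ := Nat.exists_eq_add_of_lt hM
  obtain ⟨q, rfl⟩ := Nat.exists_eq_add_of_le hq
  simp only [zero_add] at *
  rw [Finset.sum_range_succ', Finset.sum_eq_zero, zero_add]
  · have hr : range (2 + q) = range (q + 1 + 1) := by rw [add_comm 2 q]
    rw [hr, Finset.sum_range_succ', Finset.sum_congr rfl fun l hl => hper 0 (l + 1) (by omega) (by omega)
      (by rw [Finset.mem_range] at hl; omega)]
    have h1 : ((q + 1 : ℕ) : ZMod (2 + q)) = -1 := by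
      have : ((2 + q : ℕ) : ZMod (2 + q)) = 0 := ZMod.natCast_self _
      push_cast at this ⊢
      linear_combination this
    simp only [Finset.sum_const, Finset.card_range, nsmul_eq_mul, h1]
    simp
    ring
  · intro r hr
    rw [Finset.mem_range] at hr
    rw [Finset.sum_congr rfl fun l hl => hper (r + 1) l (by omega) (by omega)
      (by rwa [Finset.mem_range] at hl)]
    rw [Finset.sum_const, Finset.card_range, nsmul_eq_mul, ZMod.natCast_self, zero_mul]

lemma sum_left_ends {R : Type*} [AddCommGroup R] (c : R) {K : Set ℤ} [DecidablePred (· ∈ K)]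
    {q T : ℕ} (hq : 2 ≤ q) (hconv : ∀ x y z, x < y → y < z → x ∈ K → z ∈ K → y ∈ K)
    (hright : ∀ k : ℤ, q * k ∈ K → q * k + 1 ∈ K) (hleft : ∀ k : ℤ, q * (k + 1) ∈ K → q * k + 1 ∈ K)
    (hK : ∀ y ∈ K, 0 < y ∧ y < q * T) (hne : ∃ k : ℤ, q * k + 1 ∈ K) :
    ∑ k ∈ range T, ((if (q * k : ℤ) ∈ K then c else 0) - (if (q * k + 1 : ℤ) ∈ K then c else 0)) =
      -c := by
  have hne' : ∃ k : ℕ, (q * k + 1 : ℤ) ∈ K := by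
    obtain ⟨k, hk⟩ := hne
    have h0 : 0 ≤ k := by
      by_contra hcon
      have := (hK _ hk).1
      nlinarith
    lift k to ℕ using h0
    exact ⟨k, hk⟩
  set k₀ := Nat.find hne' with hk₀
  have hmem : (q * k₀ + 1 : ℤ) ∈ K := Nat.find_spec hne'
  have hT : k₀ < T := by
    have := (hK _ hmem).2
    by_contra hcon
    have h2 : (T : ℤ) ≤ k₀ := by exact_mod_cast not_lt.1 hcon
    nlinarith
  rw [Finset.sum_eq_single_of_mem k₀ (Finset.mem_range.2 hT)]
  · have hnot : (q * k₀ : ℤ) ∉ K := by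
      intro h
      have hpos := (hK _ h).1
      obtain ⟨k, hk⟩ : ∃ k, k₀ = k + 1 := Nat.exists_eq_succ_of_ne_zero fun h0 => by
        rw [h0] at hpos
        simp at hpos
      rw [hk] at h
      push_cast at h
      exact Nat.find_min hne' (show k < Nat.find hne' by omega) (hleft _ h)
    simp [hnot, hmem]
  · intro k _ hk
    rcases lt_or_gt_of_ne hk with h | h
    · have h1 : (q * k + 1 : ℤ) ∉ K := Nat.find_min hne' h
      have h2 : (q * k : ℤ) ∉ K := fun h' => h1 (hright _ h')
      simp [h1, h2]
    · by_cases h1 : (q * k + 1 : ℤ) ∈ K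
      · have h3 : (k₀ : ℤ) + 1 ≤ k := by exact_mod_cast h
        have h2 : (q * k : ℤ) ∈ K := hconv _ _ _ (by nlinarith) (lt_add_one _) hmem h1
        simp [h1, h2]
      · have h2 : (q * k : ℤ) ∉ K := fun h' => h1 (hright _ h')
        simp [h1, h2]

lemma sign_block_congr {q : ℤ} (hq : 2 ≤ q) {n k b y N : ℤ} (hn : 0 < n)
    (h1 : n * (q * k) < y) (h2 : y < n * (q * (k + 1))) :
    sign (N * y - n * (N * q * b)) = sign (N * (q * k + 1) - N * q * b) := by
  rw [show N * y - n * (N * q * b) = N * (y - n * (q * b)) by ring,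
    show N * (q * k + 1) - N * q * b = N * (q * (k - b) + 1) by ring, sign_mul, sign_mul]
  congr 1
  rcases lt_or_ge k b with h | h
  · have h' : k + 1 ≤ b := h
    rw [sign_neg, sign_neg]
    · nlinarith
    · have : n * (q * (k + 1)) ≤ n * (q * b) := by gcongr
      linarith
  · rw [sign_pos, sign_pos]
    · nlinarith
    · have : n * (q * b) ≤ n * (q * k) := by gcongr
      linarith

variable {ι : Type*} {n : ℕ} {N : ℤ} {M q : ℕ} {a : ι → Fin (n + 2) → ℤ}

/-- Membership of a block in a cone can be tested at its second point. -/
lemma cons_mem_cone_iff (hN : 0 < N) (hq : 2 ≤ q) (hdvd : ∀ i, a i 0 ≠ 0 → a i 0 ∣ N)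
    {C : Set (Fin (n + 2) → ℤ)}
    (hCs : ∀ z z', (∀ i, sign (a i ⬝ᵥ z) = sign (a i ⬝ᵥ z')) → (z ∈ C ↔ z' ∈ C))
    {l k y : ℤ} (hl : 0 < l) (h1 : l * (q * k) < y) (h2 : y < l * (q * (k + 1)))
    (x : Fin (n + 1) → ℤ) :
    (Fin.cons y (l • (N * q) • x) : Fin (n + 2) → ℤ) ∈ C ↔
      (Fin.cons (q * k + 1) ((N * q) • x) : Fin (n + 2) → ℤ) ∈ C := by
  refine hCs _ _ fun i => sign_dotProduct_cons_congr hN (hdvd i) ?_ ?_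
  · rw [dotProduct_smul l, smul_eq_mul, sign_mul, sign_pos hl, one_mul]
  · simp only [dotProduct_smul, smul_eq_mul]
    exact sign_block_congr (by exact_mod_cast hq) hl h1 h2

lemma sum_fiber_cone (hN : 0 < N) (hq : 2 ≤ q) (hdvd : ∀ i, a i 0 ≠ 0 → a i 0 ∣ N)
    {C : Set (Fin (n + 2) → ℤ)} (hC : IsOpenCone C)
    (hCs : ∀ z z', (∀ i, sign (a i ⬝ᵥ z) = sign (a i ⬝ᵥ z')) → (z ∈ C ↔ z' ∈ C))
    (hCb : ∀ z ∈ C, 0 < z 0 ∧ z 0 < z (Fin.last (n + 1))) {R : Type*} [AddCommGroup R] (c : R)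
    (x : Fin (n + 1) → ℤ) [DecidablePred (· ∈ C)] [Decidable (x ∈ coneProj C)] :
    ∑ k ∈ range (N * x (Fin.last n)).toNat,
      ((if (Fin.cons (q * k : ℤ) ((N * q) • x) : Fin (n + 2) → ℤ) ∈ C then c else 0) -
        (if (Fin.cons (q * k + 1 : ℤ) ((N * q) • x) : Fin (n + 2) → ℤ) ∈ C then c else 0)) =
      if x ∈ coneProj C then -c else 0 := by
  have hq0 : (0 : ℤ) < q := by exact_mod_cast (by omega : 0 < q)
  have hq2 : (2 : ℤ) ≤ q := by exact_mod_cast hq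
  split_ifs with hx
  · obtain ⟨l, hl, y, hy⟩ := hx
    have hlast : 0 < x (Fin.last n) := by
      have := hCb _ hy
      simp only [Fin.cons_zero, ← Fin.succ_last, Fin.cons_succ, Pi.smul_apply, smul_eq_mul] at this
      exact pos_of_mul_pos_right (this.1.trans this.2) hl.le
    have hT : (((N * x (Fin.last n)).toNat : ℕ) : ℤ) = N * x (Fin.last n) :=
      Int.toNat_of_nonneg (by positivity)
    have hright : ∀ k : ℤ, (Fin.cons (q * k : ℤ) ((N * q) • x) : Fin (n + 2) → ℤ) ∈ C →
        (Fin.cons (q * k + 1 : ℤ) ((N * q) • x) : Fin (n + 2) → ℤ) ∈ C := by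
      intro k hk
      obtain ⟨m, hm, h⟩ := hC.exists_smul_add_mem _ hk (Fin.cons 1 0)
      rw [smul_cons, cons_add_cons, add_zero] at h
      exact (cons_mem_cone_iff hN hq hdvd hCs hm (by linarith) (by nlinarith) x).1 h
    have hleft : ∀ k : ℤ, (Fin.cons (q * (k + 1) : ℤ) ((N * q) • x) : Fin (n + 2) → ℤ) ∈ C →
        (Fin.cons (q * k + 1 : ℤ) ((N * q) • x) : Fin (n + 2) → ℤ) ∈ C := by
      intro k hk
      obtain ⟨m, hm, h⟩ := hC.exists_smul_add_mem _ hk (Fin.cons (-1) 0)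
      rw [smul_cons, cons_add_cons, add_zero] at h
      exact (cons_mem_cone_iff hN hq hdvd hCs hm (by nlinarith) (by linarith) x).1 h
    refine sum_left_ends c
      (K := {y : ℤ | (Fin.cons y ((N * q) • x) : Fin (n + 2) → ℤ) ∈ C}) hq ?_ hright hleft ?_ ?_
    · intro y₁ y₂ y₃ h12 h23 h1 h3
      refine hC.of_smul_mem (y₃ - y₁) (by linarith) _ ?_
      have := hC.add_mem _ (hC.smul_mem (y₃ - y₂) (by linarith) _ h1) _
        (hC.smul_mem (y₂ - y₁) (by linarith) _ h3)
      rw [smul_cons, smul_cons, cons_add_cons, ← add_smul] at this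
      rw [smul_cons]
      convert this using 2
      · ring
      · congr 1
        ring
    · intro y hy
      have := hCb _ hy
      simp only [Fin.cons_zero, ← Fin.succ_last, Fin.cons_succ, Pi.smul_apply, smul_eq_mul] at this
      rw [hT]
      exact ⟨this.1, by linarith⟩
    · refine ⟨N * y / l, ?_⟩
      have hz := hC.smul_mem (N * q) (by positivity) _ hy
      rw [smul_cons, smul_comm] at hz
      have h1 : l * (N * y / l) ≤ N * y := Int.mul_ediv_self_le hl.ne'
      have h2 : N * y < l * (N * y / l + 1) := by
        have := Int.lt_ediv_add_one_mul_self (N * y) hl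
        linarith
      rcases h1.eq_or_lt with h | h
      · refine hright _ (hC.of_smul_mem l hl _ ?_)
        rw [smul_cons]
        convert hz using 2
        linear_combination (q : ℤ) * h
      · exact (cons_mem_cone_iff hN hq hdvd hCs hl (by nlinarith) (by nlinarith) x).1 hz
  · refine Finset.sum_eq_zero fun k _ => ?_
    have hnot : ∀ y : ℤ, (Fin.cons y ((N * q) • x) : Fin (n + 2) → ℤ) ∉ C :=
      fun y hy => hx ⟨N * q, by positivity, y, hy⟩
    rw [if_neg (hnot _), if_neg (hnot _), sub_zero]

lemma sum_Ioo_eq_sum_range {R : Type*} [AddCommMonoid R] (F : ℤ → R) (h0 : F 0 = 0) (t : ℤ) :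
    ∑ y ∈ Finset.Ioo 0 t, F y = ∑ j ∈ range t.toNat, F j := by
  rcases le_or_gt t 0 with ht | ht
  · rw [Finset.Ioo_eq_empty (by omega), Int.toNat_of_nonpos ht]
    simp
  · obtain ⟨k, rfl⟩ : ∃ k : ℕ, t = k + 1 := ⟨(t - 1).toNat, by omega⟩
    rw [show ((k : ℤ) + 1).toNat = k + 1 by omega, Finset.sum_range_succ']
    simp only [Nat.cast_zero, h0, add_zero]
    refine (Finset.sum_bij' (fun (j : ℕ) _ => (j : ℤ) + 1) (fun y _ => (y - 1).toNat) ?_ ?_ ?_ ?_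
      ?_).symm
    · intro j hj
      rw [Finset.mem_range] at hj
      rw [Finset.mem_Ioo]
      omega
    · intro y hy
      rw [Finset.mem_Ioo] at hy
      rw [Finset.mem_range]
      omega
    · intro j _
      omega
    · intro y hy
      rw [Finset.mem_Ioo] at hy
      omega
    · intro j _
      simp

/-- Summation of a tame function over the first coordinate changes the value on multiples of the
modulus by a sign. -/
lemma sum_fiber (hN : 0 < N) (hM : 0 < M) (hq : 2 ≤ q) (hdvd : ∀ i, a i 0 ≠ 0 → a i 0 ∣ N)
    {f : (Fin (n + 2) → ℤ) → ZMod q} (hf : IsTame a M f) {C : Set (Fin (n + 2) → ℤ)}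
    (hC : IsOpenCone C) {c : ZMod q} (hc : c ≠ 0) [DecidablePred (· ∈ C)]
    (hfC : ∀ z, f ((M : ℤ) • z) = if z ∈ C then c else 0)
    (hsupp : ∀ z, f z ≠ 0 → 0 < z 0 ∧ z 0 < z (Fin.last (n + 1)))
    (x : Fin (n + 1) → ℤ) [Decidable (x ∈ coneProj C)] :
    ∑ y ∈ Finset.Ioo 0 (((N.toNat * M * q : ℕ) • x) (Fin.last n)),
      f (Fin.cons y ((N.toNat * M * q : ℕ) • x)) = if x ∈ coneProj C then -c else 0 := by
  have hM' : (0 : ℤ) < M := by exact_mod_cast hM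
  have hmem : ∀ z, z ∈ C ↔ f ((M : ℤ) • z) ≠ 0 := fun z => by
    rw [hfC]
    split_ifs with h <;> simp [h, hc]
  have hCs : ∀ z z', (∀ i, sign (a i ⬝ᵥ z) = sign (a i ⬝ᵥ z')) → (z ∈ C ↔ z' ∈ C) := by
    intro z z' h
    rw [hmem, hmem, hf ((M : ℤ) • z) ((M : ℤ) • z')]
    · intro j
      simp only [Pi.smul_apply, smul_eq_mul, ← mul_sub]
      exact dvd_mul_right _ _
    · intro i
      rw [dotProduct_smul, dotProduct_smul, smul_eq_mul, smul_eq_mul, sign_mul, sign_mul, h]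
  have hCb : ∀ z ∈ C, 0 < z 0 ∧ z 0 < z (Fin.last (n + 1)) := by
    intro z hz
    have := hsupp _ ((hmem z).1 hz)
    simp only [Pi.smul_apply, smul_eq_mul] at this
    exact ⟨pos_of_mul_pos_right this.1 hM'.le, lt_of_mul_lt_mul_left this.2 hM'.le⟩
  rw [← sum_fiber_cone hN hq hdvd hC hCs hCb c x]
  have hNn : ((N.toNat : ℕ) : ℤ) = N := Int.toNat_of_nonneg hN.le
  set X := (N.toNat * M * q : ℕ) • x with hX
  have hXsmul : X = (M : ℤ) • (N * q) • x := by
    ext j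
    simp only [hX, Pi.smul_apply, smul_eq_mul]
    rw [nsmul_eq_mul]
    push_cast [hNn]
    ring
  have h0 : f (Fin.cons 0 X) = 0 := by
    by_contra h
    exact absurd (hsupp _ h).1 (by simp)
  have hlast : (X (Fin.last n)).toNat = M * q * (N * x (Fin.last n)).toNat := by
    rw [hXsmul]
    simp only [Pi.smul_apply, smul_eq_mul]
    rw [show (M : ℤ) * (N * q * x (Fin.last n)) = (M * q : ℕ) * (N * x (Fin.last n)) by
      push_cast; ring]
    rcases le_total 0 (N * x (Fin.last n)) with h | h
    · rw [Int.toNat_mul (by positivity) h, Int.toNat_natCast]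
    · rw [Int.toNat_of_nonpos h, mul_zero, Int.toNat_of_nonpos]
      exact mul_nonpos_of_nonneg_of_nonpos (by positivity) h
  rw [sum_Ioo_eq_sum_range (fun y => f (Fin.cons y X)) h0, hlast, sum_range_mul']
  refine Finset.sum_congr rfl fun k _ => ?_
  have hsmul : ∀ u : ℤ, f (Fin.cons (M * u) X) =
      if (Fin.cons u ((N * q) • x) : Fin (n + 2) → ℤ) ∈ C then c else 0 := by
    intro u
    rw [← hfC, smul_cons, hXsmul]
  have hsign : ∀ s : ℤ, 0 < s → s < M * q → ∀ i,
      sign (N * ((M * q : ℤ) * k + s) - breakpoint N a (.inl i) ⬝ᵥ X) =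
      sign (N * ((M * q : ℤ) * k + 1) -
        N * (M * q : ℤ) * (breakpoint N a (.inl i) ⬝ᵥ x)) := by
    intro s hs hs' i
    rw [← sign_block_congr (n := 1) (y := (M * q : ℤ) * k + s) (by
      have : (2 : ℤ) ≤ q := by exact_mod_cast hq
      nlinarith) one_pos (by linarith) (by linarith), hXsmul]
    simp only [dotProduct_smul, smul_eq_mul]
    congr 1
    ring
  have hblock : ∀ s s' : ℕ, 0 < s → s < M * q → 0 < s' → s' < M * q → (M : ℤ) ∣ s' - s →
      f (Fin.cons (((M * q * k + s : ℕ)) : ℤ) X) = f (Fin.cons (((M * q * k + s' : ℕ)) : ℤ) X) := by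
    intro s s' hs1 hs2 hs1' hs2' hss
    refine hf _ _ (fun j => ?_) fun i => ?_
    · induction j using Fin.cases with
      | zero => simpa using hss
      | succ j => simp
    · refine sign_dotProduct_cons_congr hN (hdvd i) rfl ?_
      push_cast
      rw [hsign s (by exact_mod_cast hs1) (by exact_mod_cast hs2),
        hsign s' (by exact_mod_cast hs1') (by exact_mod_cast hs2')]
  rw [sum_block hM hq (fun j => f (Fin.cons ((M * q * k + j : ℕ) : ℤ) X))]
  · rw [← hsmul, ← hsmul]
    congr 4
    · ring
    · push_cast
      ring
  · intro r l hrl hr hl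
    have hl' : M * l + r < M * q := by
      calc M * l + r < M * (l + 1) := by rw [mul_add_one]; omega
        _ ≤ M * q := Nat.mul_le_mul_left _ hl
    have hl0 : 0 < M * l + r := by
      rcases Nat.eq_zero_or_pos r with h | h
      · have : 0 < l := by omega
        positivity
      · omega
    have hM1 : M * 1 < M * q := Nat.mul_lt_mul_of_pos_left (by omega) hM
    refine hblock _ _ hl0 hl' ?_ ?_ ?_
    · split_ifs <;> omega
    · split_ifs with h
      · omega
      · rw [mul_zero, zero_add]
        exact (Nat.le_add_left _ _).trans_lt hl'
    · push_cast
      rw [add_sub_add_right_eq_sub, ← mul_sub]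
      exact dvd_mul_right _ _

lemma sum_piFinset_snoc {R : Type*} [AddCommMonoid R] (n : ℕ) (t : ℤ)
    (f : (Fin (n + 2) → ℤ) → R) :
    ∑ x ∈ Fintype.piFinset fun _ : Fin (n + 1) => Finset.Ioo 0 t, f (Fin.snoc x t) =
      ∑ x ∈ Fintype.piFinset fun _ : Fin n => Finset.Ioo 0 t,
        ∑ y ∈ Finset.Ioo 0 ((Fin.snoc x t : Fin (n + 1) → ℤ) (Fin.last n)),
          f (Fin.cons y (Fin.snoc x t : Fin (n + 1) → ℤ)) := by
  simp only [Fin.snoc_last]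
  rw [Finset.sum_comm, ← Finset.sum_product']
  refine Finset.sum_bij' (fun x _ => (x 0, Fin.tail x)) (fun p _ => Fin.cons p.1 p.2) ?_ ?_ ?_ ?_ ?_
  · intro x hx
    rw [Fintype.mem_piFinset] at hx
    simp only [Finset.mem_product, Fintype.mem_piFinset]
    exact ⟨hx 0, fun i => hx i.succ⟩
  · rintro ⟨y, x⟩ h
    simp only [Finset.mem_product, Fintype.mem_piFinset] at h
    rw [Fintype.mem_piFinset]
    exact Fin.cases h.1 h.2
  · intro x _
    exact Fin.cons_self_tail x
  · rintro ⟨y, x⟩ _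
    simp
  · intro x _
    simp only
    rw [Fin.cons_snoc_eq_snoc_cons, Fin.cons_self_tail]

/-- The sum of a tame function over a slice of an open cone is, up to sign, its value on multiples
of the modulus. -/
theorem exists_sum_slice_eq {q : ℕ} (hq : 2 ≤ q) (n : ℕ) : ∀ {ι : Type} [Finite ι]
    (a : ι → Fin (n + 1) → ℤ) {M : ℕ}, 0 < M → ∀ (f : (Fin (n + 1) → ℤ) → ZMod q), IsTame a M f →
    ∀ (C : Set (Fin (n + 1) → ℤ)) [DecidablePred (· ∈ C)], IsOpenCone C → C.Nonempty →
    ∀ c : ZMod q, c ≠ 0 → (∀ z, f ((M : ℤ) • z) = if z ∈ C then c else 0) →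
    (∀ z, f z ≠ 0 → 0 < z (Fin.last n) ∧ ∀ i : Fin n, 0 < z i.castSucc ∧ z i.castSucc < z (Fin.last n)) →
    ∃ M' : ℕ, 0 < M' ∧ ∀ t : ℤ, 0 < t → (M' : ℤ) ∣ t →
      ∑ x ∈ Fintype.piFinset fun _ : Fin n => Finset.Ioo 0 t, f (Fin.snoc x t) = (-1) ^ n * c := by
  induction n with
  | zero =>
    intro ι _ a M hM f _ C _ hC ⟨z, hz⟩ c hc hfC hsupp
    refine ⟨M, hM, ?_⟩
    rintro _ ht ⟨k, rfl⟩
    have hM' : (0 : ℤ) < M := by exact_mod_cast hM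
    have hk : 0 < k := pos_of_mul_pos_right ht hM'.le
    have hz0 : 0 < z 0 := by
      have := (hsupp ((M : ℤ) • z) (by rw [hfC, if_pos hz]; exact hc)).1
      exact pos_of_mul_pos_right (by simpa using this) hM'.le
    have h1 : (fun _ => 1 : Fin 1 → ℤ) ∈ C := by
      refine hC.of_smul_mem _ hz0 _ ?_
      convert hz using 1
      ext j
      rw [Subsingleton.elim (α := Fin 1) j 0]
      simp
    have h2 := hC.smul_mem k hk _ h1
    have h3 := hfC (k • fun _ => 1)
    rw [if_pos h2] at h3
    rw [Fintype.piFinset_of_isEmpty, Finset.univ_unique, Finset.sum_singleton, pow_zero, one_mul,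
      ← h3]
    congr 1
    ext j
    rw [Subsingleton.elim (α := Fin 1) j (Fin.last 0), Fin.snoc_last]
    simp
  | succ n ih =>
    intro ι _ a M hM f hf C _ hC ⟨z, hz⟩ c hc hfC hsupp
    classical
    have := Fintype.ofFinite ι
    obtain ⟨N, hN, hdvd⟩ : ∃ N : ℤ, 0 < N ∧ ∀ i, a i 0 ≠ 0 → a i 0 ∣ N := by
      refine ⟨∏ i, if a i 0 = 0 then 1 else |a i 0|, Finset.prod_pos fun i _ => ?_, fun i hi => ?_⟩
      · split_ifs with h
        · exact one_pos
        · exact abs_pos.2 h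
      · have := Finset.dvd_prod_of_mem (fun i => if a i 0 = 0 then 1 else |a i 0|)
          (Finset.mem_univ i)
        rw [if_neg hi, abs_dvd] at this
        exact this
    have hNn : 0 < N.toNat := by omega
    have hsupp' : ∀ z, f z ≠ 0 → 0 < z 0 ∧ z 0 < z (Fin.last (n + 1)) := fun z hz =>
      (hsupp z hz).2 0
    obtain ⟨M', hM', h⟩ := ih (projFamily N a) (M := N.toNat * M * q) (by positivity) _
      (isTame_sum hN hM hdvd hf) (coneProj C) hC.coneProj
      ⟨Fin.tail z, 1, one_pos, z 0, by rwa [one_smul, Fin.cons_self_tail]⟩ (-c) (neg_ne_zero.2 hc)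
      (fun x => by
        rw [natCast_zsmul]
        exact sum_fiber hN hM hq hdvd hf hC hc hfC hsupp' x)
      (fun x hx => by
        obtain ⟨y, -, hy⟩ := Finset.exists_ne_zero_of_sum_ne_zero hx
        have := hsupp _ hy
        exact ⟨this.1, fun i => this.2 i.succ⟩)
    refine ⟨M', hM', fun t ht hd => ?_⟩
    rw [sum_piFinset_snoc, h t ht hd]
    ring

/-- The number of lattice points in a slice of a bounded open polyhedral cone is congruent to a sign
on multiples of a suitable integer. -/
theorem exists_card_slice_eq {q : ℕ} (hq : 2 ≤ q) (n : ℕ) {ι : Type} [Finite ι]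
    (a : ι → Fin (n + 1) → ℤ) (hne : ∃ z, ∀ i, 0 < a i ⬝ᵥ z)
    (hb : ∀ z, (∀ i, 0 < a i ⬝ᵥ z) →
      0 < z (Fin.last n) ∧ ∀ i : Fin n, 0 < z i.castSucc ∧ z i.castSucc < z (Fin.last n)) :
    ∃ M : ℕ, 0 < M ∧ ∀ t : ℤ, 0 < t → (M : ℤ) ∣ t →
      (Nat.card {z : Fin (n + 1) → ℤ // (∀ i, 0 < a i ⬝ᵥ z) ∧ z (Fin.last n) = t} : ZMod q) =
        (-1) ^ n := by
  classical
  have := Fintype.ofFinite ι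
  have : Fact (1 < q) := ⟨by omega⟩
  obtain ⟨M, hM, h⟩ := exists_sum_slice_eq hq n a one_pos
    (fun z => if ∀ i, 0 < a i ⬝ᵥ z then 1 else 0)
    (fun z z' _ h => by
      have : (∀ i, 0 < a i ⬝ᵥ z) ↔ ∀ i, 0 < a i ⬝ᵥ z' := forall_congr' fun i => by
        rw [← sign_eq_one_iff, h i, sign_eq_one_iff]
      simp only [this])
    {z | ∀ i, 0 < a i ⬝ᵥ z}
    { add_mem := fun z hz z' hz' i => by
        rw [dotProduct_add]
        exact add_pos (hz i) (hz' i)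
      smul_mem := fun k hk z hz i => by
        rw [dotProduct_smul]
        exact mul_pos hk (hz i)
      of_smul_mem := fun k hk z hz i => by
        have := hz i
        rw [dotProduct_smul] at this
        exact pos_of_mul_pos_right this hk.le
      exists_smul_add_mem := fun z hz v => by
        have hpos : 0 ≤ ∑ i, |a i ⬝ᵥ v| := Finset.sum_nonneg fun _ _ => abs_nonneg _
        refine ⟨1 + ∑ i, |a i ⬝ᵥ v|, by linarith, fun i => ?_⟩
        have h1 : |a i ⬝ᵥ v| ≤ ∑ i, |a i ⬝ᵥ v| :=
          Finset.single_le_sum (f := fun i => |a i ⬝ᵥ v|) (fun _ _ => abs_nonneg _)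
            (Finset.mem_univ i)
        have h2 := neg_abs_le (a i ⬝ᵥ v)
        have h3 := hz i
        rw [dotProduct_add, dotProduct_smul, smul_eq_mul]
        nlinarith }
    hne 1 one_ne_zero (fun z => by simp) (fun z hz => hb z (by by_contra h; simp [h] at hz))
  refine ⟨M, hM, fun t ht hd => ?_⟩
  rw [← mul_one ((-1) ^ n), ← h t ht hd, Finset.sum_boole]
  congr 1
  rw [← Nat.card_eq_finsetCard]
  refine Nat.card_congr
    { toFun := fun z => ⟨Fin.init z.1, ?_⟩
      invFun := fun x => ⟨Fin.snoc x.1 t, (Finset.mem_filter.1 x.2).2, Fin.snoc_last _ _⟩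
      left_inv := ?_
      right_inv := ?_ }
  · obtain ⟨z, hz, rfl⟩ := z
    rw [Finset.mem_filter, Fintype.mem_piFinset]
    refine ⟨fun i => Finset.mem_Ioo.2 ((hb z hz).2 i), ?_⟩
    simpa [Fin.snoc_init_self] using hz
  · rintro ⟨z, hz, rfl⟩
    simp [Fin.snoc_init_self]
  · rintro ⟨x, hx⟩
    simp

/-- Homogeneous strict integral inequalities that are solvable over the reals are solvable over the
integers. -/
lemma exists_int_of_real {ι : Type*} [Finite ι] {k : ℕ} (a : ι → Fin k → ℤ) (w : Fin k → ℝ)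
    (hw : ∀ i, 0 < ∑ j, (a i j : ℝ) * w j) : ∃ z : Fin k → ℤ, ∀ i, 0 < a i ⬝ᵥ z := by
  have hopen : IsOpen {w : Fin k → ℝ | ∀ i, 0 < ∑ j, (a i j : ℝ) * w j} := by
    simp only [Set.ofPred_forall]
    exact isOpen_iInter_of_finite fun i => isOpen_lt continuous_const (by fun_prop)
  obtain ⟨v, hv⟩ := (DenseRange.piMap fun _ : Fin k =>
    Rat.denseRange_cast (𝕜 := ℝ)).exists_mem_open hopen ⟨w, hw⟩
  obtain ⟨b, hb⟩ := IsLocalization.exist_integer_multiples_of_finite (nonZeroDivisors ℤ) v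
  choose z hz using hb
  have hb0 : (b : ℤ) ≠ 0 := nonZeroDivisors.coe_ne_zero b
  refine ⟨(b : ℤ) • z, fun i => ?_⟩
  have hi : (0 : ℝ) < ∑ j, (a i j : ℝ) * v j := hv i
  have hzj : ∀ j, ((z j : ℤ) : ℝ) = b * v j := fun j => by
    have := hz j
    simp only [algebraMap_int_eq, eq_intCast, zsmul_eq_mul] at this
    exact_mod_cast congrArg (Rat.cast : ℚ → ℝ) this
  have key : ((a i ⬝ᵥ ((b : ℤ) • z) : ℤ) : ℝ) = (b : ℝ) ^ 2 * ∑ j, (a i j : ℝ) * v j := by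
    simp only [dotProduct, Pi.smul_apply, smul_eq_mul, Int.cast_sum, Int.cast_mul, hzj,
      Finset.mul_sum]
    exact Finset.sum_congr rfl fun j _ => by ring
  have hpos : (0 : ℝ) < (b : ℝ) ^ 2 := by
    have : (b : ℝ) ≠ 0 := by exact_mod_cast hb0
    positivity
  exact_mod_cast key ▸ mul_pos hpos hi

lemma sum_map_eq_sum_count {R : Type*} [CommRing R] {k : ℕ} (s : Multiset (Fin k)) (x : Fin k → R) :
    (s.map x).sum = ∑ i, (s.count i : R) * x i := by
  induction s using Multiset.induction_on with
  | empty => simp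
  | cons j s ih =>
    rw [Multiset.map_cons, Multiset.sum_cons, ih]
    simp [Multiset.count_cons, add_mul, Finset.sum_add_distrib, add_comm]

variable {m h : ℕ}

/-- The coefficients, on the markings other than the first, of the difference of the sums over
two multisets of markings. -/
def sumDiff (r s : Multiset (Fin (m + 1))) (j : Fin m) : ℤ :=
  s.count j.succ - r.count j.succ

lemma sum_sumDiff_mul {R : Type*} [CommRing R] (r s : Multiset (Fin (m + 1))) (x : Fin (m + 1) → R)
    (h0 : x 0 = 0) :
    ∑ j, (sumDiff r s j : R) * Fin.tail x j = (s.map x).sum - (r.map x).sum := by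
  rw [sum_map_eq_sum_count, sum_map_eq_sum_count, Fin.sum_univ_succ, Fin.sum_univ_succ, h0,
    add_sub_add_comm, ← Finset.sum_sub_distrib]
  simp [sumDiff, Fin.tail, sub_mul]

lemma sumDiff_dotProduct (r s : Multiset (Fin (m + 1))) (z : Fin m → ℤ) :
    sumDiff r s ⬝ᵥ z =
      (s.map (Fin.cons 0 z : Fin (m + 1) → ℤ)).sum - (r.map (Fin.cons 0 z : Fin (m + 1) → ℤ)).sum := by
  rw [← sum_sumDiff_mul r s (Fin.cons 0 z : Fin (m + 1) → ℤ) (Fin.cons_zero _ _)]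
  simp [dotProduct]

/-- The pairs of multisets of `h` markings whose sums are strictly ordered by `y`. -/
abbrev LtPair (h : ℕ) (y : Fin (m + 1) → ℝ) : Type :=
  {p : Sym (Fin (m + 1)) h × Sym (Fin (m + 1)) h //
    ((p.1 : Multiset (Fin (m + 1))).map y).sum < ((p.2 : Multiset (Fin (m + 1))).map y).sum}

/-- The functionals whose positivity cuts out the cone of the combinatorial type of `y`. -/
def typeFamily (h : ℕ) (y : Fin (m + 1) → ℝ) (p : LtPair h y) : Fin m → ℤ :=
  sumDiff p.1.1 p.1.2

/-- An integral ruler satisfies all strict inequalities that the real ruler `y` satisfies. -/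
def RespectsType (h : ℕ) (y : Fin (m + 1) → ℝ) (x : Fin (m + 1) → ℤ) : Prop :=
  ∀ r s : Multiset (Fin (m + 1)), Multiset.card r = h → Multiset.card s = h →
    (r.map y).sum < (s.map y).sum → (r.map x).sum < (s.map x).sum

lemma typeFamily_pos_iff {y : Fin (m + 1) → ℝ} {z : Fin m → ℤ} :
    (∀ p, 0 < typeFamily h y p ⬝ᵥ z) ↔ RespectsType h y (Fin.cons 0 z) := by
  constructor
  · intro H r s hr hs hlt
    have := H ⟨(⟨r, hr⟩, ⟨s, hs⟩), hlt⟩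
    rw [typeFamily, sumDiff_dotProduct] at this
    exact sub_pos.1 this
  · intro H p
    rw [typeFamily, sumDiff_dotProduct]
    exact sub_pos.2 (H _ _ p.1.1.2 p.1.2.2 p.2)

lemma RespectsType.strictMono (hh : 0 < h) {y : Fin (m + 1) → ℝ} (hy : StrictMono y)
    {x : Fin (m + 1) → ℤ} (hx : RespectsType h y x) : StrictMono x := by
  intro i j hij
  have := hx (Multiset.replicate h i) (Multiset.replicate h j) (by simp) (by simp) (by
    simp only [Multiset.map_replicate, Multiset.sum_replicate]
    exact nsmul_lt_nsmul_right hh.ne' (hy hij))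
  simp only [Multiset.map_replicate, Multiset.sum_replicate] at this
  exact lt_of_nsmul_lt_nsmul_right h this

lemma RespectsType.isBhSet {y : Fin (m + 1) → ℝ} (hy : IsRealBhRuler m h y)
    {x : Fin (m + 1) → ℤ} (hx : RespectsType h y x) : IsBhSet m h x := by
  intro r s hr hs hrs
  rcases lt_or_gt_of_ne (hy r s hr hs hrs) with H | H
  · exact (hx r s hr hs H).ne
  · exact (hx s r hs hr H).ne'

lemma sum_map_div (t : ℤ) (x : Fin (m + 1) → ℤ) (s : Multiset (Fin (m + 1))) :
    (s.map fun i => (x i : ℝ) / t).sum = ((s.map x).sum : ℤ) / (t : ℝ) := by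
  rw [Multiset.sum_map_div]
  simp [Multiset.map_map]

lemma sum_map_div_lt_iff {t : ℤ} (ht : 0 < t) (x : Fin (m + 1) → ℤ)
    (r s : Multiset (Fin (m + 1))) :
    (r.map fun i => (x i : ℝ) / t).sum < (s.map fun i => (x i : ℝ) / t).sum ↔
      (r.map x).sum < (s.map x).sum := by
  have ht' : (0 : ℝ) < t := by exact_mod_cast ht
  rw [sum_map_div, sum_map_div, div_lt_div_iff_of_pos_right ht', Int.cast_lt]

lemma isRealRuler_div {t : ℤ} (ht : 0 < t) {x : Fin (m + 1) → ℤ} (hx : IsRuler m t x) :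
    IsRealRuler m 1 fun i => (x i : ℝ) / t := by
  have ht' : (0 : ℝ) < t := by exact_mod_cast ht
  refine ⟨fun i j hij => ?_, by simp [hx.2.1], by simp [hx.2.2, ht'.ne']⟩
  exact div_lt_div_of_pos_right (by exact_mod_cast hx.1 hij) ht'

lemma isRealBhRuler_div {t : ℤ} (ht : 0 < t) {x : Fin (m + 1) → ℤ} (hx : IsBhSet m h x) :
    IsRealBhRuler m h fun i => (x i : ℝ) / t := by
  intro r s hr hs hrs
  rcases lt_or_gt_of_ne (hx r s hr hs hrs) with H | H
  · exact ((sum_map_div_lt_iff ht x r s).2 H).ne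
  · exact ((sum_map_div_lt_iff ht x s r).2 H).ne'

lemma combEquivBh_div_iff {t : ℤ} (ht : 0 < t) {x : Fin (m + 1) → ℤ} {y : Fin (m + 1) → ℝ}
    (hy : IsRealBhRuler m h y) :
    CombEquivBh m h (fun i => (x i : ℝ) / t) y ↔ RespectsType h y x := by
  constructor
  · intro H r s hr hs hlt
    exact (sum_map_div_lt_iff ht x r s).1 ((H r s hr hs).2 hlt)
  · intro H r s hr hs
    rw [sum_map_div_lt_iff ht]
    refine ⟨fun hlt => ?_, H r s hr hs⟩
    by_contra hcon
    have hrs : r ≠ s := by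
      rintro rfl
      exact lt_irrefl _ hlt
    have := H s r hs hr (lt_of_le_of_ne (not_lt.1 hcon) (hy r s hr hs hrs).symm)
    exact lt_asymm hlt this

/-- Combinatorial types of real `B_h`-rulers of length one. -/
abbrev CombType (m h : ℕ) : Type :=
  Quotient (bhSetoid m h fun y => IsRealRuler m 1 y ∧ IsRealBhRuler m h y)

instance : Finite (CombType m h) := by
  let g : CombType m h → Set (Sym (Fin (m + 1)) h × Sym (Fin (m + 1)) h) := fun c =>
    {p | ((p.1 : Multiset (Fin (m + 1))).map c.out.1).sum <
      ((p.2 : Multiset (Fin (m + 1))).map c.out.1).sum}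
  refine Finite.of_injective g fun c c' hcc => ?_
  rw [← c.out_eq, ← c'.out_eq]
  exact Quotient.sound fun r s hr hs => Set.ext_iff.1 hcc (⟨r, hr⟩, ⟨s, hs⟩)

lemma finite_bhSets (m h : ℕ) (t : ℤ) :
    Finite {x : Fin (m + 1) → ℤ // IsRuler m t x ∧ IsBhSet m h x} := by
  refine Set.Finite.to_subtype ((Set.finite_Icc (fun _ => 0) (fun _ => t)).subset ?_)
  rintro x ⟨⟨hx, h0, ht⟩, -⟩
  exact ⟨fun i => h0 ▸ hx.monotone (Fin.zero_le i), fun i => ht ▸ hx.monotone (Fin.le_last i)⟩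

/-- The `B_h`-sets of length `t`, sorted by combinatorial type. -/
lemma bmh_eq_sum {n : ℕ} (hh : 0 < h) [Fintype (CombType (n + 1) h)] {t : ℤ} (ht : 0 < t) :
    bmh (n + 1) h t = ∑ c : CombType (n + 1) h, Nat.card {z : Fin (n + 1) → ℤ //
      (∀ p, 0 < typeFamily h c.out.1 p ⬝ᵥ z) ∧ z (Fin.last n) = t} := by
  have := finite_bhSets (n + 1) h t
  let φ : {x : Fin (n + 1 + 1) → ℤ // IsRuler (n + 1) t x ∧ IsBhSet (n + 1) h x} →
      CombType (n + 1) h := fun x =>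
    Quotient.mk _ ⟨fun i => (x.1 i : ℝ) / t, isRealRuler_div ht x.2.1, isRealBhRuler_div ht x.2.2⟩
  have hφ : ∀ x c, φ x = c ↔ RespectsType h c.out.1 x.1 := fun x c => by
    rw [← combEquivBh_div_iff ht c.out.2.2]
    conv_lhs => rw [← c.out_eq]
    exact Quotient.eq
  rw [bmh, ← Nat.card_congr (Equiv.sigmaFiberEquiv φ), Nat.card_sigma]
  refine Finset.sum_congr rfl fun c _ => ?_
  simp only [typeFamily_pos_iff]
  refine Nat.card_congr
    { toFun := fun x => ⟨Fin.tail x.1.1, ?_, x.1.2.1.2.2⟩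
      invFun := fun z => ⟨⟨Fin.cons 0 z.1,
        ⟨z.2.1.strictMono hh c.out.2.1.1, Fin.cons_zero _ _, z.2.2⟩,
          z.2.1.isBhSet c.out.2.2⟩, (hφ _ _).2 z.2.1⟩
      left_inv := ?_
      right_inv := ?_ }
  · have h0 : x.1.1 0 = 0 := x.1.2.1.2.1
    rw [← h0, Fin.cons_self_tail]
    exact (hφ _ _).1 x.2
  · rintro ⟨⟨x, hx⟩, hc⟩
    have h0 : x 0 = 0 := hx.1.2.1
    simp only [Subtype.mk.injEq]
    rw [← h0, Fin.cons_self_tail]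
  · rintro ⟨z, hz⟩
    rfl

lemma exists_bmh_cast_eq {n q : ℕ} (hh : 0 < h) (hq : 2 ≤ q) :
    ∃ M : ℕ, 0 < M ∧ ∀ t : ℤ, 0 < t → (M : ℤ) ∣ t →
      (bmh (n + 1) h t : ZMod q) = (-1) ^ n * Nat.card (CombType (n + 1) h) := by
  have := Fintype.ofFinite (CombType (n + 1) h)
  have hcone : ∀ c : CombType (n + 1) h, ∃ M : ℕ, 0 < M ∧ ∀ t : ℤ, 0 < t → (M : ℤ) ∣ t →
      (Nat.card {z : Fin (n + 1) → ℤ // (∀ p, 0 < typeFamily h c.out.1 p ⬝ᵥ z) ∧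
        z (Fin.last n) = t} : ZMod q) = (-1) ^ n := by
    intro c
    refine exists_card_slice_eq hq n _ (exists_int_of_real _ (Fin.tail c.out.1) fun p => ?_)
      fun z hz => ?_
    · simp only [typeFamily]
      rw [sum_sumDiff_mul _ _ _ c.out.2.1.2.1]
      exact sub_pos.2 p.2
    · have hmono := (typeFamily_pos_iff.1 hz).strictMono hh c.out.2.1.1
      exact ⟨hmono (Fin.succ_pos (Fin.last n)), fun i => ⟨hmono (Fin.succ_pos i.castSucc),
        hmono (Fin.succ_lt_succ_iff.2 (Fin.castSucc_lt_last i))⟩⟩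
  choose M hM hcard using hcone
  refine ⟨∏ c, M c, Finset.prod_pos fun c _ => hM c, fun t ht hd => ?_⟩
  rw [bmh_eq_sum hh ht, Nat.cast_sum, Finset.sum_congr rfl fun c _ => hcard c t ht
    ((Int.natCast_dvd_natCast.2 (Finset.dvd_prod_of_mem M (Finset.mem_univ c))).trans hd)]
  rw [Finset.sum_const, Finset.card_univ, nsmul_eq_mul, Nat.card_eq_fintype_card, mul_comm]

/-- The constant term of a rational polynomial is determined by congruences satisfied by its values
at highly divisible integers. -/
lemma eval_zero_eq_of_congr (p : Polynomial ℚ) (b : ℕ → ℤ) {s : ℕ} (hs : 0 < s)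
    (hp : ∀ t : ℕ, 0 < t → s ∣ t → (b t : ℚ) = p.eval (t : ℚ)) (v : ℤ)
    (hb : ∀ q : ℕ, 2 ≤ q → ∃ M : ℕ, 0 < M ∧ ∀ t : ℕ, 0 < t → M ∣ t → (b t : ZMod q) = v) :
    p.eval 0 = v := by
  obtain ⟨D, hD, hDp⟩ := IsLocalization.integerNormalization_spec (nonZeroDivisors ℤ) p
  set P := IsLocalization.integerNormalization (nonZeroDivisors ℤ) p
  have hD0 : D ≠ 0 := nonZeroDivisors.ne_zero hD
  have heval : ∀ t : ℤ, ((P.eval t : ℤ) : ℚ) = D * p.eval (t : ℚ) := fun t => by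
    have := congrArg (Polynomial.eval (t : ℚ)) hDp
    rw [Polynomial.eval_smul, zsmul_eq_mul] at this
    rw [← this, algebraMap_int_eq, Polynomial.eval_intCast_map, eq_intCast, Int.cast_id]
  have hdvd : ∀ q : ℕ, 2 ≤ q → (q : ℤ) ∣ D * v - P.eval 0 := by
    intro q hq
    obtain ⟨M, hM, h⟩ := hb q hq
    have ht : 0 < s * M * q := by positivity
    have h1 := h (s * M * q) ht ⟨s * q, by ring⟩
    have h2 : D * b (s * M * q) = P.eval ((s * M * q : ℕ) : ℤ) := by
      have := heval ((s * M * q : ℕ) : ℤ)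
      rw [Int.cast_natCast, ← hp _ ht ⟨M * q, by ring⟩] at this
      exact_mod_cast this.symm
    have h3 : (q : ℤ) ∣ v - b (s * M * q) := by
      rw [← ZMod.intCast_zmod_eq_zero_iff_dvd]
      simp [h1]
    have h4 := Polynomial.sub_dvd_eval_sub ((s * M * q : ℕ) : ℤ) 0 P
    rw [← h2, sub_zero] at h4
    have h5 : (q : ℤ) ∣ D * b (s * M * q) - P.eval 0 :=
      (Int.natCast_dvd_natCast.2 (dvd_mul_left q (s * M))).trans h4
    have := (h3.mul_left D).add h5
    rwa [mul_sub, sub_add_sub_cancel] at this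
  have hzero : D * v - P.eval 0 = 0 := by
    refine Int.eq_zero_of_abs_lt_dvd (hdvd ((D * v - P.eval 0).natAbs + 2) (by omega)) ?_
    push_cast
    linarith
  have h0 := heval 0
  rw [← sub_eq_zero.1 hzero] at h0
  push_cast at h0
  have hDq : (D : ℚ) ≠ 0 := by exact_mod_cast hD0
  exact (mul_left_cancel₀ hDq h0).symm

end BhRuler

/-- If `s ≥ 1` and polynomials `p_0, …, p_{s-1}` represent the quasipolynomial `b_{m,h}`,
then `(-1)^{m-1} p_0(0)` is the number of combinatorial types of `B_h`-sets with `m+1`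
markings, i.e. the number of equivalence classes of real `B_h`-rulers of length 1. -/
theorem bmh_eval_zero (m h : ℕ) (hm : 1 ≤ m) (hh : 2 ≤ h)
    (s : ℕ) (hs : 1 ≤ s) (p : ℕ → Polynomial ℚ)
    (hrep : ∀ t : ℕ, 0 < t → (bmh m h (t : ℤ) : ℚ) = (p (t % s)).eval (t : ℚ)) :
    (-1 : ℚ) ^ (m - 1) * (p 0).eval 0 =
      Nat.card
        (Quotient (bhSetoid m h (fun y => IsRealRuler m 1 y ∧ IsRealBhRuler m h y))) := by
  obtain ⟨n, rfl⟩ : ∃ n, m = n + 1 := Nat.exists_eq_add_of_le' hm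
  have key := BhRuler.eval_zero_eq_of_congr (p 0) (fun t => bmh (n + 1) h t) hs
    (fun t ht hd => by
      rw [Int.cast_natCast, hrep t ht, Nat.mod_eq_zero_of_dvd hd])
    ((-1) ^ n * Nat.card (BhRuler.CombType (n + 1) h))
    (fun q hq => by
      obtain ⟨M, hM, H⟩ := BhRuler.exists_bmh_cast_eq (n := n) (h := h) (by omega) hq
      refine ⟨M, hM, fun t ht hd => ?_⟩
      have := H t (by exact_mod_cast ht) (by exact_mod_cast hd)
      push_cast
      exact this)
  rw [key, Nat.add_sub_cancel]
  push_cast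
  rw [← mul_assoc, ← mul_pow]
  simp
end

section
/- Let m ≥ 1 and let a be a nonzero vector in ℕ^m. Then the minimum number r such that a can be written as a sum of r consecutive vectors (with repetition allowed) equals climb(a). -/
/-- The coordinates of a vector `a ∈ ℕ^m`, numbered `1,…,m`, with value `0` outside
this range (in particular `a_0 = 0`). -/
def coordOf {m : ℕ} (a : Fin m → ℕ) (j : ℕ) : ℕ :=
  if h : 1 ≤ j ∧ j ≤ m then a ⟨j - 1, by omega⟩ else 0

/-- The climb of a vector `a ∈ ℕ^m`: `Σ_{j=1}^m max(a_j - a_{j-1}, 0)`, with `a_0 = 0`. -/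
def climb {m : ℕ} (a : Fin m → ℕ) : ℕ :=
  ∑ j ∈ Finset.Icc 1 m, (coordOf a j - coordOf a (j - 1))

/-- The consecutive vector `e_{[j,k]} ∈ ℕ^m`: the 0/1 vector whose `i`-th coordinate
(coordinates numbered `1,…,m`) is 1 exactly when `j ≤ i ≤ k`. -/
def consecVec (m j k : ℕ) : Fin m → ℕ :=
  fun i => if j ≤ (i : ℕ) + 1 ∧ (i : ℕ) + 1 ≤ k then 1 else 0

/-- A consecutive vector in `ℕ^m`. -/
def IsConsecVec {m : ℕ} (c : Fin m → ℕ) : Prop :=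
  ∃ j k : ℕ, 1 ≤ j ∧ j ≤ k ∧ k ≤ m ∧ c = consecVec m j k

theorem coordOf_succ {m : ℕ} (a : Fin m → ℕ) (i : Fin m) :
    coordOf a ((i : ℕ) + 1) = a i := by
  have hi : 1 ≤ (i : ℕ) + 1 ∧ (i : ℕ) + 1 ≤ m := by omega
  simp [coordOf, hi]

theorem coordOf_add {m : ℕ} (a b : Fin m → ℕ) (i : ℕ) :
    coordOf (a + b) i = coordOf a i + coordOf b i := by
  unfold coordOf
  split_ifs <;> simp

theorem coordOf_consecVec {m j k : ℕ} (hj : 1 ≤ j) (hk : k ≤ m) (i : ℕ) :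
    coordOf (consecVec m j k) i = if j ≤ i ∧ i ≤ k then 1 else 0 := by
  unfold coordOf consecVec
  split_ifs <;> grind

theorem climb_zero {m : ℕ} : climb (0 : Fin m → ℕ) = 0 := by
  simp [climb, coordOf]

theorem climb_add_le {m : ℕ} (a b : Fin m → ℕ) : climb (a + b) ≤ climb a + climb b := by
  unfold climb
  rw [← Finset.sum_add_distrib]
  refine Finset.sum_le_sum fun i _ => ?_
  rw [coordOf_add, coordOf_add]
  omega

theorem climb_sum_le {m : ℕ} {ι : Type*} (s : Finset ι) (c : ι → Fin m → ℕ) :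
    climb (∑ i ∈ s, c i) ≤ ∑ i ∈ s, climb (c i) :=
  Finset.le_sum_of_subadditive climb climb_zero.le climb_add_le s c

theorem climb_consecVec {m j k : ℕ} (hj : 1 ≤ j) (hjk : j ≤ k) (hk : k ≤ m) :
    climb (consecVec m j k) = 1 := by
  unfold climb
  rw [Finset.sum_eq_single_of_mem j (Finset.mem_Icc.2 ⟨hj, hjk.trans hk⟩)]
  · simp only [coordOf_consecVec hj hk]
    grind
  · intro i _ hij
    simp only [coordOf_consecVec hj hk]
    grind

theorem IsConsecVec.climb_eq_one {m : ℕ} {c : Fin m → ℕ} (hc : IsConsecVec c) :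
    climb c = 1 := by
  obtain ⟨j, k, hj, hjk, hk, rfl⟩ := hc
  exact climb_consecVec hj hjk hk

theorem climb_add_consecVec {m j k : ℕ} (b : Fin m → ℕ) (hj : 1 ≤ j) (hjk : j ≤ k) (hk : k ≤ m)
    (hleft : coordOf b (j - 1) = 0) (hright : coordOf b (k + 1) = 0) :
    climb (b + consecVec m j k) = climb b + 1 := by
  rw [← climb_consecVec hj hjk hk]
  unfold climb
  rw [← Finset.sum_add_distrib]
  refine Finset.sum_congr rfl fun i hi => ?_
  have hi1 : 1 ≤ i := (Finset.mem_Icc.1 hi).1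
  simp only [coordOf_add, coordOf_consecVec hj hk]
  rcases eq_or_ne i j with rfl | hij
  · grind
  · rcases eq_or_ne i (k + 1) with rfl | hik
    · grind
    · grind

/-- Subtracting the indicator of a maximal interval of the support lowers the climb by one. -/
theorem exists_eq_add_isConsecVec {m : ℕ} {a : Fin m → ℕ} (ha : a ≠ 0) :
    ∃ b c : Fin m → ℕ, IsConsecVec c ∧ a = b + c ∧ climb a = climb b + 1 := by
  obtain ⟨i, hi⟩ := Function.ne_iff.1 ha
  have hpos : ∃ j, coordOf a j ≠ 0 := ⟨i + 1, by simpa [coordOf_succ] using hi⟩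
  obtain ⟨j, hj, hjmin⟩ : ∃ j, coordOf a j ≠ 0 ∧ ∀ l < j, coordOf a l = 0 :=
    ⟨Nat.find hpos, Nat.find_spec hpos, fun l hl => not_not.1 (Nat.find_min hpos hl)⟩
  have hjm : 1 ≤ j ∧ j ≤ m := by
    by_contra h
    exact hj (by simp [coordOf, h])
  have hzero : ∃ k, j ≤ k ∧ coordOf a (k + 1) = 0 := ⟨m, hjm.2, by simp [coordOf]⟩
  obtain ⟨k, ⟨hjk, hk⟩, hkmin⟩ : ∃ k, (j ≤ k ∧ coordOf a (k + 1) = 0) ∧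
      ∀ l < k, ¬(j ≤ l ∧ coordOf a (l + 1) = 0) :=
    ⟨Nat.find hzero, Nat.find_spec hzero, fun l hl => Nat.find_min hzero hl⟩
  have hkm : k ≤ m := by
    by_contra h
    exact hkmin m (by omega) ⟨hjm.2, by simp [coordOf]⟩
  have hsupp : ∀ l, j ≤ l → l ≤ k → coordOf a l ≠ 0 := by
    intro l hjl hlk hl
    rcases hjl.eq_or_lt with rfl | hlt
    · exact hj hl
    · exact hkmin (l - 1) (by omega) ⟨by omega, by rwa [Nat.sub_add_cancel (by omega)]⟩
  have hab : a = (a - consecVec m j k) + consecVec m j k := by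
    refine (tsub_add_cancel_of_le fun l => ?_).symm
    have hl := hsupp (l + 1)
    rw [coordOf_succ] at hl
    unfold consecVec
    split_ifs with h
    · exact Nat.one_le_iff_ne_zero.2 (hl h.1 h.2)
    · exact Nat.zero_le _
  have hle : ∀ l, coordOf a l = 0 → coordOf (a - consecVec m j k) l = 0 := by
    intro l hl
    rw [hab, coordOf_add] at hl
    omega
  refine ⟨a - consecVec m j k, consecVec m j k, ⟨j, k, hjm.1, hjk, hkm, rfl⟩, hab, ?_⟩
  conv_lhs => rw [hab]
  exact climb_add_consecVec _ hjm.1 hjk hkm (hle _ (hjmin _ (by omega))) (hle _ hk)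

theorem exists_sum_isConsecVec {m : ℕ} (a : Fin m → ℕ) :
    ∃ c : Fin (climb a) → Fin m → ℕ, (∀ i, IsConsecVec (c i)) ∧ a = ∑ i, c i := by
  induction h : climb a generalizing a with
  | zero =>
    refine ⟨Fin.elim0, fun i => i.elim0, ?_⟩
    by_contra hne
    obtain ⟨b, c, -, -, hclimb⟩ := exists_eq_add_isConsecVec (a := a) (by simpa using hne)
    omega
  | succ n ih =>
    have ha : a ≠ 0 := by
      rintro rfl
      simp [climb_zero] at h
    obtain ⟨b, d, hd, hab, hclimb⟩ := exists_eq_add_isConsecVec ha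
    obtain ⟨c, hc, hbc⟩ := ih b (by omega)
    refine ⟨Fin.cons d c, Fin.cases hd hc, ?_⟩
    rw [Fin.sum_univ_succ, hab, hbc, add_comm]
    simp

/-- The minimum number `r` such that a nonzero `a ∈ ℕ^m` is a sum of `r` consecutive
vectors equals `climb a`. -/
theorem climb_eq_min_consec_decomposition (m : ℕ) (hm : 1 ≤ m)
    (a : Fin m → ℕ) (ha : a ≠ 0) :
    IsLeast {r : ℕ | ∃ c : Fin r → Fin m → ℕ,
      (∀ i, IsConsecVec (c i)) ∧ a = ∑ i, c i} (climb a) := by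
  refine ⟨exists_sum_isConsecVec a, ?_⟩
  rintro r ⟨c, hc, rfl⟩
  calc climb (∑ i, c i) ≤ ∑ i, climb (c i) := climb_sum_le _ c
    _ = r := by simp [fun i => (hc i).climb_eq_one]
end

section
/- Let m ≥ 1 and h ≥ 2 be integers. Let Q be the set of all z ∈ ℝ^m with z_1, ..., z_m > 0 and z_1 + ... + z_m = 1 such that for every pair of distinct vectors a, b ∈ ℕ^m with disjoint supports and climb(a) + climb(b) ≤ h, one has Σ_{i=1}^m a_i z_i ≠ Σ_{i=1}^m b_i z_i. Then two points z, w ∈ Q lie in the same connected component of Q if and only if for every pair of distinct vectors a, b ∈ ℕ^m with disjoint supports and climb(a) + climb(b) ≤ h, the inequality Σ_{i=1}^m a_i z_i < Σ_{i=1}^m b_i z_i holds if and only if Σ_{i=1}^m a_i w_i < Σ_{i=1}^m b_i w_i. -/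
/-- The open region set for `B_h`-sets: the open standard simplex with the hyperplanes
`Σ a_i z_i = Σ b_i z_i` removed, for all distinct `a, b ∈ ℕ^m` with disjoint supports
and `climb a + climb b ≤ h`. -/
def regionSet (m h : ℕ) : Set (Fin m → ℝ) :=
  {z | (∀ i, 0 < z i) ∧ (∑ i, z i = 1) ∧
    ∀ a b : Fin m → ℕ, a ≠ b → (∀ i, a i = 0 ∨ b i = 0) → climb a + climb b ≤ h →
      ∑ i, (a i : ℝ) * z i ≠ ∑ i, (b i : ℝ) * z i}

/-- Two continuous functions that never agree on a preconnected set compare in the same way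
at all of its points. -/
theorem IsPreconnected.lt_of_lt_of_forall_ne {X : Type*} [TopologicalSpace X] {S : Set X}
    (hS : IsPreconnected S) {f g : X → ℝ} (hf : Continuous f) (hg : Continuous g)
    (hne : ∀ x ∈ S, f x ≠ g x) {x y : X} (hx : x ∈ S) (hy : y ∈ S) (hlt : f x < g x) :
    f y < g y := by
  by_contra! hle
  obtain ⟨c, hc, heq⟩ := hS.intermediate_value₂ hx hy hf.continuousOn hg.continuousOn hlt.le hle
  exact hne c hc heq

/-- A weighted sum is compatible with linear combinations of two vectors. -/
theorem sum_mul_linearCombination {m : ℕ} (c z w : Fin m → ℝ) (s t : ℝ) :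
    ∑ i, c i * (s • z + t • w) i = s * ∑ i, c i * z i + t * ∑ i, c i * w i := by
  simp only [Pi.add_apply, Pi.smul_apply, smul_eq_mul, Finset.mul_sum, ← Finset.sum_add_distrib]
  exact Finset.sum_congr rfl fun i _ => by ring

/-- A strict inequality that holds at two points holds for their convex combinations. -/
theorem convexCombination_lt {p q p' q' s t : ℝ} (hs : 0 ≤ s) (ht : 0 ≤ t) (hst : s + t = 1)
    (hp : p < q) (hp' : p' < q') : s * p + t * p' < s * q + t * q' := by
  rcases hs.eq_or_lt with rfl | hs
  · obtain rfl : t = 1 := by linarith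
    simpa using hp'
  · exact add_lt_add_of_lt_of_le (mul_lt_mul_of_pos_left hp hs)
      (mul_le_mul_of_nonneg_left hp'.le ht)

/-- If two points of the region set lie on the same side of every removed hyperplane, then
the segment between them stays in the region set. -/
theorem segment_subset_regionSet {m h : ℕ} {z w : Fin m → ℝ} (hz : z ∈ regionSet m h)
    (hw : w ∈ regionSet m h)
    (hside : ∀ a b : Fin m → ℕ, a ≠ b → (∀ i, a i = 0 ∨ b i = 0) → climb a + climb b ≤ h →
      (∑ i, (a i : ℝ) * z i < ∑ i, (b i : ℝ) * z i ↔
        ∑ i, (a i : ℝ) * w i < ∑ i, (b i : ℝ) * w i)) :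
    segment ℝ z w ⊆ regionSet m h := by
  rintro _ ⟨s, t, hs, ht, hst, rfl⟩
  refine ⟨fun i => ?_, ?_, fun a b hab hd hc => ?_⟩
  · simpa using convexCombination_lt hs ht hst (hz.1 i) (hw.1 i)
  · have hsum := sum_mul_linearCombination (fun _ => 1) z w s t
    simp only [one_mul, hz.2.1, hw.2.1] at hsum
    rw [hsum, mul_one, mul_one, hst]
  · rw [sum_mul_linearCombination, sum_mul_linearCombination]
    have hiff := hside a b hab hd hc
    rcases (hz.2.2 a b hab hd hc).lt_or_gt with hlt | hgt
    · exact (convexCombination_lt hs ht hst hlt (hiff.1 hlt)).ne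
    · have hgt' := (hw.2.2 a b hab hd hc).lt_or_gt.resolve_left
        fun hlt => hgt.asymm (hiff.2 hlt)
      exact (convexCombination_lt hs ht hst hgt hgt').ne'

/-- Two points of the region set lie in the same connected component iff they lie on the
same side of every hyperplane `Σ a_i z_i = Σ b_i z_i` with `a ≠ b` of disjoint supports
and `climb a + climb b ≤ h`. -/
theorem sameComponent_iff_sameSides (m h : ℕ) (hm : 1 ≤ m) (hh : 2 ≤ h)
    (z w : Fin m → ℝ) (hz : z ∈ regionSet m h) (hw : w ∈ regionSet m h) :
    w ∈ connectedComponentIn (regionSet m h) z ↔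
      ∀ a b : Fin m → ℕ, a ≠ b → (∀ i, a i = 0 ∨ b i = 0) → climb a + climb b ≤ h →
        (∑ i, (a i : ℝ) * z i < ∑ i, (b i : ℝ) * z i ↔
          ∑ i, (a i : ℝ) * w i < ∑ i, (b i : ℝ) * w i) := by
  constructor
  · intro hmem a b hab hd hc
    have hne : ∀ x ∈ connectedComponentIn (regionSet m h) z,
        ∑ i, (a i : ℝ) * x i ≠ ∑ i, (b i : ℝ) * x i := fun x hx =>
      (connectedComponentIn_subset _ _ hx).2.2 a b hab hd hc
    have hcont (c : Fin m → ℕ) : Continuous fun x : Fin m → ℝ => ∑ i, (c i : ℝ) * x i := by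
      fun_prop
    have hz' := mem_connectedComponentIn hz
    have hpre := isPreconnected_connectedComponentIn (F := regionSet m h) (x := z)
    exact ⟨hpre.lt_of_lt_of_forall_ne (hcont a) (hcont b) hne hz' hmem,
      hpre.lt_of_lt_of_forall_ne (hcont a) (hcont b) hne hmem hz'⟩
  · intro hside
    exact (convex_segment z w).isPreconnected.subset_connectedComponentIn
      (left_mem_segment ℝ z w) (segment_subset_regionSet hz hw hside) (right_mem_segment ℝ z w)
end

section
/- There exists a strict total order ≺ on the proper consecutive subsets of [5] = {1,2,3,4,5}, namely the transitive closure of the list {3} ≺ {5} ≺ {1} ≺ {4} ≺ {2} ≺ {3,4} ≺ {2,3} ≺ {1,2} ≺ {4,5} ≺ {1,2,3} ≺ {3,4,5} ≺ {2,3,4} ≺ {2,3,4,5} ≺ {1,2,3,4}, with the following properties: (i) whenever U and V are proper consecutive subsets with U strictly contained in V, then U ≺ V; (ii) whenever U, V, W are pairwise disjoint consecutive subsets such that U ∪ W and V ∪ W are proper consecutive subsets, then U ≺ V if and only if U ∪ W ≺ V ∪ W; and yet (iii) there is no vector z ∈ ℝ^5 with all coordinates positive such that for all proper consecutive subsets U,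 V of [5], U ≺ V implies Σ_{i∈U} z_i < Σ_{i∈V} z_i. -/
/-- A consecutive subset of `[5] = {1,…,5}`. -/
def IsConsec5 (U : Finset ℕ) : Prop :=
  ∃ i j : ℕ, 1 ≤ i ∧ i ≤ j ∧ j ≤ 5 ∧ U = Finset.Icc i j

/-- A proper consecutive subset of `[5]`. -/
def IsPCS5 (U : Finset ℕ) : Prop :=
  IsConsec5 U ∧ U ≠ Finset.Icc 1 5

/-- The proper consecutive subsets of `[5]`, listed in increasing order. -/
def orderedPCS5 : List (Finset ℕ) :=
  [{3}, {5}, {1}, {4}, {2}, Finset.Icc 3 4, Finset.Icc 2 3, Finset.Icc 1 2,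
    Finset.Icc 4 5, Finset.Icc 1 3, Finset.Icc 3 5, Finset.Icc 2 4,
    Finset.Icc 2 5, Finset.Icc 1 4]

theorem isConsec5_of_mem_orderedPCS5 :
    ∀ U ∈ orderedPCS5, ∃ i ≤ 5, ∃ j ≤ 5, 1 ≤ i ∧ i ≤ j ∧ U = Finset.Icc i j := by
  decide +kernel

theorem Icc_one_five_notMem_orderedPCS5 : Finset.Icc 1 5 ∉ orderedPCS5 := by
  decide +kernel

theorem IsConsec5.mem {U : Finset ℕ} (h : IsConsec5 U) :
    U ∈ Finset.Icc 1 5 :: orderedPCS5 := by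
  obtain ⟨i, j, hi, hij, hj, rfl⟩ := h
  have key : ∀ j ∈ Finset.Icc 1 5, ∀ i ∈ Finset.Icc 1 j,
      Finset.Icc i j ∈ Finset.Icc 1 5 :: orderedPCS5 := by decide +kernel
  exact key j (Finset.mem_Icc.2 ⟨hi.trans hij, hj⟩) i (Finset.mem_Icc.2 ⟨hi, hij⟩)

theorem isPCS5_iff_mem {U : Finset ℕ} : IsPCS5 U ↔ U ∈ orderedPCS5 := by
  constructor
  · rintro ⟨h, hne⟩
    exact (List.mem_cons.1 h.mem).resolve_left hne
  · intro h
    obtain ⟨i, -, j, hj, hi, hij, hU⟩ := isConsec5_of_mem_orderedPCS5 U h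
    refine ⟨⟨i, j, hi, hij, hj, hU⟩, ?_⟩
    rintro rfl
    exact Icc_one_five_notMem_orderedPCS5 h

/-- `U` strictly precedes `V` in the list `orderedPCS5`. -/
def PrecPCS5 (U V : Finset ℕ) : Prop :=
  U ∈ orderedPCS5 ∧ V ∈ orderedPCS5 ∧ orderedPCS5.idxOf U < orderedPCS5.idxOf V

instance : DecidableRel PrecPCS5 := fun U V => by
  unfold PrecPCS5; infer_instance

theorem precPCS5_of_ssubset :
    ∀ U ∈ orderedPCS5, ∀ V ∈ orderedPCS5, U ⊂ V → PrecPCS5 U V := by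
  decide +kernel

theorem precPCS5_union_iff :
    ∀ U ∈ Finset.Icc 1 5 :: orderedPCS5, ∀ V ∈ Finset.Icc 1 5 :: orderedPCS5, Disjoint U V →
      ∀ W ∈ Finset.Icc 1 5 :: orderedPCS5, Disjoint U W → Disjoint V W →
        U ∪ W ∈ orderedPCS5 → V ∪ W ∈ orderedPCS5 →
          (PrecPCS5 U V ↔ PrecPCS5 (U ∪ W) (V ∪ W)) := by
  decide +kernel

theorem isChain_precPCS5 : orderedPCS5.IsChain PrecPCS5 := by
  decide +kernel

/-- There is a strict total order `≺` on the proper consecutive subsets of `[5]`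
(the transitive closure of the listed chain) which is compatible with strict containment
and with disjoint unions, and yet is not realized by any positive real vector `z ∈ ℝ^5`. -/
theorem counterexample_coherent_orientation_not_realizable :
    ∃ r : Finset ℕ → Finset ℕ → Prop,
      -- `r` is a relation on proper consecutive subsets of `[5]`
      (∀ U V, r U V → IsPCS5 U ∧ IsPCS5 V) ∧
      -- strict total order: irreflexive, transitive, total on proper consecutive subsets
      (∀ U, ¬ r U U) ∧
      (∀ U V W, r U V → r V W → r U W) ∧
      (∀ U V, IsPCS5 U → IsPCS5 V → U ≠ V → r U V ∨ r V U) ∧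
      -- it contains the listed chain
      List.Chain' r
        [{3}, {5}, {1}, {4}, {2}, Finset.Icc 3 4, Finset.Icc 2 3, Finset.Icc 1 2,
          Finset.Icc 4 5, Finset.Icc 1 3, Finset.Icc 3 5, Finset.Icc 2 4,
          Finset.Icc 2 5, Finset.Icc 1 4] ∧
      -- (i) compatible with strict containment
      (∀ U V, IsPCS5 U → IsPCS5 V → U ⊂ V → r U V) ∧
      -- (ii) compatible with disjoint unions
      (∀ U V W, IsConsec5 U → IsConsec5 V → IsConsec5 W →
        Disjoint U V → Disjoint U W → Disjoint V W →
        IsPCS5 (U ∪ W) → IsPCS5 (V ∪ W) → (r U V ↔ r (U ∪ W) (V ∪ W))) ∧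
      -- (iii) not realizable by any positive vector
      ¬ ∃ z : ℕ → ℝ, (∀ i, 1 ≤ i → i ≤ 5 → 0 < z i) ∧
        ∀ U V, IsPCS5 U → IsPCS5 V → r U V → ∑ i ∈ U, z i < ∑ i ∈ V, z i := by
  refine ⟨PrecPCS5, fun U V h => ⟨isPCS5_iff_mem.2 h.1, isPCS5_iff_mem.2 h.2.1⟩,
    fun U h => lt_irrefl _ h.2.2, fun U V W h h' => ⟨h.1, h'.2.1, h.2.2.trans h'.2.2⟩,
    ?_, isChain_precPCS5, ?_, ?_, ?_⟩
  · intro U V hU hV hne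
    rw [isPCS5_iff_mem] at hU hV
    rcases lt_or_gt_of_ne (mt (List.idxOf_inj hU).1 hne) with h | h
    · exact Or.inl ⟨hU, hV, h⟩
    · exact Or.inr ⟨hV, hU, h⟩
  · intro U V hU hV
    exact precPCS5_of_ssubset U (isPCS5_iff_mem.1 hU) V (isPCS5_iff_mem.1 hV)
  · intro U V W hU hV hW hUV hUW hVW h h'
    exact precPCS5_union_iff U hU.mem V hV.mem hUV W hW.mem hUW hVW
      (isPCS5_iff_mem.1 h) (isPCS5_iff_mem.1 h')
  · rintro ⟨z, -, hz⟩
    have sum_lt : ∀ U V, PrecPCS5 U V → ∑ i ∈ U, z i < ∑ i ∈ V, z i := fun U V h =>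
      hz U V (isPCS5_iff_mem.2 h.1) (isPCS5_iff_mem.2 h.2.1) h
    have h51 := sum_lt {5} {1} (by decide +kernel)
    have h42 := sum_lt {4} {2} (by decide +kernel)
    have h1245 := sum_lt {1, 2} {4, 5} (by decide +kernel)
    simp only [Finset.sum_singleton] at h51 h42
    rw [Finset.sum_pair (by decide), Finset.sum_pair (by decide)] at h1245
    linarith
end

section
/- For every fixed integer m ≥ 1, the ratio b_m(t) / C(t−1, m−1) tends to 1 as the positive integer t tends to infinity, where C(t−1, m−1) denotes the binomial coefficient. -/
/-- A Golomb ruler: the differences `x j - x i` over pairs `i < j` are pairwise distinct. -/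
def IsGolomb (m : ℕ) (x : Fin (m + 1) → ℤ) : Prop :=
  ∀ i j k l : Fin (m + 1), i < j → k < l → x j - x i = x l - x k → i = k ∧ j = l

/-- `b_m(t)`: the number of Golomb rulers of length `t` with `m+1` markings. -/
noncomputable def golombCount (m : ℕ) (t : ℤ) : ℕ :=
  Nat.card {x : Fin (m + 1) → ℤ // IsRuler m t x ∧ IsGolomb m x}

theorem rulers_finite (m : ℕ) (t : ℤ) : {x : Fin (m + 1) → ℤ | IsRuler m t x}.Finite := by
  refine (Set.finite_Icc (fun _ => 0) (fun _ => t)).subset fun x hx => ?_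
  obtain ⟨hmono, h0, hl⟩ := hx
  exact ⟨fun i => h0 ▸ hmono.monotone (Fin.zero_le i),
    fun i => hl ▸ hmono.monotone (Fin.le_last i)⟩

/-- A ruler is determined by its set of interior markings. -/
theorem ncard_rulers (m t : ℕ) (hm : 1 ≤ m) (ht : 1 ≤ t) :
    {x : Fin (m + 1) → ℤ | IsRuler m t x}.ncard = (t - 1).choose (m - 1) := by
  classical
  have hcard : ((Finset.Ioo (0 : ℤ) t).powersetCard (m - 1)).card = (t - 1).choose (m - 1) := by
    rw [Finset.card_powersetCard, Int.card_Ioo]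
    congr 1
    omega
  rw [← hcard, ← Set.ncard_coe_finset]
  have hmem (x : Fin (m + 1) → ℤ) (hx : IsRuler m t x) :
      insert 0 (insert (t : ℤ) (((Finset.univ.image x).erase 0).erase t)) =
        Finset.univ.image x := by
    rw [Finset.insert_erase, Finset.insert_erase]
    · exact Finset.mem_image.2 ⟨0, Finset.mem_univ _, hx.2.1⟩
    · exact Finset.mem_erase.2 ⟨by omega, Finset.mem_image.2 ⟨_, Finset.mem_univ _, hx.2.2⟩⟩
  refine Set.ncard_congr (fun x _ => ((Finset.univ.image x).erase 0).erase t) ?_ ?_ ?_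
  · intro x hx
    obtain ⟨hmono, h0, hl⟩ := id hx
    rw [Finset.mem_coe, Finset.mem_powersetCard]
    constructor
    · intro a ha
      simp only [Finset.mem_erase, Finset.mem_image, Finset.mem_univ, true_and] at ha
      obtain ⟨hat, ha0, i, rfl⟩ := ha
      have h1 := hmono.monotone (Fin.zero_le i)
      have h2 := hmono.monotone (Fin.le_last i)
      rw [Finset.mem_Ioo]
      omega
    · have h := congrArg Finset.card (hmem x hx)
      rw [Finset.card_image_of_injective _ hmono.injective, Finset.card_insert_of_notMem,
        Finset.card_insert_of_notMem (by simp), Finset.card_univ, Fintype.card_fin] at h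
      · omega
      · simp
        omega
  · intro x y hx hy h
    have himage : Finset.univ.image x = Finset.univ.image y := by
      rw [← hmem x hx, ← hmem y hy]
      simp only [h]
    refine (hx.1.range_inj hy.1).1 ?_
    simpa using congrArg (fun s : Finset ℤ => (s : Set ℤ)) himage
  · intro s hs
    rw [Finset.mem_coe, Finset.mem_powersetCard] at hs
    obtain ⟨hsub, hsc⟩ := hs
    have h0s : (0 : ℤ) ∉ s := fun h => by simpa using hsub h
    have hts : (t : ℤ) ∉ s := fun h => by simpa using hsub h
    have h0ts : (0 : ℤ) ∉ insert (t : ℤ) s := by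
      rw [Finset.mem_insert, not_or]
      exact ⟨by omega, h0s⟩
    have hS : (insert 0 (insert (t : ℤ) s)).card = m + 1 := by
      rw [Finset.card_insert_of_notMem h0ts, Finset.card_insert_of_notMem hts]
      omega
    set S := insert 0 (insert (t : ℤ) s) with hSdef
    have hSicc : ∀ a ∈ S, 0 ≤ a ∧ a ≤ t := by
      intro a ha
      rw [hSdef, Finset.mem_insert, Finset.mem_insert] at ha
      rcases ha with rfl | rfl | ha
      · omega
      · omega
      · have := Finset.mem_Ioo.1 (hsub ha)
        omega
    set x := S.orderEmbOfFin hS with hx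
    have himage : Finset.univ.image x = S := Finset.image_orderEmbOfFin_univ S hS
    have hxS (i) : x i ∈ S := Finset.orderEmbOfFin_mem S hS i
    obtain ⟨i, -, hi⟩ := Finset.mem_image.1 (himage ▸ (by simp [hSdef] : (0 : ℤ) ∈ S))
    obtain ⟨j, -, hj⟩ := Finset.mem_image.1 (himage ▸ (by simp [hSdef] : (t : ℤ) ∈ S))
    refine ⟨x, ⟨x.strictMono, ?_, ?_⟩, ?_⟩
    · exact le_antisymm (hi ▸ x.monotone (Fin.zero_le i)) (hSicc _ (hxS 0)).1
    · exact le_antisymm (hSicc _ (hxS _)).2 (hj ▸ x.monotone (Fin.le_last j))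
    · rw [himage, hSdef, Finset.erase_insert h0ts, Finset.erase_insert hts]

/-- A nontrivial coincidence of two differences determines some interior marking from the
others. -/
theorem exists_interior_determined {m : ℕ} {i j k l : Fin (m + 1)} (hij : i < j) (hkl : k < l)
    (hne : ¬(i = k ∧ j = l)) :
    ∃ p : Fin (m + 1), p ≠ 0 ∧ p ≠ Fin.last m ∧ ∀ x y : Fin (m + 1) → ℤ,
      x j - x i = x l - x k → y j - y i = y l - y k → (∀ q, q ≠ p → x q = y q) → x = y := by
  suffices h : ∃ p : Fin (m + 1), p ≠ 0 ∧ p ≠ Fin.last m ∧ ∀ x y : Fin (m + 1) → ℤ,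
      x j - x i = x l - x k → y j - y i = y l - y k → (∀ q, q ≠ p → x q = y q) → x p = y p by
    obtain ⟨p, h0, hl, h⟩ := h
    refine ⟨p, h0, hl, fun x y hx hy hq => funext fun q => ?_⟩
    by_cases hqp : q = p
    · exact hqp ▸ h x y hx hy hq
    · exact hq q hqp
  have hlast (a : Fin (m + 1)) : a ≤ Fin.last m := Fin.le_last a
  have hzero (a : Fin (m + 1)) : 0 ≤ a := Fin.zero_le a
  rcases lt_trichotomy j l with hjl | rfl | hjl
  · refine ⟨j, ((hzero i).trans_lt hij).ne', (hjl.trans_le (hlast l)).ne,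
      fun x y hx hy hq => ?_⟩
    have h1 := hq i hij.ne
    have h2 := hq l hjl.ne'
    by_cases hkj : k = j
    · subst hkj
      omega
    · have h3 := hq k hkj
      omega
  · rcases lt_trichotomy i k with hik | rfl | hik
    · refine ⟨k, ((hzero i).trans_lt hik).ne', (hkl.trans_le (hlast j)).ne,
        fun x y hx hy hq => ?_⟩
      have h1 := hq i hik.ne
      have h2 := hq j hkl.ne'
      omega
    · exact absurd ⟨rfl, rfl⟩ hne
    · refine ⟨i, ((hzero k).trans_lt hik).ne', (hij.trans_le (hlast j)).ne,
        fun x y hx hy hq => ?_⟩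
      have h1 := hq k hik.ne
      have h2 := hq j hij.ne'
      omega
  · refine ⟨l, ((hzero k).trans_lt hkl).ne', (hjl.trans_le (hlast j)).ne,
      fun x y hx hy hq => ?_⟩
    have h1 := hq k hkl.ne
    have h2 := hq j hjl.ne'
    by_cases hil : i = l
    · subst hil
      omega
    · have h3 := hq i hil
      omega

/-- Rulers with a prescribed nontrivial coincidence of two differences. -/
theorem ncard_rulers_coincidence_le {m : ℕ} (hm : 1 ≤ m) (t : ℕ) {i j k l : Fin (m + 1)}
    (hij : i < j) (hkl : k < l) (hne : ¬(i = k ∧ j = l)) :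
    {x : Fin (m + 1) → ℤ | IsRuler m t x ∧ x j - x i = x l - x k}.ncard ≤
      (t + 1) ^ (m - 2) := by
  classical
  obtain ⟨p, hp0, hpl, hp⟩ := exists_interior_determined hij hkl hne
  have hl0 : Fin.last m ≠ 0 := by
    rw [Ne, Fin.ext_iff, Fin.val_last, Fin.val_zero]
    omega
  let Q : Finset (Fin (m + 1)) := {0, Fin.last m, p}ᶜ
  have hQ : Q.card = m - 2 := by
    rw [Finset.card_compl, Fintype.card_fin, Finset.card_insert_of_notMem, Finset.card_pair hpl.symm]
    · omega
    · simp [hl0.symm, hp0.symm]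
  have hF : (Fintype.piFinset fun _ : Q => Finset.Icc (0 : ℤ) t).card = (t + 1) ^ (m - 2) := by
    simp [Fintype.card_piFinset, hQ]
  rw [← hF, ← Set.ncard_coe_finset]
  refine Set.ncard_le_ncard_of_injOn (fun x (q : Q) => x q) ?_ ?_ (Finset.finite_toSet _)
  · rintro x ⟨⟨hmono, h0, hl⟩, -⟩
    rw [Finset.mem_coe, Fintype.mem_piFinset]
    intro q
    rw [Finset.mem_Icc]
    exact ⟨h0 ▸ hmono.monotone (Fin.zero_le _), hl ▸ hmono.monotone (Fin.le_last _)⟩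
  · rintro x ⟨⟨-, hx0, hxl⟩, hx⟩ y ⟨⟨-, hy0, hyl⟩, hy⟩ hxy
    refine hp x y hx hy fun q hqp => ?_
    by_cases hq0 : q = 0
    · rw [hq0, hx0, hy0]
    by_cases hql : q = Fin.last m
    · rw [hql, hxl, hyl]
    exact congrFun hxy ⟨q, by simp [Q, hq0, hql, hqp]⟩

theorem ncard_non_golomb_le (m t : ℕ) (hm : 1 ≤ m) :
    {x : Fin (m + 1) → ℤ | IsRuler m t x ∧ ¬IsGolomb m x}.ncard ≤
      (m + 1) ^ 4 * (t + 1) ^ (m - 2) := by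
  classical
  let I := Fin (m + 1) × Fin (m + 1) × Fin (m + 1) × Fin (m + 1)
  let J : Finset I := {a | a.1 < a.2.1 ∧ a.2.2.1 < a.2.2.2 ∧ ¬(a.1 = a.2.2.1 ∧ a.2.1 = a.2.2.2)}
  let B (a : I) : Set (Fin (m + 1) → ℤ) :=
    {x | IsRuler m t x ∧ x a.2.1 - x a.1 = x a.2.2.2 - x a.2.2.1}
  have hsub : {x : Fin (m + 1) → ℤ | IsRuler m t x ∧ ¬IsGolomb m x} ⊆ ⋃ a ∈ J, B a := by
    rintro x ⟨hx, hg⟩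
    simp only [IsGolomb, not_forall] at hg
    obtain ⟨i, j, k, l, hij, hkl, h, hne⟩ := hg
    exact Set.mem_biUnion (x := (i, j, k, l))
      (Finset.mem_filter.2 ⟨Finset.mem_univ _, hij, hkl, hne⟩) ⟨hx, h⟩
  have hfin : (⋃ a ∈ J, B a).Finite :=
    (rulers_finite m t).subset (Set.iUnion₂_subset fun a _ x hx => hx.1)
  calc _ ≤ (⋃ a ∈ J, B a).ncard := Set.ncard_le_ncard hsub hfin
    _ ≤ ∑ a ∈ J, (B a).ncard := Finset.set_ncard_biUnion_le J B
    _ ≤ J.card * (t + 1) ^ (m - 2) := by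
      refine Finset.sum_le_card_nsmul _ _ _ fun a ha => ?_
      obtain ⟨h1, h2, h3⟩ := (Finset.mem_filter.1 ha).2
      exact ncard_rulers_coincidence_le hm t h1 h2 h3
    _ ≤ _ := by
      refine Nat.mul_le_mul_right _ ((Finset.card_le_univ J).trans_eq ?_)
      simp only [I, Fintype.card_prod, Fintype.card_fin]
      ring

theorem golombCount_add_ncard_non_golomb (m t : ℕ) (hm : 1 ≤ m) (ht : 1 ≤ t) :
    golombCount m t + {x : Fin (m + 1) → ℤ | IsRuler m t x ∧ ¬IsGolomb m x}.ncard =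
      (t - 1).choose (m - 1) := by
  rw [← ncard_rulers m t hm ht]
  exact Set.ncard_inter_add_ncard_sdiff_eq_ncard _ {x | IsGolomb m x} (rulers_finite m t)

/-- With two markings there is only one difference. -/
theorem isGolomb_one (x : Fin 2 → ℤ) : IsGolomb 1 x := by
  intro i j k l hij hkl _
  omega

theorem pow_le_mul_choose (d t : ℕ) (ht : 2 * d + 3 ≤ t) :
    ((t : ℝ) + 1) ^ (d + 1) ≤ 2 ^ (d + 1) * (d + 1).factorial * ((t - 1).choose (d + 1) : ℝ) := by
  have h1 := Nat.pow_le_choose (α := ℝ) (d + 1) (t - 1)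
  rw [div_le_iff₀ (by positivity)] at h1
  have h2 : (t : ℝ) + 1 ≤ 2 * ((t - 1 + 1 - (d + 1) : ℕ) : ℝ) := by
    exact_mod_cast (by omega : t + 1 ≤ 2 * (t - 1 + 1 - (d + 1)))
  calc ((t : ℝ) + 1) ^ (d + 1) ≤ (2 * ((t - 1 + 1 - (d + 1) : ℕ) : ℝ)) ^ (d + 1) := by gcongr
    _ = 2 ^ (d + 1) * ((t - 1 + 1 - (d + 1) : ℕ) : ℝ) ^ (d + 1) := mul_pow _ _ _
    _ ≤ 2 ^ (d + 1) * (((t - 1).choose (d + 1) : ℝ) * (d + 1).factorial) := by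
      gcongr
    _ = _ := by ring

/-- For fixed `m ≥ 1`, `b_m(t) / C(t-1, m-1) → 1` as `t → ∞`. -/
theorem golombCount_ratio_tendsto_one (m : ℕ) (hm : 1 ≤ m) :
    Filter.Tendsto
      (fun t : ℕ => (golombCount m (t : ℤ) : ℝ) / (Nat.choose (t - 1) (m - 1) : ℝ))
      Filter.atTop (nhds 1) := by
  obtain rfl | ⟨d, rfl⟩ : m = 1 ∨ ∃ d, m = d + 2 := by
    rcases hm.eq_or_lt with h | h
    · exact Or.inl h.symm
    · exact Or.inr ⟨m - 2, by omega⟩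
  · refine tendsto_const_nhds.congr' ?_
    filter_upwards [Filter.eventually_ge_atTop 1] with t ht
    have h := golombCount_add_ncard_non_golomb 1 t le_rfl ht
    simp only [isGolomb_one, not_true_eq_false, and_false, Set.ofPred_false, Set.ncard_empty,
      add_zero, Nat.sub_self, Nat.choose_zero_right] at h
    simp [h]
  · let C : ℝ := (d + 3 : ℝ) ^ 4 * (2 ^ (d + 1) * (d + 1).factorial)
    have hlim : Filter.Tendsto (fun t : ℕ => 1 - C * (1 / ((t : ℝ) + 1))) Filter.atTop (nhds 1) := by
      simpa using (tendsto_one_div_add_atTop_nhds_zero_nat.const_mul C).const_sub 1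
    refine tendsto_of_tendsto_of_tendsto_of_le_of_le' hlim tendsto_const_nhds ?_ ?_
    all_goals
      filter_upwards [Filter.eventually_ge_atTop (2 * d + 3)] with t ht
      have hcount := golombCount_add_ncard_non_golomb (d + 2) t hm (by omega)
      have hpos : (0 : ℝ) < ((t - 1).choose (d + 2 - 1) : ℝ) := by
        exact_mod_cast Nat.choose_pos (by omega)
    · have hbad := ncard_non_golomb_le (d + 2) t hm
      have hchoose := pow_le_mul_choose d t ht
      have hbound : ((t - 1).choose (d + 1) : ℝ) ≤
          golombCount (d + 2) t + (d + 3 : ℝ) ^ 4 * ((t : ℝ) + 1) ^ d := by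
        exact_mod_cast hcount.symm.le.trans (Nat.add_le_add_left hbad _)
      have ht0 : (0 : ℝ) < (t : ℝ) + 1 := by positivity
      have hkey : (d + 3 : ℝ) ^ 4 * ((t : ℝ) + 1) ^ d ≤
          C * (1 / ((t : ℝ) + 1)) * ((t - 1).choose (d + 1) : ℝ) := by
        rw [mul_one_div, div_mul_eq_mul_div, le_div_iff₀ ht0]
        calc (d + 3 : ℝ) ^ 4 * ((t : ℝ) + 1) ^ d * ((t : ℝ) + 1)
            = (d + 3 : ℝ) ^ 4 * ((t : ℝ) + 1) ^ (d + 1) := by ring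
          _ ≤ (d + 3 : ℝ) ^ 4 *
              (2 ^ (d + 1) * (d + 1).factorial * ((t - 1).choose (d + 1) : ℝ)) := by gcongr
          _ = _ := by ring
      rw [le_div_iff₀ hpos, sub_mul, one_mul]
      have hidx : d + 2 - 1 = d + 1 := rfl
      rw [hidx]
      linarith
    · rw [div_le_one hpos]
      exact_mod_cast Nat.le.intro hcount
end

section
/- For every integer m ≥ 1, the Golomb counting function b_m(t) is a quasipolynomial in t of degree m−1 with leading coefficient 1/(m−1)!. Moreover, if s ≥ 1 and rational polynomials p_0, ..., p_{s-1} represent this quasipolynomial (i.e. b_m(t) = p_{t mod s}(t) for all positive integers t), then (−1)^{m−1} · p_0(0) equals the number of combinatorial types of Golomb rulers with m+1 markings, that is, the number of equivalence classes of real Golomb rulers of length 1 with m+1 markings under combinatorial equivalence. -/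
/-- A real Golomb ruler: the differences `y j - y i` over pairs `i < j` are pairwise
distinct. -/
def IsRealGolomb (m : ℕ) (y : Fin (m + 1) → ℝ) : Prop :=
  ∀ i j k l : Fin (m + 1), i < j → k < l → y j - y i = y l - y k → i = k ∧ j = l

/-- A consecutive subset of `[m] = {1,…,m}`. -/
def IsConsec (m : ℕ) (U : Finset ℕ) : Prop :=
  ∃ i j : ℕ, 1 ≤ i ∧ i ≤ j ∧ j ≤ m ∧ U = Finset.Icc i j

/-- The successive differences `z_i = y_i - y_{i-1}` (for `1 ≤ i ≤ m`) of a real ruler. -/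
def succDiff (m : ℕ) (y : Fin (m + 1) → ℝ) (i : ℕ) : ℝ :=
  if h : 1 ≤ i ∧ i ≤ m then y ⟨i, by omega⟩ - y ⟨i - 1, by omega⟩ else 0

/-- Combinatorial equivalence of real Golomb rulers: all strict inequalities between sums
of successive differences over consecutive subsets of `[m]` agree. -/
def CombEquivGolomb (m : ℕ) (y y' : Fin (m + 1) → ℝ) : Prop :=
  ∀ U V : Finset ℕ, IsConsec m U → IsConsec m V →
    ((∑ i ∈ U, succDiff m y i) < ∑ i ∈ V, succDiff m y i ↔
      (∑ i ∈ U, succDiff m y' i) < ∑ i ∈ V, succDiff m y' i)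

/-- The setoid of combinatorial equivalence on real Golomb rulers of length 1. -/
def golombSetoid (m : ℕ) :
    Setoid {y : Fin (m + 1) → ℝ // IsRealRuler m 1 y ∧ IsRealGolomb m y} where
  r a b := CombEquivGolomb m a.1 b.1
  iseqv :=
    ⟨fun _ _ _ _ _ => Iff.rfl,
     fun hab U V hU hV => (hab U V hU hV).symm,
     fun hab hbc U V hU hV => (hab U V hU hV).trans (hbc U V hU hV)⟩

/-- `f` agrees on positive integers with a quasipolynomial of degree at most `d` whose constituent
for the residue class of `0` has constant term `a`. -/
def IsQuasiPoly (d : ℕ) (a : ℚ) (f : ℕ → ℕ) : Prop :=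
  ∃ s : ℕ, 0 < s ∧ ∃ P : ℕ → Polynomial ℚ, (∀ i, (P i).natDegree ≤ d) ∧
    (∀ t : ℕ, 0 < t → (f t : ℚ) = (P (t % s)).eval (t : ℚ)) ∧ (P 0).eval 0 = a

namespace IsQuasiPoly

variable {d : ℕ} {a b : ℚ} {f g : ℕ → ℕ}

theorem congr (hf : IsQuasiPoly d a f) (hab : a = b) (hfg : ∀ t, 0 < t → f t = g t) :
    IsQuasiPoly d b g := by
  obtain ⟨s, hs, P, hd, he, h0⟩ := hf
  exact ⟨s, hs, P, hd, fun t ht => hfg t ht ▸ he t ht, hab ▸ h0⟩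

theorem zero (d : ℕ) : IsQuasiPoly d 0 (fun _ => 0) :=
  ⟨1, one_pos, 0, by simp, by simp, by simp⟩

theorem add (hf : IsQuasiPoly d a f) (hg : IsQuasiPoly d b g) :
    IsQuasiPoly d (a + b) (fun t => f t + g t) := by
  obtain ⟨s, hs, P, hd, he, h0⟩ := hf
  obtain ⟨s', hs', P', hd', he', h0'⟩ := hg
  refine ⟨s * s', by positivity, fun i => P (i % s) + P' (i % s'), fun i => ?_, fun t ht => ?_, ?_⟩
  · exact (Polynomial.natDegree_add_le _ _).trans (max_le (hd _) (hd' _))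
  · simp only [Nat.mod_mul_right_mod, Nat.mod_mul_left_mod, Polynomial.eval_add, Nat.cast_add]
    rw [he t ht, he' t ht]
  · simp [h0, h0']

theorem sum {κ : Type*} (S : Finset κ) (α : κ → ℚ) (F : κ → ℕ → ℕ)
    (h : ∀ i ∈ S, IsQuasiPoly d (α i) (F i)) :
    IsQuasiPoly d (∑ i ∈ S, α i) (fun t => ∑ i ∈ S, F i t) := by
  classical
  induction S using Finset.induction_on with
  | empty => simpa using zero d
  | insert i S hi ih =>
    simp only [Finset.sum_insert hi]
    exact (h i (by simp)).add (ih fun j hj => h j (by simp [hj]))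

end IsQuasiPoly

/-- The number of ways to write `t` as `n` plus `s` times an ordered sum of `k` naturals is a
quasipolynomial in `t`. -/
theorem isQuasiPoly_choose (s k n : ℕ) (hs : 0 < s) (hn : 0 < n)
    (hnk : n ≤ s * (k + 1)) :
    IsQuasiPoly k (if n = s * (k + 1) then (-1) ^ k else 0)
      (fun t => if n ≤ t ∧ s ∣ t - n then ((t - n) / s + k).choose k else 0) := by
  have hs' : (s : ℚ) ≠ 0 := by positivity
  set Q : Polynomial ℚ := Polynomial.C (1 / (k.factorial : ℚ)) *
    ∏ j ∈ Finset.range k, (Polynomial.C (1 / (s : ℚ)) * (Polynomial.X - Polynomial.C (n : ℚ)) +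
      Polynomial.C ((j : ℚ) + 1)) with hQ
  have hQe (t : ℚ) : Q.eval t =
      1 / (k.factorial : ℚ) * ∏ j ∈ Finset.range k, ((t - n) / s + (j + 1)) := by
    rw [hQ, Polynomial.eval_mul, Polynomial.eval_prod, Polynomial.eval_C]
    congr 1
    refine Finset.prod_congr rfl fun j _ => ?_
    simp
    ring
  have hQd : Q.natDegree ≤ k := by
    refine (Polynomial.natDegree_C_mul_le _ _).trans ((Polynomial.natDegree_prod_le _ _).trans ?_)
    refine (Finset.sum_le_card_nsmul _ _ 1 fun j _ => ?_).trans (by simp)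
    refine Polynomial.natDegree_add_le_of_degree_le ?_
      ((Polynomial.natDegree_C _).le.trans zero_le_one)
    exact (Polynomial.natDegree_C_mul_le _ _).trans (Polynomial.natDegree_X_sub_C_le _)
  have hvanish (t y : ℕ) (hy : 1 ≤ y) (hyk : y ≤ k) (h : t + s * y = n) : Q.eval (t : ℚ) = 0 := by
    rw [hQe, Finset.prod_eq_zero (i := y - 1) (by simp; omega), mul_zero]
    rw [← h]
    push_cast [Nat.cast_sub hy]
    field_simp
    ring
  refine ⟨s, hs, fun i => if i ≡ n [MOD s] then Q else 0, fun i => ?_, fun t ht => ?_, ?_⟩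
  · dsimp only
    split_ifs
    · exact hQd
    · simp
  · have hmod : t % s ≡ n [MOD s] ↔ t ≡ n [MOD s] := by simp [Nat.ModEq]
    simp only [hmod]
    by_cases hnt : n ≤ t
    · have : t ≡ n [MOD s] ↔ s ∣ t - n := by
        rw [Nat.ModEq.comm, Nat.modEq_iff_dvd' hnt]
      simp only [this, hnt, true_and]
      split_ifs with hd
      · obtain ⟨x, hx⟩ := hd
        rw [hx, Nat.mul_div_cancel_left _ hs, hQe]
        have hx' : ((t : ℚ) - n) / s = x := by
          rw [← Nat.cast_sub hnt, hx]; push_cast; field_simp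
        have hc := Nat.ascFactorial_eq_factorial_mul_choose x k
        rw [Nat.ascFactorial_eq_prod_range] at hc
        have hc' : ∏ j ∈ Finset.range k, ((x : ℚ) + (j + 1)) =
            (k.factorial : ℚ) * ((x + k).choose k : ℕ) := by
          rw [← Nat.cast_mul, ← hc]
          push_cast
          exact Finset.prod_congr rfl fun j _ => by ring
        have := k.factorial_ne_zero
        rw [hx', hc']
        field_simp
      · simp
    · simp only [hnt, false_and, if_false, Nat.cast_zero]
      split_ifs with hd
      · obtain ⟨y, hy⟩ := (Nat.modEq_iff_dvd' (le_of_not_ge hnt)).1 hd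
        refine (hvanish t y ?_ ?_ (by omega)).symm
        · rcases Nat.eq_zero_or_pos y with rfl | h
          · simp at hy; omega
          · exact h
        · by_contra! hc
          have := Nat.mul_le_mul_left s hc
          simp at this
          omega
      · simp
  · dsimp only
    by_cases hd : s ∣ n
    · obtain ⟨y, rfl⟩ := hd
      rw [if_pos ((Nat.modEq_zero_iff_dvd.2 ⟨y, rfl⟩).symm)]
      have hyk := Nat.le_of_mul_le_mul_left hnk hs
      have hy : 1 ≤ y := Nat.pos_of_mul_pos_left hn
      by_cases hk : y = k + 1
      · subst hk
        rw [if_pos rfl, hQe]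
        have : ∀ j ∈ Finset.range k, ((0 : ℚ) - (s * (k + 1) : ℕ)) / s + (j + 1)
            = (-1) * ((k - 1 - j : ℕ) + 1 : ℚ) := by
          intro j hj
          have : j + 1 ≤ k := by simpa using hj
          rw [Nat.sub_sub, add_comm 1 j, Nat.cast_sub this]
          push_cast
          field_simp
          ring
        rw [Finset.prod_congr rfl this, Finset.prod_mul_distrib,
          Finset.prod_range_reflect (fun j => (j : ℚ) + 1)]
        have : ∏ j ∈ Finset.range k, ((j : ℚ) + 1) = k.factorial := by
          rw [← Finset.prod_range_add_one_eq_factorial]; push_cast; rfl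
        rw [this]
        have := k.factorial_ne_zero
        simp
        field_simp
      · rw [if_neg fun h => hk (Nat.eq_of_mul_eq_mul_left hs h)]
        exact_mod_cast hvanish 0 y hy (by omega) (by simp)
    · rw [if_neg fun h => hd (Nat.modEq_zero_iff_dvd.1 h.symm), if_neg]
      · simp
      · rintro rfl; exact hd ⟨_, rfl⟩

/-- Positivity of `(a, -b)` for the lexicographic order, i.e. of `a - ε b` for all sufficiently
small `ε > 0`. -/
def PerturbedPos (a : ℤ) (b : ℝ) : Prop := 0 < a ∨ a = 0 ∧ b < 0

section Counting

variable {ι : Type*} [Fintype ι]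

/-- The lattice points `z` of weight `t` such that `z - ε p` lies, for all sufficiently small
`ε > 0`, in the part of the open positive orthant on which all forms in `H` are positive. -/
def coneSlice (p : ι → ℝ) (H : List (ι → ℤ)) (w : ι → ℕ) (t : ℕ) : Set (ι → ℤ) :=
  {z | (∀ l, PerturbedPos (z l) (p l)) ∧
    (∀ h ∈ H, PerturbedPos (∑ l, h l * z l) (∑ l, (h l : ℝ) * p l)) ∧ ∑ l, (w l : ℤ) * z l = t}

theorem coneSlice_finite (p : ι → ℝ) (H : List (ι → ℤ)) {w : ι → ℕ} (hw : ∀ l, 0 < w l) (t : ℕ) :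
    (coneSlice p H w t).Finite := by
  refine (Set.Finite.pi' fun _ : ι => Set.finite_Icc (0 : ℤ) t).subset ?_
  rintro z ⟨hz, -, ht⟩ l
  have hz' (l) : 0 ≤ z l := by rcases hz l with h | h <;> omega
  refine ⟨hz' l, ?_⟩
  rw [← ht]
  refine le_trans ?_ (Finset.single_le_sum (f := fun l => (w l : ℤ) * z l)
    (fun i _ => mul_nonneg (by positivity) (hz' i)) (Finset.mem_univ l))
  have : (1 : ℤ) ≤ w l := by exact_mod_cast hw l
  nlinarith [hz' l]

theorem ncard_sum_eq (k n s t : ℕ) (hk : Fintype.card ι = k + 1) (hs : 0 < s) :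
    {a : ι → ℕ | n + s * ∑ l, a l = t}.ncard =
      if n ≤ t ∧ s ∣ t - n then ((t - n) / s + k).choose k else 0 := by
  classical
  split_ifs with h
  · obtain ⟨hn, x, hx⟩ := h
    have : {a : ι → ℕ | n + s * ∑ l, a l = t} = {a | ∑ l, a l = x} := by
      ext a
      simp only [Set.mem_ofPred_eq]
      constructor
      · intro h
        exact Nat.eq_of_mul_eq_mul_left hs (by omega)
      · rintro rfl; omega
    rw [this, hx, Nat.mul_div_cancel_left _ hs]
    have := Nat.card_congr (Sym.equivNatSumOfFintype ι x)
    rw [Nat.card_eq_fintype_card, Sym.card_sym_eq_choose, hk] at this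
    rw [← Nat.card_coe_set_eq]
    refine this.symm.trans ?_
    rw [← Nat.choose_symm_add]
    congr 1; omega
  · have : {a : ι → ℕ | n + s * ∑ l, a l = t} = ∅ := by
      refine Set.eq_empty_of_forall_notMem fun a ha => h ?_
      have : n + s * ∑ l, a l = t := ha
      exact ⟨by omega, _, by rw [← this, Nat.add_sub_cancel_left]⟩
    rw [this, Set.ncard_empty]

theorem isQuasiPoly_orthant {k : ℕ} (hk : Fintype.card ι = k + 1) {p : ι → ℝ} {w : ι → ℕ}
    (hw : ∀ l, 0 < w l) (hp : ∀ l, p l ≠ 0) (hp' : ∃ l, 0 < p l) :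
    IsQuasiPoly k (open Classical in if ∀ l, 0 < p l then (-1) ^ k else 0)
      (fun t => (coneSlice p [] w t).ncard) := by
  classical
  set s := ∏ l, w l with hs
  have hs0 : 0 < s := Finset.prod_pos fun l _ => hw l
  set e : ι → ℕ := fun l => s / w l with he
  have hwe (l) : w l * e l = s := Nat.mul_div_cancel' (Finset.dvd_prod_of_mem w (Finset.mem_univ l))
  have he0 (l) : 0 < e l := Nat.pos_of_mul_pos_left ((hwe l).symm ▸ hs0)
  set δ : ι → ℕ := fun l => if 0 < p l then 1 else 0 with hδ
  have hδ1 (l) : δ l ≤ 1 := by simp only [hδ]; split_ifs <;> simp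
  have hpos (a : ℤ) (l : ι) : PerturbedPos a (p l) ↔ (δ l : ℤ) ≤ a := by
    simp only [PerturbedPos, hδ]
    rcases lt_or_gt_of_ne (hp l) with h | h
    · simp [h, h.le.not_gt, le_iff_lt_or_eq, eq_comm]
    · simp [h, h.le.not_gt, Int.lt_iff_add_one_le]
  set N : ((l : ι) → Fin (e l)) → ℕ := fun ρ => ∑ l, w l * (δ l + ρ l) with hN
  set φ : ((l : ι) → Fin (e l)) → (ι → ℕ) → ι → ℤ :=
    fun ρ a l => ((δ l + ρ l + e l * a l : ℕ) : ℤ) with hφ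
  have hinj (ρ ρ' a a') (h : φ ρ a = φ ρ' a') : ρ = ρ' ∧ a = a' := by
    have h' (l) : (ρ l : ℕ) + e l * a l = ρ' l + e l * a' l := by
      have := congrFun h l
      simp only [hφ, Nat.cast_inj] at this
      omega
    refine ⟨funext fun l => Fin.ext ?_, funext fun l => ?_⟩
    · have := congrArg (· % e l) (h' l)
      simpa [Nat.mod_eq_of_lt] using this
    · have := congrArg (· / e l) (h' l)
      simpa [Nat.add_mul_div_left _ _ (he0 l), Nat.div_eq_of_lt] using this
  have hsumN (ρ) (a : ι → ℕ) : ∑ l, w l * (δ l + ρ l + e l * a l) = N ρ + s * ∑ l, a l := by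
    rw [hN, Finset.mul_sum, ← Finset.sum_add_distrib]
    exact Finset.sum_congr rfl fun l _ => by rw [← hwe l]; ring
  have hunion (t : ℕ) : coneSlice p [] w t = ⋃ ρ, φ ρ '' {a | N ρ + s * ∑ l, a l = t} := by
    ext z
    simp only [coneSlice, hpos, Set.mem_iUnion, Set.mem_image, Set.mem_ofPred_eq]
    constructor
    · rintro ⟨hz, -, ht⟩
      set r : ι → ℕ := fun l => (z l - δ l).toNat with hr
      have hr' (l) : z l = (δ l + r l : ℕ) := by
        have := hz l
        simp only [hr]; omega
      have hrd (l) : δ l + r l % e l + e l * (r l / e l) = δ l + r l := by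
        rw [add_assoc, Nat.mod_add_div]
      refine ⟨fun l => ⟨r l % e l, Nat.mod_lt _ (he0 l)⟩, fun l => r l / e l, ?_, ?_⟩
      · rw [← hsumN]
        simp only [hrd]
        simp only [hr'] at ht
        exact_mod_cast ht
      · ext l
        simp only [hφ, hrd, hr' l]
    · rintro ⟨ρ, a, ha, rfl⟩
      refine ⟨fun l => by simp only [hφ, Nat.cast_le]; omega, by simp, ?_⟩
      rw [← hsumN] at ha
      simp only [hφ]
      exact_mod_cast ha
  have hcard (t : ℕ) : ∑ ρ, (if N ρ ≤ t ∧ s ∣ t - N ρ then ((t - N ρ) / s + k).choose k else 0) =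
      (coneSlice p [] w t).ncard := by
    have hfin := coneSlice_finite p [] hw t
    rw [hunion t] at hfin ⊢
    rw [Set.ncard_iUnion_of_finite (fun ρ => hfin.subset (Set.subset_iUnion _ ρ)),
      finsum_eq_sum_of_fintype]
    · refine Finset.sum_congr rfl fun ρ _ => ?_
      rw [Set.ncard_image_of_injective _ fun a a' h => (hinj ρ ρ a a' h).2,
        ncard_sum_eq k _ s t hk hs0]
    · intro ρ ρ' hρ
      refine Set.disjoint_left.2 ?_
      rintro _ ⟨a, -, rfl⟩ ⟨a', -, h⟩
      exact hρ (hinj _ _ _ _ h).1.symm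
  have hle (ρ : (l : ι) → Fin (e l)) (l) : w l * (δ l + ρ l) ≤ s := by
    have h1 := hδ1 l
    have h2 := (ρ l).2
    have h3 : δ l + ρ l ≤ e l := by omega
    exact (Nat.mul_le_mul_left _ h3).trans (hwe l).le
  have hcs : ∑ _l : ι, s = s * (k + 1) := by simp [hk, mul_comm]
  have hNs (ρ) : N ρ = s * (k + 1) ↔ (∀ l, 0 < p l) ∧ ∀ l, (ρ l : ℕ) = e l - 1 := by
    rw [← hcs, hN, Finset.sum_eq_sum_iff_of_le fun l _ => hle ρ l, ← forall_and]
    simp only [Finset.mem_univ, true_imp_iff]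
    refine forall_congr' fun l => ?_
    have h1 : w l * (δ l + ρ l) = s ↔ δ l + ρ l = e l := by
      rw [← hwe l]
      exact Nat.mul_right_inj (hw l).ne'
    rw [h1]
    have hρ := (ρ l).2
    have := he0 l
    by_cases h : 0 < p l
    · have hδl : δ l = 1 := if_pos h
      simp only [hδl, h, true_and]
      omega
    · have hδl : δ l = 0 := if_neg h
      simp only [hδl, h, false_and, iff_false]
      omega
  refine (IsQuasiPoly.sum Finset.univ _ _ fun ρ _ => isQuasiPoly_choose s k (N ρ) hs0 ?_ ?_).congr
    ?_ fun t _ => hcard t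
  · obtain ⟨l, hl⟩ := hp'
    refine lt_of_lt_of_le ?_ (Finset.single_le_sum (f := fun l => w l * (δ l + ρ l))
      (fun _ _ => Nat.zero_le _) (Finset.mem_univ l))
    have := hw l
    simp only [hδ, if_pos hl]
    positivity
  · rw [← hcs]
    exact Finset.sum_le_sum fun l _ => hle ρ l
  · simp only [hNs]
    split_ifs with h
    · simp only [h, implies_true, true_and]
      rw [Finset.sum_eq_single (fun l => ⟨e l - 1, Nat.sub_lt (he0 l) one_pos⟩)]
      · simp
      · intro ρ _ hρ
        rw [if_neg fun h => hρ (funext fun l => Fin.ext (h l))]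
      · simp
    · simp [h]

end Counting

section Elliott

variable {ι : Type*} [Fintype ι] [DecidableEq ι]

/-- The part of Elliott's reduction in which an entry of largest absolute value is positive. -/
theorem elliott_induction_of_pos {P : (ι → ℤ) → Prop}
    (hnonneg : ∀ c, (∀ l, 0 ≤ c l) → P c)
    (hstep : ∀ c i j, 0 < c i → c j < 0 → P (Function.update c j (c i + c j)) →
      P (Function.update c i (c j + c i)) → P c) {B : ℤ} {n : ℕ} (hB : 0 < B)
    (ih : ∀ c : ι → ℤ, (∀ l, |c l| ≤ B) →
      (Finset.univ.filter fun l => |c l| = B).card < n → P c)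
    (o : ℕ) : ∀ (c : ι → ℤ) (i : ι), (∀ l, |c l| ≤ B) →
      (Finset.univ.filter fun l => |c l| = B).card ≤ n → c i = B →
      (Finset.univ.filter fun l => c l < 0).card ≤ o → P c := by
  induction o with
  | zero =>
    intro c i _ _ _ ho
    refine hnonneg c fun l => ?_
    simp only [nonpos_iff_eq_zero, Finset.card_eq_zero, Finset.filter_eq_empty_iff] at ho
    simpa using ho (Finset.mem_univ l)
  | succ o iho =>
    intro c i hc hn hi ho
    by_cases hneg : ∃ j, c j < 0
    · obtain ⟨j, hj⟩ := hneg
      have hij : i ≠ j := by rintro rfl; omega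
      have hjB := abs_le.1 (hc j)
      have hlt : |c i + c j| < B := abs_lt.2 ⟨by omega, by omega⟩
      refine hstep c i j (by omega) hj (iho _ i (fun l => ?_) ?_ ?_ ?_) (ih _ (fun l => ?_) ?_)
      · by_cases hl : l = j
        · subst hl; simpa using hlt.le
        · simpa [hl] using hc l
      · refine (Finset.card_le_card fun l hl => ?_).trans hn
        simp only [Finset.mem_filter, Finset.mem_univ, true_and] at hl ⊢
        by_cases hlj : l = j
        · subst hlj; simp at hl; omega
        · simpa [hlj] using hl
      · simpa [hij] using hi
      · refine Nat.le_of_lt_succ (lt_of_lt_of_le (Finset.card_lt_card ?_) ho)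
        refine Finset.ssubset_iff_of_subset (fun l hl => ?_) |>.2 ⟨j, by simpa using hj, ?_⟩
        · simp only [Finset.mem_filter, Finset.mem_univ, true_and] at hl ⊢
          by_cases hlj : l = j
          · subst hlj; exact hj
          · simpa [hlj] using hl
        · simp; omega
      · by_cases hl : l = i
        · subst hl; simpa [add_comm] using hlt.le
        · simpa [hl] using hc l
      · refine lt_of_lt_of_le (Finset.card_lt_card ?_) hn
        refine Finset.ssubset_iff_of_subset (fun l hl => ?_) |>.2
          ⟨i, by simp [hi, abs_of_pos hB], ?_⟩
        · simp only [Finset.mem_filter, Finset.mem_univ, true_and] at hl ⊢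
          by_cases hli : l = i
          · subst hli; rw [hi, abs_of_pos hB]
          · simpa [hli] using hl
        · simp [add_comm (c j), hlt.ne]
    · push Not at hneg
      exact hnonneg c hneg

/-- Elliott's reduction as an induction principle for integer vectors: a property that holds for
vectors without sign changes, and that can be deduced for `c` from the two vectors obtained by
replacing one of two entries of opposite sign by their sum, holds for all vectors. -/
theorem elliott_induction {P : (ι → ℤ) → Prop} (hnonpos : ∀ c, (∀ l, c l ≤ 0) → P c)
    (hnonneg : ∀ c, (∀ l, 0 ≤ c l) → P c)
    (hstep : ∀ c i j, 0 < c i → c j < 0 → P (Function.update c j (c i + c j)) →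
      P (Function.update c i (c j + c i)) → P c) (c : ι → ℤ) : P c := by
  have key (B : ℕ) : ∀ n : ℕ, ∀ c : ι → ℤ, (∀ l, |c l| ≤ B) →
      (Finset.univ.filter fun l => |c l| = B).card ≤ n → P c := by
    induction B with
    | zero =>
      intro n c hc _
      exact hnonpos c fun l => (le_abs_self _).trans (hc l)
    | succ B ihB =>
      intro n
      induction n with
      | zero =>
        intro c hc hn
        simp only [nonpos_iff_eq_zero, Finset.card_eq_zero, Finset.filter_eq_empty_iff] at hn
        refine ihB _ c (fun l => ?_) le_rfl
        have h1 := hc l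
        have h2 := hn (Finset.mem_univ l)
        push_cast at h1 h2
        omega
      | succ n ihn =>
        have ih' (c : ι → ℤ) (hc : ∀ l, |c l| ≤ (B + 1 : ℕ))
            (hn : (Finset.univ.filter fun l => |c l| = (B + 1 : ℕ)).card < n + 1) : P c :=
          ihn c hc (Nat.le_of_lt_succ hn)
        intro c hc hn
        by_cases hlt : (Finset.univ.filter fun l => |c l| = (B + 1 : ℕ)).card < n + 1
        · exact ih' c hc hlt
        · obtain ⟨i, hi⟩ := Finset.card_pos.1 ((Nat.succ_pos n).trans_le (not_lt.1 hlt))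
          have hB : (0 : ℤ) < (B + 1 : ℕ) := by positivity
          rcases (abs_eq hB.le).1 (Finset.mem_filter.1 hi).2 with hi | hi
          · exact elliott_induction_of_pos hnonneg hstep hB ih' _ c i hc hn hi le_rfl
          · have hneg (c : ι → ℤ) (j : ι) (x : ℤ) :
                -Function.update c j x = Function.update (-c) j (-x) := by
              ext l
              by_cases h : l = j
              · subst h; simp
              · simp [h]
            have := elliott_induction_of_pos (P := fun c => P (-c)) (n := n + 1)
              (fun c h => hnonpos _ fun l => by simpa using h l)
              (fun c i j hi hj h1 h2 => hstep (-c) j i (by simpa using hj) (by simpa using hi)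
                (by simpa only [hneg, neg_add, Pi.neg_apply] using h2)
                (by simpa only [hneg, neg_add, Pi.neg_apply] using h1))
              hB (fun c hc hn => ih' (-c) (by simpa using hc) (by simpa using hn)) _ (-c) i
              (by simpa using hc) (by simpa using hn) (by simp [hi]) le_rfl
            simpa using this
  refine key (∑ l, (c l).natAbs) _ c (fun l => ?_) le_rfl
  rw [Int.abs_eq_natAbs]
  exact_mod_cast Finset.single_le_sum (f := fun l => (c l).natAbs) (fun _ _ => Nat.zero_le _)
    (Finset.mem_univ l)

end Elliott

namespace PerturbedPos

variable {a a' : ℤ} {b b' : ℝ}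

theorem add (h : PerturbedPos a b) (h' : PerturbedPos a' b') :
    PerturbedPos (a + a') (b + b') := by
  rcases h with h | ⟨h, hb⟩ <;> rcases h' with h' | ⟨h', hb'⟩
  · exact Or.inl (by omega)
  · exact Or.inl (by omega)
  · exact Or.inl (by omega)
  · exact Or.inr ⟨by omega, by linarith⟩

theorem not_neg (h : PerturbedPos a b) : ¬PerturbedPos (-a) (-b) := by
  rcases h with h | ⟨h, hb⟩ <;> rintro (h' | ⟨h', hb'⟩)
  · omega
  · omega
  · omega
  · linarith

theorem or_neg (hb : b ≠ 0) : PerturbedPos a b ∨ PerturbedPos (-a) (-b) := by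
  rcases lt_trichotomy a 0 with h | h | h
  · exact Or.inr (Or.inl (by omega))
  · rcases lt_or_gt_of_ne hb with hb | hb
    · exact Or.inl (Or.inr ⟨h, hb⟩)
    · exact Or.inr (Or.inr ⟨by omega, by linarith⟩)
  · exact Or.inl (Or.inl h)

variable {ι : Type*} [Fintype ι] {z : ι → ℤ} {p : ι → ℝ}

theorem sum (h : ∀ l, PerturbedPos (z l) (p l)) {c : ι → ℤ} (hc : ∀ l, 0 ≤ c l) (hc0 : c ≠ 0) :
    PerturbedPos (∑ l, c l * z l) (∑ l, (c l : ℝ) * p l) := by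
  have hz (l) : 0 ≤ z l := by rcases h l with h | h <;> omega
  have hcz (l) : 0 ≤ c l * z l := mul_nonneg (hc l) (hz l)
  rcases (Finset.sum_nonneg fun l _ => hcz l).lt_or_eq with hs | hs
  · exact Or.inl hs
  · refine Or.inr ⟨hs.symm, ?_⟩
    have h0 := (Finset.sum_eq_zero_iff_of_nonneg fun l _ => hcz l).1 hs.symm
    have hneg (l) (hl : 0 < c l) : p l < 0 := by
      rcases h l with h | h
      · have := h0 l (Finset.mem_univ l)
        have := mul_pos hl h
        omega
      · exact h.2
    obtain ⟨l, hl⟩ := Function.ne_iff.1 hc0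
    have hl' : 0 < c l := lt_of_le_of_ne (hc l) (Ne.symm hl)
    refine Finset.sum_neg' (fun i _ => ?_) ⟨l, Finset.mem_univ l, ?_⟩
    · rcases (hc i).lt_or_eq with hi | hi
      · exact (mul_neg_of_pos_of_neg (by exact_mod_cast hi) (hneg i hi)).le
      · simp [← hi]
    · exact mul_neg_of_pos_of_neg (by exact_mod_cast hl') (hneg l hl')

theorem not_sum (h : ∀ l, PerturbedPos (z l) (p l)) {c : ι → ℤ} (hc : ∀ l, c l ≤ 0) :
    ¬PerturbedPos (∑ l, c l * z l) (∑ l, (c l : ℝ) * p l) := by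
  by_cases hc0 : c = 0
  · simp [hc0, PerturbedPos]
  · have := (sum h (c := -c) (fun l => by simpa using hc l) (neg_ne_zero.2 hc0)).not_neg
    simpa using this

end PerturbedPos

section Cone

variable {ι : Type*} [Fintype ι]

/-- The real vector `p` satisfies no nontrivial integral linear relation. -/
def IsGenericVec (p : ι → ℝ) : Prop := ∀ c : ι → ℤ, c ≠ 0 → ∑ l, (c l : ℝ) * p l ≠ 0

/-- The vector `p` lies in the open cone cut out of the open positive orthant by `H`. -/
def InCone (p : ι → ℝ) (H : List (ι → ℤ)) : Prop :=
  (∀ l, 0 < p l) ∧ ∀ h ∈ H, 0 < ∑ l, (h l : ℝ) * p l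

variable [DecidableEq ι]

theorem IsGenericVec.ne_zero {p : ι → ℝ} (hp : IsGenericVec p) (l : ι) : p l ≠ 0 := by
  have := hp (Pi.single l 1) (by simp)
  simpa [Pi.single_apply] using this

theorem IsGenericVec.sub_ne_zero {p : ι → ℝ} (hp : IsGenericVec p) {i j : ι} (hij : i ≠ j) :
    p i - p j ≠ 0 := by
  have := hp (Pi.single i 1 - Pi.single j 1) fun h => by
    have := congrFun h i
    simp [hij] at this
  simpa [Pi.single_apply, sub_mul, Finset.sum_sub_distrib] using this

theorem sum_update_mul_update {R : Type*} [CommRing R] (h z : ι → R) {i j : ι} (hij : i ≠ j) :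
    ∑ l, Function.update h j (h i + h j) l * Function.update z i (z i - z j) l =
      ∑ l, h l * z l := by
  have h1 : Function.update h j (h i + h j) = h + Pi.single j (h i) := by
    ext l
    by_cases hl : l = j
    · subst hl; simp [add_comm]
    · simp [hl]
  have h2 : Function.update z i (z i - z j) = z - Pi.single i (z j) := by
    ext l
    by_cases hl : l = i
    · subst hl; simp
    · simp [hl]
  have : (h + Pi.single j (h i)) ⬝ᵥ (z - Pi.single i (z j)) = h ⬝ᵥ z := by
    simp [hij]
  rw [h1, h2]
  exact this

theorem sum_cast_update_mul_update {R S : Type*} [AddMonoid S] [CommRing R] (φ : S →+ R)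
    (h : ι → S) (z : ι → R) {i j : ι} (hij : i ≠ j) :
    ∑ l, φ (Function.update h j (h i + h j) l) * Function.update z i (z i - z j) l =
      ∑ l, φ (h l) * z l := by
  rw [← sum_update_mul_update (fun l => φ (h l)) z hij]
  refine Finset.sum_congr rfl fun l _ => ?_
  congr 1
  by_cases hl : l = j
  · subst hl; simp
  · simp [hl]

theorem IsGenericVec.update {p : ι → ℝ} (hp : IsGenericVec p) {i j : ι} (hij : i ≠ j) :
    IsGenericVec (Function.update p i (p i - p j)) := by
  intro c hc
  set c' := Function.update c j (c j - c i) with hc'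
  have hcc' : c = Function.update c' j (c' i + c' j) := by simp [hc', hij]
  have := sum_cast_update_mul_update (Int.castAddHom ℝ) c' p hij
  simp only [← hcc', Int.coe_castAddHom] at this
  rw [this]
  refine hp c' fun h => hc ?_
  rw [hcc', h]
  simp

theorem inCone_update_iff {p : ι → ℝ} {H : List (ι → ℤ)} {i j : ι} (hij : i ≠ j) :
    InCone (Function.update p i (p i - p j))
      (H.map fun h => Function.update h j (h i + h j)) ↔ InCone p H ∧ 0 < p i - p j := by
  have hs (h : ι → ℤ) := sum_cast_update_mul_update (Int.castAddHom ℝ) h p hij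
  simp only [Int.coe_castAddHom] at hs
  simp only [InCone, List.forall_mem_map, hs]
  constructor
  · rintro ⟨h1, h2⟩
    have hi := h1 i
    have hj := h1 j
    simp only [Function.update_self, Function.update_of_ne hij.symm] at hi hj
    refine ⟨⟨fun l => ?_, h2⟩, hi⟩
    by_cases hl : l = i
    · subst hl; linarith
    · simpa [hl] using h1 l
  · rintro ⟨⟨h1, h2⟩, h⟩
    refine ⟨fun l => ?_, h2⟩
    by_cases hl : l = i
    · subst hl; simpa using h
    · simpa [hl] using h1 l

theorem ncard_coneSlice_update (p : ι → ℝ) (H : List (ι → ℤ)) (w : ι → ℕ) (t : ℕ) {i j : ι}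
    (hij : i ≠ j) :
    (coneSlice (Function.update p i (p i - p j))
      (H.map fun h => Function.update h j (h i + h j))
      (Function.update w j (w i + w j)) t).ncard =
    {z ∈ coneSlice p H w t | PerturbedPos (z i - z j) (p i - p j)}.ncard := by
  set T : (ι → ℤ) → ι → ℤ := fun z => Function.update z i (z i - z j) with hT
  have hTinj : Function.LeftInverse (fun z : ι → ℤ => Function.update z i (z i + z j)) T := by
    intro z; simp [hT, hij.symm]
  have hTsurj : Function.RightInverse (fun z : ι → ℤ => Function.update z i (z i + z j)) T := by
    intro z; simp [hT, hij.symm]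
  rw [← Set.ncard_preimage_of_injective_subset_range hTinj.injective
    (by simp [hTsurj.surjective.range_eq])]
  congr 1
  ext z
  have hs (h : ι → ℤ) := sum_cast_update_mul_update (Int.castAddHom ℝ) h p hij
  have hz (h : ι → ℤ) := sum_update_mul_update h z hij
  have hwz := sum_cast_update_mul_update (Nat.castAddMonoidHom ℤ) w z hij
  simp only [Int.coe_castAddHom, Nat.coe_castAddMonoidHom] at hs hwz
  simp only [coneSlice, Set.mem_preimage, Set.mem_ofPred_eq, List.forall_mem_map, hT, hs, hz, hwz]
  constructor
  · rintro ⟨h1, h2, h3⟩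
    have hi := h1 i
    have hj := h1 j
    simp only [Function.update_self, Function.update_of_ne hij.symm] at hi hj
    refine ⟨⟨fun l => ?_, h2, h3⟩, hi⟩
    by_cases hl : l = i
    · subst hl; simpa using hi.add hj
    · simpa [hl] using h1 l
  · rintro ⟨⟨h1, h2, h3⟩, h⟩
    refine ⟨fun l => ?_, h2, h3⟩
    by_cases hl : l = i
    · subst hl; simpa using h
    · simpa [hl] using h1 l

/-- The perturbed lattice point count of the dilations of a slice of a rational polyhedral cone is
a quasipolynomial, whose constituent for the residue class of `0` has constant term `0` unless the
direction of the perturbation lies in the cone. -/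
theorem isQuasiPoly_coneSlice {k : ℕ} (hk : Fintype.card ι = k + 1) (n : ℕ) :
    ∀ (H : List (ι → ℤ)), H.length = n → ∀ (p : ι → ℝ) (w : ι → ℕ), (∀ l, 0 < w l) →
      IsGenericVec p → (∃ l, 0 < p l) →
      IsQuasiPoly k (open Classical in if InCone p H then (-1) ^ k else 0)
        (fun t => (coneSlice p H w t).ncard) := by
  classical
  induction n with
  | zero =>
    intro H hH p w hw hp hp'
    obtain rfl := List.length_eq_zero_iff.1 hH
    simpa [InCone] using isQuasiPoly_orthant hk hw hp.ne_zero hp'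
  | succ n ih =>
    suffices ∀ (c : ι → ℤ) (H : List (ι → ℤ)), H.length = n → ∀ (p : ι → ℝ) (w : ι → ℕ),
        (∀ l, 0 < w l) → IsGenericVec p → (∃ l, 0 < p l) →
        IsQuasiPoly k (if InCone p (c :: H) then (-1) ^ k else 0)
          (fun t => (coneSlice p (c :: H) w t).ncard) by
      intro H hH
      obtain ⟨c, H', rfl⟩ := List.exists_cons_of_length_eq_add_one hH
      exact this c H' (by simpa using hH)
    have hzero (c : ι → ℤ) (hc : ∀ l, c l ≤ 0) (H : List (ι → ℤ)) (p : ι → ℝ) (w : ι → ℕ) :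
        IsQuasiPoly k (if InCone p (c :: H) then (-1) ^ k else 0)
          (fun t => (coneSlice p (c :: H) w t).ncard) := by
      refine (IsQuasiPoly.zero k).congr ?_ fun t _ => ?_
      · rw [if_neg]
        rintro ⟨h1, h2⟩
        refine (h2 c (by simp)).not_ge (Finset.sum_nonpos fun l _ => ?_)
        exact mul_nonpos_of_nonpos_of_nonneg (by exact_mod_cast hc l) (h1 l).le
      · rw [Set.eq_empty_of_forall_notMem (s := coneSlice p (c :: H) w t), Set.ncard_empty]
        rintro z ⟨h1, h2, -⟩
        exact PerturbedPos.not_sum h1 hc (h2 c (by simp))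
    intro c
    induction c using elliott_induction with
    | hnonpos c hc => exact fun H _ p w _ _ _ => hzero c hc H p w
    | hnonneg c hc =>
      by_cases hc0 : c = 0
      · exact fun H _ p w _ _ _ => hzero c (by simp [hc0]) H p w
      intro H hH p w hw hp hp'
      refine (ih H hH p w hw hp hp').congr ?_ fun t _ => ?_
      · congr 1
        simp only [InCone, List.forall_mem_cons, eq_iff_iff]
        refine and_congr_right fun h1 => (and_iff_right ?_).symm
        obtain ⟨l, hl⟩ := Function.ne_iff.1 hc0
        refine Finset.sum_pos' (fun i _ => ?_) ⟨l, Finset.mem_univ l, ?_⟩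
        · exact mul_nonneg (by exact_mod_cast hc i) (h1 i).le
        · exact mul_pos (by exact_mod_cast lt_of_le_of_ne (hc l) (Ne.symm hl)) (h1 l)
      · congr 1
        ext z
        simp only [coneSlice, List.forall_mem_cons, Set.mem_ofPred_eq]
        refine and_congr_right fun h1 => ?_
        rw [and_iff_right (PerturbedPos.sum h1 hc hc0)]
    | hstep c i j hi hj ih1 ih2 =>
      intro H hH p w hw hp hp'
      have hij : i ≠ j := by rintro rfl; omega
      have hw' {i j : ι} (l) : 0 < Function.update w j (w i + w j) l := by
        by_cases hl : l = j
        · subst hl; simpa using Or.inr (hw l)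
        · simpa [hl] using hw l
      have hpos {i j : ι} (hij : i ≠ j) : ∃ l, 0 < Function.update p i (p i - p j) l := by
        by_contra! h
        obtain ⟨l, hl⟩ := hp'
        have hi := h i
        have hj := h j
        simp only [Function.update_self, Function.update_of_ne hij.symm] at hi hj
        by_cases hli : l = i
        · subst hli; linarith
        · have := h l
          simp only [Function.update_of_ne hli] at this
          linarith
      have h1 := ih1 (H.map fun h => Function.update h j (h i + h j)) (by simpa using hH) _ _
        (hw' (i := i) (j := j)) (hp.update hij) (hpos hij)
      have h2 := ih2 (H.map fun h => Function.update h i (h j + h i)) (by simpa using hH) _ _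
        (hw' (i := j) (j := i)) (hp.update hij.symm) (hpos hij.symm)
      have hmap {i j : ι} : Function.update c j (c i + c j) ::
          (H.map fun h => Function.update h j (h i + h j)) =
          (c :: H).map fun h => Function.update h j (h i + h j) := rfl
      rw [hmap] at h1 h2
      refine (h1.add h2).congr ?_ fun t _ => ?_
      · simp only [inCone_update_iff hij, inCone_update_iff hij.symm]
        by_cases hC : InCone p (c :: H)
        · rcases lt_or_gt_of_ne (hp.sub_ne_zero hij) with h | h
          · have h' : ¬ p j < p i := by linarith
            have h'' : p i < p j := by linarith
            simp [hC, h', h'']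
          · have h' : p j < p i := by linarith
            have h'' : ¬ p i < p j := by linarith
            simp [hC, h', h'']
        · simp [hC]
      · have hfin := coneSlice_finite p (c :: H) hw t
        simp only [ncard_coneSlice_update _ _ _ _ hij, ncard_coneSlice_update _ _ _ _ hij.symm]
        rw [← Set.ncard_union_eq _ (hfin.subset fun _ h => h.1) (hfin.subset fun _ h => h.1)]
        · congr 1
          ext z
          simp only [Set.mem_union, Set.mem_ofPred_eq, ← and_or_left, and_iff_left_iff_imp]
          intro _
          simpa using PerturbedPos.or_neg (a := z i - z j) (hp.sub_ne_zero hij)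
        · refine Set.disjoint_left.2 fun z h h' => ?_
          exact h.2.not_neg (by simpa using h'.2)

end Cone

section Asymptotics

open Filter Topology

theorem Polynomial.tendsto_eval_div_pow {P : Polynomial ℚ} {k : ℕ} (hP : P.natDegree ≤ k) :
    Tendsto (fun x => P.eval x / x ^ k) atTop (𝓝 (P.coeff k)) := by
  rcases hP.lt_or_eq with h | h
  · rw [Polynomial.coeff_eq_zero_of_natDegree_lt h]
    have := Polynomial.div_tendsto_atTop_zero_of_degree_lt P (Polynomial.X ^ k)
      (by rw [Polynomial.degree_X_pow]; exact Polynomial.degree_lt_iff_coeff_zero _ _ |>.2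
            fun n hn => Polynomial.coeff_eq_zero_of_natDegree_lt (h.trans_le hn))
    simpa using this
  · by_cases hP0 : P = 0
    · simp [hP0]
    have := Polynomial.div_tendsto_atTop_leadingCoeff_div_of_degree_eq P (Polynomial.X ^ k)
      (by rw [Polynomial.degree_X_pow, Polynomial.degree_eq_natDegree hP0, h])
    simpa [Polynomial.leadingCoeff, h] using this

theorem Polynomial.coeff_eq_of_eval_eq {P : Polynomial ℚ} {k s i : ℕ} {c : ℚ} {f : ℕ → ℚ}
    (hP : P.natDegree ≤ k) (hi : i < s)
    (hf : Tendsto (fun t : ℕ => f t / (t : ℚ) ^ k) atTop (𝓝 c))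
    (h : ∀ t : ℕ, 0 < t → t % s = i → f t = P.eval (t : ℚ)) : P.coeff k = c := by
  have hsub : Tendsto (fun n : ℕ => s * (n + 1) + i) atTop atTop := by
    refine tendsto_atTop_mono (fun n => ?_) tendsto_id
    have : n ≤ s * (n + 1) := (Nat.le_succ n).trans (Nat.le_mul_of_pos_left _ (by omega))
    simp only [id]; omega
  refine tendsto_nhds_unique ((Polynomial.tendsto_eval_div_pow hP).comp
    ((tendsto_natCast_atTop_atTop (R := ℚ)).comp hsub)) ((hf.comp hsub).congr fun n => ?_)
  have : 0 < s * (n + 1) := Nat.mul_pos (by omega) n.succ_pos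
  simp only [Function.comp]
  rw [h _ (by omega) (by rw [Nat.mul_add_mod, Nat.mod_eq_of_lt hi])]

theorem tendsto_div_pow_of_choose_bound {k : ℕ} {K : ℚ} {f g : ℕ → ℕ}
    (hle : ∀ t, 0 < t → f t ≤ (t - 1).choose k)
    (hge : ∀ t, 0 < t → (t - 1).choose k ≤ f t + g t)
    (hg : ∀ t : ℕ, 0 < t → (g t : ℚ) * t ≤ K * ((t : ℚ) + 1) ^ k) :
    Tendsto (fun t : ℕ => (f t : ℚ) / (t : ℚ) ^ k) atTop (𝓝 (1 / (k.factorial : ℚ))) := by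
  have hinv : Tendsto (fun t : ℕ => (t : ℚ)⁻¹) atTop (𝓝 0) :=
    tendsto_inv_atTop_zero.comp tendsto_natCast_atTop_atTop
  have hlow : Tendsto (fun t : ℕ => (1 - k * (t : ℚ)⁻¹) ^ k / (k.factorial : ℚ) -
      K * (1 + (t : ℚ)⁻¹) ^ k * (t : ℚ)⁻¹) atTop (𝓝 (1 / (k.factorial : ℚ))) := by
    have := ((((hinv.const_mul (k : ℚ)).const_sub 1).pow k).div_const (k.factorial : ℚ)).sub
      ((((hinv.const_add 1).pow k).const_mul K).mul hinv)
    simpa using this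
  have hk : (0 : ℚ) < k.factorial := by exact_mod_cast k.factorial_pos
  refine tendsto_of_tendsto_of_tendsto_of_le_of_le' hlow tendsto_const_nhds ?_ ?_
  · filter_upwards [eventually_gt_atTop k] with t ht
    have ht0 : (0 : ℚ) < t := by exact_mod_cast (by omega : 0 < t)
    have h1 := Nat.pow_sub_le_descFactorial (t - 1) k
    rw [Nat.descFactorial_eq_factorial_mul_choose, Nat.sub_add_cancel (by omega)] at h1
    have h2 : ((t : ℚ) - k) ^ k ≤ k.factorial * ((t - 1).choose k : ℕ) := by
      rw [← Nat.cast_sub ht.le]; exact_mod_cast h1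
    have h3 : (((t - 1).choose k : ℕ) : ℚ) ≤ f t + g t := by exact_mod_cast hge t (by omega)
    have h4 := hg t (by omega)
    have e1 : (1 - k * (t : ℚ)⁻¹) = (t - k) / t := by field_simp
    have e2 : (1 + (t : ℚ)⁻¹) = (t + 1) / t := by field_simp
    rw [e1, e2, div_pow, div_pow, sub_le_iff_le_add]
    calc ((t : ℚ) - k) ^ k / (t : ℚ) ^ k / k.factorial
        ≤ (k.factorial * ((t - 1).choose k : ℕ)) / (t : ℚ) ^ k / k.factorial := by gcongr
      _ = ((t - 1).choose k : ℕ) / (t : ℚ) ^ k := by field_simp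
      _ ≤ (f t + g t) / (t : ℚ) ^ k := by gcongr
      _ = f t / (t : ℚ) ^ k + (g t * t) / (t : ℚ) ^ k * (t : ℚ)⁻¹ := by field_simp
      _ ≤ f t / (t : ℚ) ^ k + (K * ((t : ℚ) + 1) ^ k) / (t : ℚ) ^ k * (t : ℚ)⁻¹ := by gcongr
      _ = _ := by ring
  · filter_upwards [eventually_gt_atTop 0] with t ht
    have ht0 : (0 : ℚ) < t := by exact_mod_cast ht
    have h1 := Nat.descFactorial_le_pow (t - 1) k
    rw [Nat.descFactorial_eq_factorial_mul_choose] at h1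
    have h2 : k.factorial * f t ≤ t ^ k :=
      (Nat.mul_le_mul_left _ (hle t ht)).trans (h1.trans (Nat.pow_le_pow_left (by omega) k))
    rw [div_le_div_iff₀ (by positivity) hk, one_mul, mul_comm]
    exact_mod_cast h2

end Asymptotics

section Counting

variable {ι : Type*} [Fintype ι]

theorem ncard_pos_sum_eq {k : ℕ} (hk : Fintype.card ι = k + 1) {t : ℕ} (ht : 0 < t) :
    {z : ι → ℤ | (∀ l, 0 < z l) ∧ ∑ l, z l = t}.ncard = (t - 1).choose k := by
  have himage : {z : ι → ℤ | (∀ l, 0 < z l) ∧ ∑ l, z l = t} =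
      (fun (a : ι → ℕ) l => (a l + 1 : ℤ)) '' {a | (k + 1) + 1 * ∑ l, a l = t} := by
    ext z
    simp only [Set.mem_ofPred_eq, Set.mem_image]
    constructor
    · rintro ⟨hz, hs⟩
      have hz' (l) : ((z l - 1).toNat : ℤ) = z l - 1 := by have := hz l; omega
      refine ⟨fun l => (z l - 1).toNat, ?_, funext fun l => by rw [hz']; ring⟩
      zify
      simp only [hz', Finset.sum_sub_distrib, hs]
      simp [hk]
    · rintro ⟨a, ha, rfl⟩
      refine ⟨fun l => by positivity, ?_⟩
      rw [← ha]
      simp [Finset.sum_add_distrib, hk, add_comm]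
  rw [himage, Set.ncard_image_of_injective _ fun a b h => funext fun l => by
    simpa using congrFun h l, ncard_sum_eq k (k + 1) 1 t hk one_pos]
  split_ifs with h
  · congr 1; omega
  · rw [Nat.choose_eq_zero_of_lt]
    simp only [one_dvd, and_true] at h
    omega

theorem ncard_hyperplane_le {k : ℕ} (hk : Fintype.card ι = k + 1) (d : ι → ℤ) {r r' : ι}
    (hd : d r ≠ d r') (t : ℕ) :
    {z : ι → ℤ | ((∀ l, 0 < z l) ∧ ∑ l, z l = t) ∧ ∑ l, d l * z l = 0}.ncard * t ≤
      (t + 1) ^ k := by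
  classical
  have hr : r ≠ r' := fun h => hd (by rw [h])
  have hle : {z : ι → ℤ | ((∀ l, 0 < z l) ∧ ∑ l, z l = t) ∧ ∑ l, d l * z l = 0}.ncard ≤
      (t + 1) ^ (k - 1) := by
    have hcard : Fintype.card {l // l ∉ ({r, r'} : Finset ι)} = k - 1 := by
      rw [Fintype.card_subtype_compl, hk, Fintype.card_coe, Finset.card_pair hr]
      omega
    have htarget : (Fintype.piFinset fun _ : {l // l ∉ ({r, r'} : Finset ι)} =>
        Finset.Icc (0 : ℤ) t).card = (t + 1) ^ (k - 1) := by
      rw [Fintype.card_piFinset, Finset.prod_const, Finset.card_univ, hcard]; simp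
    rw [← htarget, ← Set.ncard_coe_finset]
    refine Set.ncard_le_ncard_of_injOn (fun z l => z l) ?_ ?_ (Finset.finite_toSet _)
    · rintro z ⟨⟨hz, hs⟩, -⟩
      simp only [Finset.mem_coe, Fintype.mem_piFinset, Finset.mem_Icc]
      refine fun l => ⟨(hz l).le, ?_⟩
      rw [← hs]
      exact Finset.single_le_sum (fun i _ => (hz i).le) (Finset.mem_univ (l : ι))
    · rintro z ⟨⟨-, hs⟩, h0⟩ z' ⟨⟨-, hs'⟩, h0'⟩ h
      have hoff (l) (hl : l ∉ ({r, r'} : Finset ι)) : z l - z' l = 0 := by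
        rw [sub_eq_zero]; exact congrFun h ⟨l, hl⟩
      have hsplit (c : ι → ℤ) : ∑ l, c l * (z l - z' l) =
          c r * (z r - z' r) + c r' * (z r' - z' r') := by
        rw [← Finset.sum_subset (Finset.subset_univ {r, r'}) fun l _ hl => by rw [hoff l hl, mul_zero],
          Finset.sum_pair hr]
      have h1 : (z r - z' r) + (z r' - z' r') = 0 := by
        have := hsplit 1
        simp only [Pi.one_apply, one_mul, Finset.sum_sub_distrib, hs, hs', sub_self] at this
        exact this.symm
      have h2 : d r * (z r - z' r) + d r' * (z r' - z' r') = 0 := by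
        rw [← hsplit]
        simp only [mul_sub, Finset.sum_sub_distrib, h0, h0', sub_self]
      have h3 : (d r - d r') * (z r - z' r) = 0 := by linear_combination h2 - d r' * h1
      have h4 : z r - z' r = 0 := (mul_eq_zero.1 h3).resolve_left (sub_ne_zero.2 hd)
      ext l
      by_cases hl : l ∈ ({r, r'} : Finset ι)
      · rcases Finset.mem_insert.1 hl with rfl | hl
        · omega
        · rw [Finset.mem_singleton.1 hl]; omega
      · have := hoff l hl; omega
  have hk1 : 1 ≤ k := by
    have := Fintype.one_lt_card_iff.2 ⟨r, r', hr⟩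
    omega
  calc _ ≤ (t + 1) ^ (k - 1) * (t + 1) := Nat.mul_le_mul hle (Nat.le_succ t)
    _ = (t + 1) ^ k := by rw [← pow_succ, Nat.sub_add_cancel hk1]

theorem dense_isGenericVec : Dense {p : ι → ℝ | IsGenericVec p} := by
  classical
  refine MeasureTheory.Measure.dense_of_ae (μ := MeasureTheory.volume) ?_
  simp only [IsGenericVec, MeasureTheory.ae_all_iff]
  intro c
  by_cases hc : c = 0
  · simp [hc]
  set φ : (ι → ℝ) →ₗ[ℝ] ℝ := ∑ l, (c l : ℝ) • LinearMap.proj l with hφ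
  have hφa (p) : φ p = ∑ l, (c l : ℝ) * p l := by simp [hφ]
  have hne : LinearMap.ker φ ≠ ⊤ := by
    obtain ⟨l, hl⟩ := Function.ne_iff.1 hc
    intro h
    have : Pi.single l 1 ∈ LinearMap.ker φ := h ▸ Submodule.mem_top
    rw [LinearMap.mem_ker, hφa] at this
    simp [Pi.single_apply] at this
    exact hl this
  have := MeasureTheory.Measure.addHaar_submodule MeasureTheory.volume _ hne
  have hae : ∀ᵐ p : ι → ℝ, φ p ≠ 0 := by
    rw [MeasureTheory.ae_iff]
    convert this using 2
    ext p
    simp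
  simpa [hc, hφa] using hae

end Counting

section Rulers

variable {m : ℕ}

/-- The markings of the ruler with successive differences `z`. -/
def rulerOf {R : Type*} [AddCommMonoid R] (z : Fin m → R) (j : Fin (m + 1)) : R :=
  ∑ l : Fin m, if l.castSucc < j then z l else 0

section

variable {R : Type*} [AddCommGroup R]

theorem rulerOf_zero (z : Fin m → R) : rulerOf z 0 = 0 := by simp [rulerOf]

theorem rulerOf_last (z : Fin m → R) : rulerOf z (Fin.last m) = ∑ l, z l := by
  simp [rulerOf, Fin.castSucc_lt_last]

theorem rulerOf_succ (z : Fin m → R) (r : Fin m) :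
    rulerOf z r.succ = rulerOf z r.castSucc + z r := by
  have : z r = ∑ l, if l = r then z l else 0 := by simp
  rw [this, rulerOf, rulerOf, ← Finset.sum_add_distrib]
  refine Finset.sum_congr rfl fun l _ => ?_
  rcases lt_trichotomy l r with h | rfl | h
  · simp [h, h.ne, h.le, Fin.castSucc_lt_succ_iff]
  · simp
  · simp [h.ne', h.not_ge, h.le.not_gt, Fin.castSucc_lt_succ_iff]

theorem rulerOf_succ_sub {y : Fin (m + 1) → R} (hy : y 0 = 0) :
    rulerOf (fun r : Fin m => y r.succ - y r.castSucc) = y := by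
  ext j
  induction j using Fin.induction with
  | zero => rw [rulerOf_zero, hy]
  | succ r ih => rw [rulerOf_succ, ih]; abel

theorem rulerOf_injective : Function.Injective (rulerOf : (Fin m → R) → _) := by
  intro z z' h
  ext r
  have h1 := congrFun h r.succ
  rw [rulerOf_succ, rulerOf_succ, congrFun h r.castSucc] at h1
  exact add_left_cancel h1

theorem strictMono_rulerOf [LinearOrder R] [IsOrderedAddMonoid R] {z : Fin m → R} :
    StrictMono (rulerOf z) ↔ ∀ l, 0 < z l := by
  simp [Fin.strictMono_iff_lt_succ, rulerOf_succ]

end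

/-- The form comparing the distances `[i, j]` and `[k, l]` on a ruler in terms of its successive
differences. -/
def diffForm (q : Fin (m + 1) × Fin (m + 1) × Fin (m + 1) × Fin (m + 1)) (r : Fin m) : ℤ :=
  ((if r.castSucc < q.2.2.2 then 1 else 0) - (if r.castSucc < q.2.2.1 then 1 else 0)) -
    ((if r.castSucc < q.2.1 then 1 else 0) - (if r.castSucc < q.1 then 1 else 0))

theorem sum_diffForm_mul {R : Type*} [CommRing R] (z : Fin m → R) (i j k l : Fin (m + 1)) :
    ∑ r, (diffForm (i, j, k, l) r : R) * z r =
      (rulerOf z l - rulerOf z k) - (rulerOf z j - rulerOf z i) := by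
  simp only [diffForm, rulerOf, ← Finset.sum_sub_distrib]
  refine Finset.sum_congr rfl fun r _ => ?_
  push_cast
  simp only [sub_mul, ite_mul, one_mul, zero_mul]

theorem exists_diffForm_ne {i j k l : Fin (m + 1)} (hij : i < j) (hkl : k < l)
    (hne : ¬(i = k ∧ j = l)) : ∃ r r', diffForm (i, j, k, l) r ≠ diffForm (i, j, k, l) r' := by
  have hlt {a b : Fin (m + 1)} (h : a < b) : ∃ r : Fin m, r.castSucc = a :=
    ⟨a.castLT (by omega), by simp⟩
  obtain ⟨ri, rfl⟩ := hlt hij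
  obtain ⟨rk, rfl⟩ := hlt hkl
  rcases lt_trichotomy ri rk with h | rfl | h
  · refine ⟨ri, rk, ?_⟩
    have h1 : ri.castSucc < l := by simp only [Fin.lt_def, Fin.val_castSucc] at *; omega
    have h2 : ¬ rk < ri := h.le.not_gt
    simp only [diffForm, hij, hkl, h1, Fin.castSucc_lt_castSucc_iff, h, h2, lt_irrefl, if_true,
      if_false]
    split_ifs <;> omega
  · rcases lt_trichotomy j l with h | rfl | h
    · obtain ⟨rj, rfl⟩ := hlt h
      refine ⟨rj, ri, ?_⟩
      simp [diffForm, hij, hkl, h]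
    · exact absurd ⟨rfl, rfl⟩ hne
    · obtain ⟨rl, rfl⟩ := hlt h
      refine ⟨rl, ri, ?_⟩
      have h1 : ¬ rl < ri := (Fin.castSucc_lt_castSucc_iff.1 hkl).not_gt
      simp [diffForm, hij, hkl, h, h1]
  · refine ⟨ri, rk, ?_⟩
    have h1 : rk.castSucc < j := by simp only [Fin.lt_def, Fin.val_castSucc] at *; omega
    have h2 : ¬ ri < rk := h.le.not_gt
    simp only [diffForm, hij, hkl, h1, Fin.castSucc_lt_castSucc_iff, h, h2, lt_irrefl, if_true,
      if_false]
    split_ifs <;> omega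

/-- The distances between markings are ordered in the same way on two rulers. -/
def SameOrder (y y' : Fin (m + 1) → ℝ) : Prop :=
  ∀ i j k l : Fin (m + 1), i < j → k < l → (y j - y i < y l - y k ↔ y' j - y' i < y' l - y' k)

theorem SameOrder.symm {y y' : Fin (m + 1) → ℝ} (h : SameOrder y y') : SameOrder y' y :=
  fun i j k l hij hkl => (h i j k l hij hkl).symm

theorem SameOrder.trans {y y' y'' : Fin (m + 1) → ℝ} (h : SameOrder y y')
    (h' : SameOrder y' y'') : SameOrder y y'' :=
  fun i j k l hij hkl => (h i j k l hij hkl).trans (h' i j k l hij hkl)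

theorem IsRealGolomb.of_imp {y y' : Fin (m + 1) → ℝ} (hy' : IsRealGolomb m y')
    (h : ∀ i j k l : Fin (m + 1), i < j → k < l → y' j - y' i < y' l - y' k →
      y j - y i < y l - y k) : IsRealGolomb m y ∧ SameOrder y y' := by
  refine ⟨fun i j k l hij hkl he => ?_, fun i j k l hij hkl => ⟨fun hlt => ?_, h i j k l hij hkl⟩⟩
  · rcases lt_trichotomy (y' j - y' i) (y' l - y' k) with h' | h' | h'
    · exact absurd he (h _ _ _ _ hij hkl h').ne
    · exact hy' _ _ _ _ hij hkl h'
    · exact absurd he (h _ _ _ _ hkl hij h').ne'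
  · rcases lt_trichotomy (y' j - y' i) (y' l - y' k) with h' | h' | h'
    · exact h'
    · obtain ⟨rfl, rfl⟩ := hy' _ _ _ _ hij hkl h'
      exact absurd hlt (lt_irrefl _)
    · exact absurd hlt (h _ _ _ _ hkl hij h').not_gt

theorem sum_Icc_succDiff (y : Fin (m + 1) → ℝ) {i j : ℕ} (hij : i ≤ j) (hj : j ≤ m) :
    ∑ r ∈ Finset.Icc (i + 1) j, succDiff m y r = y ⟨j, by omega⟩ - y ⟨i, by omega⟩ := by
  induction j, hij using Nat.le_induction with
  | base => simp
  | succ j hij ih =>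
    rw [Finset.sum_Icc_succ_top (by omega), ih (by omega), succDiff, dif_pos ⟨by omega, hj⟩]
    simp

theorem combEquivGolomb_iff {y y' : Fin (m + 1) → ℝ} :
    CombEquivGolomb m y y' ↔ SameOrder y y' := by
  constructor
  · intro h i j k l hij hkl
    have hcon {a b : Fin (m + 1)} (hab : a < b) : IsConsec m (Finset.Icc (a + 1 : ℕ) b) :=
      ⟨a + 1, b, by omega, by omega, by omega, rfl⟩
    have := h _ _ (hcon hij) (hcon hkl)
    rwa [sum_Icc_succDiff y (by omega) (by omega), sum_Icc_succDiff y (by omega) (by omega),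
      sum_Icc_succDiff y' (by omega) (by omega), sum_Icc_succDiff y' (by omega) (by omega)] at this
  · rintro h _ _ ⟨i, j, hi, hij, hj, rfl⟩ ⟨k, l, hk, hkl, hl, rfl⟩
    obtain ⟨i, rfl⟩ := Nat.exists_eq_succ_of_ne_zero (by omega : i ≠ 0)
    obtain ⟨k, rfl⟩ := Nat.exists_eq_succ_of_ne_zero (by omega : k ≠ 0)
    simp only [Nat.succ_eq_add_one] at *
    rw [sum_Icc_succDiff y (by omega) hj, sum_Icc_succDiff y (by omega) hl,
      sum_Icc_succDiff y' (by omega) hj, sum_Icc_succDiff y' (by omega) hl]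
    exact h _ _ _ _ (Fin.mk_lt_mk.2 (by omega)) (Fin.mk_lt_mk.2 (by omega))

/-- The successive differences of the Golomb rulers of length `t`. -/
def golombDiffs (m : ℕ) (t : ℤ) : Set (Fin m → ℤ) :=
  {z | ((∀ l, 0 < z l) ∧ ∑ l, z l = t) ∧ IsGolomb m (rulerOf z)}

theorem golombCount_eq_ncard (m : ℕ) (t : ℤ) : golombCount m t = (golombDiffs m t).ncard := by
  have : {x | IsRuler m t x ∧ IsGolomb m x} = rulerOf '' golombDiffs m t := by
    ext x
    constructor
    · rintro ⟨⟨h1, h2, h3⟩, hg⟩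
      have hx := rulerOf_succ_sub h2
      exact ⟨_, ⟨⟨strictMono_rulerOf.1 (by rwa [hx]), by rw [← rulerOf_last, hx, h3]⟩,
        by rwa [hx]⟩, hx⟩
    · rintro ⟨z, ⟨⟨h1, h2⟩, hg⟩, rfl⟩
      exact ⟨⟨strictMono_rulerOf.2 h1, rulerOf_zero z, by rw [rulerOf_last, h2]⟩, hg⟩
  rw [← Set.ncard_image_of_injective _ rulerOf_injective, ← this]
  rfl

theorem ncard_not_golomb_le {k : ℕ} (hk : m = k + 1) (t : ℕ) :
    ({z : Fin m → ℤ | (∀ l, 0 < z l) ∧ ∑ l, z l = t} \ golombDiffs m t).ncard * t ≤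
      (m + 1) ^ 4 * (t + 1) ^ k := by
  classical
  set F : Fin (m + 1) × Fin (m + 1) × Fin (m + 1) × Fin (m + 1) → Set (Fin m → ℤ) := fun q =>
    {z | (((∀ l, 0 < z l) ∧ ∑ l, z l = t) ∧ ∑ r, diffForm q r * z r = 0) ∧
      ∃ r r', diffForm q r ≠ diffForm q r'} with hF
  have hsub : {z : Fin m → ℤ | (∀ l, 0 < z l) ∧ ∑ l, z l = t} \ golombDiffs m t ⊆ ⋃ q, F q := by
    rintro z ⟨hz, hg⟩
    have hg' : ¬IsGolomb m (rulerOf z) := fun h => hg ⟨hz, h⟩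
    simp only [IsGolomb] at hg'
    push Not at hg'
    obtain ⟨i, j, k, l, hij, hkl, he, hne⟩ := hg'
    refine Set.mem_iUnion.2 ⟨(i, j, k, l), ⟨hz, ?_⟩, exists_diffForm_ne hij hkl fun h => hne h.1 h.2⟩
    have := sum_diffForm_mul z i j k l
    simp only [Int.cast_id] at this
    rw [this, he, sub_self]
  have hfin : (⋃ q, F q).Finite := by
    refine (coneSlice_finite (fun _ => 1) [] (w := fun _ => 1) (fun _ => one_pos) t).subset ?_
    refine Set.iUnion_subset fun q z hz => ⟨fun l => Or.inl (hz.1.1.1 l), by simp, ?_⟩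
    simpa using hz.1.1.2
  have hF1 (q) : (F q).ncard * t ≤ (t + 1) ^ k := by
    by_cases hq : ∃ r r', diffForm q r ≠ diffForm q r'
    · obtain ⟨r, r', hr⟩ := id hq
      simpa only [hF, hq, and_true] using ncard_hyperplane_le (by simp [hk]) (diffForm q) hr t
    · simp [hF, hq]
  calc _ ≤ (∑ q, (F q).ncard) * t := Nat.mul_le_mul_right _
        ((Set.ncard_le_ncard hsub hfin).trans (Set.ncard_iUnion_le_of_fintype F))
    _ ≤ ∑ _q : Fin (m + 1) × Fin (m + 1) × Fin (m + 1) × Fin (m + 1), (t + 1) ^ k := by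
        rw [Finset.sum_mul]; exact Finset.sum_le_sum fun q _ => hF1 q
    _ = (m + 1) ^ 4 * (t + 1) ^ k := by simp; ring

theorem tendsto_golombCount_div_pow (k : ℕ) :
    Filter.Tendsto (fun t : ℕ => (golombCount (k + 1) t : ℚ) / (t : ℚ) ^ k) Filter.atTop
      (nhds (1 / (k.factorial : ℚ))) := by
  have hfin (t : ℕ) (ht : 0 < t) :
      {z : Fin (k + 1) → ℤ | (∀ l, 0 < z l) ∧ ∑ l, z l = t}.Finite := by
    refine (coneSlice_finite (fun _ => 1) [] (w := fun _ => 1) (fun _ => one_pos) t).subset ?_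
    exact fun z hz => ⟨fun l => Or.inl (hz.1 l), by simp, by simpa using hz.2⟩
  have hsub (t : ℕ) : golombDiffs (k + 1) t ⊆
      {z : Fin (k + 1) → ℤ | (∀ l, 0 < z l) ∧ ∑ l, z l = t} := fun z hz => hz.1
  refine tendsto_div_pow_of_choose_bound (K := ((k + 1 + 1) ^ 4 : ℕ))
    (g := fun t => ({z : Fin (k + 1) → ℤ | (∀ l, 0 < z l) ∧ ∑ l, z l = t} \
      golombDiffs (k + 1) t).ncard) (fun t ht => ?_) (fun t ht => ?_) fun t ht => ?_
  · rw [← ncard_pos_sum_eq (Fintype.card_fin (k + 1)) ht, golombCount_eq_ncard]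
    exact Set.ncard_le_ncard (hsub t) (hfin t ht)
  · rw [← ncard_pos_sum_eq (Fintype.card_fin (k + 1)) ht, golombCount_eq_ncard,
      add_comm (Set.ncard _), Set.ncard_sdiff_add_ncard_of_subset (hsub t) (hfin t ht)]
  · exact_mod_cast ncard_not_golomb_le rfl t

instance finite_quotient_golombSetoid (m : ℕ) : Finite (Quotient (golombSetoid m)) := by
  let f : Quotient (golombSetoid m) →
      (Fin (m + 1) × Fin (m + 1) × Fin (m + 1) × Fin (m + 1) → Prop) :=
    Quotient.lift (fun y q => (q.1 < q.2.1 ∧ q.2.2.1 < q.2.2.2) ∧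
      y.1 q.2.1 - y.1 q.1 < y.1 q.2.2.2 - y.1 q.2.2.1) fun y y' h => by
        ext q
        exact and_congr_right fun hq => combEquivGolomb_iff.1 h _ _ _ _ hq.1 hq.2
  refine Finite.of_injective f fun c c' => ?_
  induction c using Quotient.ind
  induction c' using Quotient.ind
  intro h
  refine Quotient.sound (combEquivGolomb_iff.2 fun i j k l hij hkl => ?_)
  simpa [f, hij, hkl] using congrFun h (i, j, k, l)

theorem exists_isGenericVec_sameOrder {y : Fin (m + 1) → ℝ} (hmono : StrictMono y) (h0 : y 0 = 0)
    (hy : IsRealGolomb m y) : ∃ p : Fin m → ℝ, IsGenericVec p ∧ (∀ l, 0 < p l) ∧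
      IsRealGolomb m (rulerOf p) ∧ SameOrder (rulerOf p) y := by
  have hcont (j : Fin (m + 1)) : Continuous fun p : Fin m → ℝ => rulerOf p j := by
    unfold rulerOf
    refine continuous_finsetSum _ fun l _ => ?_
    split_ifs <;> fun_prop
  have hopen : IsOpen {p : Fin m → ℝ | (∀ l, 0 < p l) ∧ ∀ i j k l : Fin (m + 1),
      y j - y i < y l - y k → rulerOf p j - rulerOf p i < rulerOf p l - rulerOf p k} := by
    refine isOpen_iff_mem_nhds.2 fun p ⟨hp1, hp2⟩ => Filter.Eventually.and
      (Filter.eventually_all.2 fun l => ?_) ?_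
    · exact (continuous_apply l).continuousAt.eventually (lt_mem_nhds (hp1 l))
    · simp only [Filter.eventually_all]
      exact fun i j k l h => ((hcont j).sub (hcont i)).continuousAt.eventually_lt
        ((hcont l).sub (hcont k)).continuousAt (hp2 i j k l h)
  have hz := rulerOf_succ_sub h0
  obtain ⟨p, ⟨hp1, hp2⟩, hp⟩ := dense_isGenericVec.inter_open_nonempty _ hopen
    ⟨_, strictMono_rulerOf.1 (by rwa [hz]), fun i j k l h => by rwa [hz]⟩
  exact ⟨p, hp, hp1, hy.of_imp fun i j k l _ _ h => hp2 i j k l h⟩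

/-- The forms that are positive on the successive differences `p`. -/
noncomputable def posForms (p : Fin m → ℝ) : List (Fin m → ℤ) :=
  open Classical in
  ((Finset.univ.filter fun q : Fin (m + 1) × Fin (m + 1) × Fin (m + 1) × Fin (m + 1) =>
    (q.1 < q.2.1 ∧ q.2.2.1 < q.2.2.2) ∧ 0 < ∑ r, (diffForm q r : ℝ) * p r).toList).map diffForm

theorem forall_mem_posForms {p : Fin m → ℝ} {Q : (Fin m → ℤ) → Prop} :
    (∀ h ∈ posForms p, Q h) ↔ ∀ i j k l : Fin (m + 1), i < j → k < l →
      rulerOf p j - rulerOf p i < rulerOf p l - rulerOf p k → Q (diffForm (i, j, k, l)) := by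
  simp only [posForms, List.forall_mem_map, Finset.mem_toList, Finset.mem_filter, Finset.mem_univ,
    true_and, Prod.forall, sum_diffForm_mul, sub_pos, and_imp]

theorem inCone_posForms {p : Fin m → ℝ} (hp : ∀ l, 0 < p l) : InCone p (posForms p) :=
  ⟨hp, forall_mem_posForms.2 fun i j k l _ _ h => by rwa [sum_diffForm_mul, sub_pos]⟩

theorem mem_coneSlice_posForms {p : Fin m → ℝ} (hp : ∀ l, 0 < p l)
    (hg : IsRealGolomb m (rulerOf p)) {t : ℕ} {z : Fin m → ℤ} :
    z ∈ coneSlice p (posForms p) (fun _ => 1) t ↔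
      z ∈ golombDiffs m t ∧ SameOrder (fun j => ((rulerOf z j : ℤ) : ℝ)) (rulerOf p) := by
  have hpos {a : ℤ} {b : ℝ} (hb : 0 < b) : PerturbedPos a b ↔ 0 < a := by
    simp [PerturbedPos, hb.le.not_gt]
  have hforms : (∀ h ∈ posForms p, PerturbedPos (∑ l, h l * z l) (∑ l, (h l : ℝ) * p l)) ↔
      ∀ i j k l : Fin (m + 1), i < j → k < l →
        rulerOf p j - rulerOf p i < rulerOf p l - rulerOf p k →
        ((rulerOf z j : ℤ) : ℝ) - (rulerOf z i : ℤ) < (rulerOf z l : ℤ) - (rulerOf z k : ℤ) := by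
    rw [forall_mem_posForms]
    refine forall₄_congr fun i j k l => forall₃_congr fun hij hkl h => ?_
    rw [hpos (by rwa [sum_diffForm_mul, sub_pos])]
    have := sum_diffForm_mul z i j k l
    simp only [Int.cast_id] at this
    rw [this, sub_pos]
    exact_mod_cast Iff.rfl
  have hgol : IsGolomb m (rulerOf z) ↔ IsRealGolomb m (fun j => ((rulerOf z j : ℤ) : ℝ)) := by
    refine forall₄_congr fun i j k l => forall₂_congr fun _ _ => ?_
    dsimp only
    norm_cast
  simp only [coneSlice, golombDiffs, Set.mem_ofPred_eq, hforms, hpos (hp _), Nat.cast_one, one_mul,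
    hgol]
  constructor
  · rintro ⟨h1, h2, h3⟩
    have := hg.of_imp h2
    exact ⟨⟨⟨h1, h3⟩, this.1⟩, this.2⟩
  · rintro ⟨⟨⟨h1, h3⟩, -⟩, h⟩
    exact ⟨h1, fun i j k l hij hkl => (h i j k l hij hkl).2, h3⟩

theorem isQuasiPoly_golombCount (k : ℕ) :
    IsQuasiPoly k (Nat.card (Quotient (golombSetoid (k + 1))) * (-1) ^ k)
      (fun t => golombCount (k + 1) t) := by
  classical
  have := Fintype.ofFinite (Quotient (golombSetoid (k + 1)))
  have hex (c : Quotient (golombSetoid (k + 1))) :=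
    exists_isGenericVec_sameOrder c.out.2.1.1 c.out.2.1.2.1 c.out.2.2
  choose p hgen hpos hgol hord using hex
  have hunion (t : ℕ) (ht : 0 < t) : golombDiffs (k + 1) t =
      ⋃ c, coneSlice (p c) (posForms (p c)) (fun _ => 1) t := by
    ext z
    simp only [Set.mem_iUnion, mem_coneSlice_posForms (hpos _) (hgol _)]
    refine ⟨fun hz => ?_, fun ⟨c, hz, _⟩ => hz⟩
    have ht' : (0 : ℝ) < t := by exact_mod_cast ht
    have hdiv (a b : ℤ) : (a : ℝ) / t - (b : ℝ) / t = ((a - b : ℤ) : ℝ) / t := by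
      push_cast; ring
    have hz' : IsRealRuler (k + 1) 1 (fun j => ((rulerOf z j : ℤ) : ℝ) / t) ∧
        IsRealGolomb (k + 1) (fun j => ((rulerOf z j : ℤ) : ℝ) / t) := by
      obtain ⟨⟨h1, h2⟩, h3⟩ := hz
      refine ⟨⟨fun i j hij => ?_, by simp [rulerOf_zero], ?_⟩, fun i j a b hij hab he => ?_⟩
      · have := strictMono_rulerOf.2 h1 hij
        dsimp only
        gcongr
      · dsimp only
        rw [rulerOf_last, h2]
        simp [ht'.ne']
      · simp only [hdiv] at he
        refine h3 i j a b hij hab ?_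
        rw [div_left_inj' ht'.ne'] at he
        exact_mod_cast he
    refine ⟨Quotient.mk _ ⟨_, hz'⟩, hz, SameOrder.trans (fun i j a b _ _ => ?_)
      ((combEquivGolomb_iff.1 (Quotient.mk_out (s := golombSetoid (k + 1)) ⟨_, hz'⟩)).symm.trans
        (hord _).symm)⟩
    dsimp only
    rw [hdiv, hdiv, div_lt_div_iff_of_pos_right ht']
    norm_cast
  have hdisj (t : ℕ) : Pairwise (Function.onFun Disjoint
      fun c => coneSlice (p c) (posForms (p c)) (fun _ => 1) t) := by
    refine fun c c' hc => Set.disjoint_left.2 fun z h h' => hc ?_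
    rw [mem_coneSlice_posForms (hpos _) (hgol _)] at h h'
    exact Quotient.out_equiv_out.1
      (combEquivGolomb_iff.2 ((hord c).symm.trans (h.2.symm.trans (h'.2.trans (hord c')))))
  refine (IsQuasiPoly.sum Finset.univ _ _ fun c _ => isQuasiPoly_coneSlice
    (Fintype.card_fin (k + 1)) _ (posForms (p c)) rfl (p c) (fun _ => 1) (fun _ => one_pos)
    (hgen c) ⟨0, hpos c 0⟩).congr ?_ fun t ht => ?_
  · simp [inCone_posForms (hpos _)]
  · rw [golombCount_eq_ncard, hunion t ht, Set.ncard_iUnion_of_finite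
      (fun c => coneSlice_finite _ _ (fun _ => one_pos) t) (hdisj t), finsum_eq_sum_of_fintype]

end Rulers

/-- The Golomb counting function `b_m` is a quasipolynomial of degree `m-1` with leading
coefficient `1/(m-1)!`; moreover, for any representation `p_0, …, p_{s-1}` of this
quasipolynomial, `(-1)^{m-1} p_0(0)` equals the number of combinatorial types of Golomb
rulers with `m+1` markings. -/
theorem golombCount_quasipolynomial_and_types (m : ℕ) (hm : 1 ≤ m) :
    (∃ s : ℕ, 0 < s ∧ ∃ p : ℕ → Polynomial ℚ,
      (∀ i < s, (p i).natDegree = m - 1 ∧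
        (p i).leadingCoeff = 1 / (Nat.factorial (m - 1) : ℚ)) ∧
      ∀ t : ℕ, 0 < t → (golombCount m (t : ℤ) : ℚ) = (p (t % s)).eval (t : ℚ)) ∧
    (∀ s : ℕ, 1 ≤ s → ∀ p : ℕ → Polynomial ℚ,
      (∀ t : ℕ, 0 < t → (golombCount m (t : ℤ) : ℚ) = (p (t % s)).eval (t : ℚ)) →
      (-1 : ℚ) ^ (m - 1) * (p 0).eval 0 = Nat.card (Quotient (golombSetoid m))) := by
  obtain ⟨k, rfl⟩ := Nat.exists_eq_add_of_le' hm
  obtain ⟨s, hs, P, hdeg, heval, hP0⟩ := isQuasiPoly_golombCount k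
  rw [Nat.add_sub_cancel]
  refine ⟨⟨s, hs, P, fun i hi => ?_, heval⟩, fun s' hs' p hp => ?_⟩
  · have hc : (P i).coeff k = 1 / (k.factorial : ℚ) :=
      Polynomial.coeff_eq_of_eval_eq (hdeg i) hi (tendsto_golombCount_div_pow k)
        fun t ht hti => by rw [heval t ht, hti]
    have hk : (P i).natDegree = k := by
      refine (hdeg i).antisymm (Polynomial.le_natDegree_of_ne_zero ?_)
      rw [hc]
      have := k.factorial_ne_zero
      positivity
    exact ⟨hk, by rw [Polynomial.leadingCoeff, hk, hc]⟩
  · have hpP : p 0 = P 0 := by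
      refine Polynomial.eq_of_infinite_eval_eq _ _
        (Set.infinite_of_injective_forall_mem (f := fun n : ℕ => ((s * s' * (n + 1) : ℕ) : ℚ))
          (fun a b h => ?_) fun n => ?_)
      · have h' : s * s' * (a + 1) = s * s' * (b + 1) := by
          dsimp only at h
          exact_mod_cast h
        exact Nat.succ_injective (Nat.eq_of_mul_eq_mul_left (Nat.mul_pos hs hs') h')
      · have ht : 0 < s * s' * (n + 1) := by positivity
        have h1 := hp _ ht
        have h2 := heval _ ht
        rw [mul_assoc, Nat.mul_mod_right, ← mul_assoc] at h2
        rw [mul_comm s s', mul_assoc, Nat.mul_mod_right, ← mul_assoc, mul_comm s' s] at h1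
        exact h1.symm.trans h2
    rw [hpP, hP0, mul_left_comm, ← mul_pow]
    simp
end
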